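/- Let c be a real number with 1 < c < 4109054/1999527 and c ≠ 2, let ε > 0 be fixed and sufficiently small, let P be sufficiently large, and τ = P^{1-c-ε}. Then for every α ∈ (τ, 1-τ), S(α) ≪ P^{2627349/2666036 + ε}, with implied constant depending only on c and ε. -/

import Mathlib

open scoped Classical
open Finset Real

/-- `eC x = e(x) = e^{2πix}`. -/
noncomputable def eC (x : ℝ) : ℂ := Complex.exp ((2 * Real.pi * x : ℝ) * Complex.I)

/-- `SS c P α = S(α) = Σ_{p ≤ P} (log p) e([p^c]α)`, the sum over primes `p ≤ P`. -/
noncomputable def SS (c P α : ℝ) : ℂ :=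
  ∑ p ∈ (Finset.range (⌊P⌋₊ + 1)).filter Nat.Prime,
    (Real.log p : ℂ) * eC ((⌊(p : ℝ) ^ c⌋ : ℝ) * α)

/-! ### The additive character -/

lemma norm_eC (x : ℝ) : ‖eC x‖ = 1 := Complex.norm_exp_ofReal_mul_I _

lemma eC_add (x y : ℝ) : eC (x + y) = eC x * eC y := by
  simp only [eC, ← Complex.exp_add]; congr 1; push_cast; ring

lemma eC_zero : eC 0 = 1 := by simp [eC]

lemma eC_intCast (n : ℤ) : eC n = 1 := by
  rw [eC, Complex.exp_eq_one_iff]; exact ⟨n, by push_cast; ring⟩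

lemma conj_eC (x : ℝ) : starRingEnd ℂ (eC x) = eC (-x) := by
  simp only [eC, ← Complex.exp_conj, map_mul, Complex.conj_ofReal, Complex.conj_I]
  congr 1; push_cast; ring

lemma eC_sub (x y : ℝ) : eC (x - y) = eC x * starRingEnd ℂ (eC y) := by
  rw [conj_eC, ← eC_add, sub_eq_add_neg]

lemma eC_eq_cos_add_sin (x : ℝ) :
    eC x = ((cos (2 * π * x) : ℝ) : ℂ) + ((sin (2 * π * x) : ℝ) : ℂ) * Complex.I := by
  rw [eC, Complex.exp_mul_I, Complex.ofReal_cos, Complex.ofReal_sin]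

lemma norm_one_sub_eC (x : ℝ) : ‖1 - eC x‖ = 2 * |sin (π * x)| := by
  have h : eC x - 1 = Complex.exp (Complex.I * ((2 * π * x : ℝ) : ℂ)) - 1 := by
    rw [eC, mul_comm]
  rw [norm_sub_rev, h, Complex.norm_exp_I_mul_ofReal_sub_one]
  rw [norm_mul, Real.norm_eq_abs, Real.norm_eq_abs, abs_two]
  congr 3; ring

lemma norm_eC_sub_eC_le (x y : ℝ) : ‖eC x - eC y‖ ≤ 2 * π * |x - y| := by
  have h : eC x - eC y = -(eC y * (1 - eC (x - y))) := by
    have := eC_add y (x - y)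
    rw [add_sub_cancel] at this
    rw [this]; ring
  rw [h, norm_neg, norm_mul, norm_eC, one_mul, norm_one_sub_eC]
  have := Real.abs_sin_le_abs (x := π * (x - y))
  rw [abs_mul, abs_of_pos pi_pos] at this
  linarith

lemma norm_sum_eC_le_card {ι : Type*} (s : Finset ι) (f : ι → ℝ) :
    ‖∑ i ∈ s, eC (f i)‖ ≤ s.card := by
  refine (norm_sum_le _ _).trans ?_
  simp [norm_eC]

lemma norm_sum_eC_neg {ι : Type*} (s : Finset ι) (f : ι → ℝ) :
    ‖∑ i ∈ s, eC (-f i)‖ = ‖∑ i ∈ s, eC (f i)‖ := by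
  simp_rw [← conj_eC, ← map_sum]
  exact RCLike.norm_conj _

lemma two_mul_le_sin_pi_mul {ρ d : ℝ} (h0 : 0 ≤ ρ) (h1 : ρ ≤ d) (h2 : d ≤ 1 - ρ) :
    2 * ρ ≤ sin (π * d) := by
  have key : ∀ y : ℝ, 0 ≤ y → y ≤ 1 / 2 → 2 * y ≤ sin (π * y) := by
    intro y hy hy'
    have := Real.mul_le_sin (x := π * y) (by positivity) (by nlinarith [pi_pos])
    have e : 2 / π * (π * y) = 2 * y := by field_simp
    linarith
  rcases le_total d (1 / 2) with h | h
  · linarith [key d (by linarith) h]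
  · have := key (1 - d) (by linarith) (by linarith)
    rw [mul_sub π, mul_one, Real.sin_pi_sub] at this
    linarith

/-! ### The Kusmin–Landau inequality -/

lemma one_sub_eC_mul_cot {x : ℝ} (h : sin (π * x) ≠ 0) :
    (1 - eC x) * (1 / 2 + ((cos (π * x) / sin (π * x) / 2 : ℝ) : ℂ) * Complex.I) = 1 := by
  rw [eC_eq_cos_add_sin, show 2 * π * x = 2 * (π * x) by ring, Real.cos_two_mul, Real.sin_two_mul]
  have hs : ((sin (π * x) : ℝ) : ℂ) ≠ 0 := by exact_mod_cast h
  have h1 : ((sin (π * x) : ℝ) : ℂ) ^ 2 + ((cos (π * x) : ℝ) : ℂ) ^ 2 = 1 := by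
    exact_mod_cast Real.sin_sq_add_cos_sq (π * x)
  generalize sin (π * x) = s at *
  generalize cos (π * x) = t at *
  push_cast
  field_simp
  ring_nf
  simp only [Complex.I_sq]
  linear_combination (- 2 * Complex.I * t) * h1

lemma abs_cot_le {ρ x : ℝ} (hρ : 0 < ρ) (h : 2 * ρ ≤ sin (π * x)) :
    |cos (π * x) / sin (π * x)| ≤ 1 / (2 * ρ) := by
  have hs : 0 < sin (π * x) := by linarith
  rw [abs_div, abs_of_pos hs]
  gcongr
  exact abs_cos_le_one _

/-- The **Kusmin–Landau inequality**. -/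
lemma norm_sum_eC_le_of_monotone (f : ℕ → ℝ) (L : ℕ) {ρ : ℝ} (hρ : 0 < ρ) (ν : ℤ)
    (hd : ∀ i < L, ν + ρ ≤ f (i + 1) - f i ∧ f (i + 1) - f i ≤ ν + 1 - ρ)
    (hm : ∀ i, i + 1 < L → f (i + 1) - f i ≤ f (i + 2) - f (i + 1)) :
    ‖∑ i ∈ range L, eC (f i)‖ ≤ 2 / ρ := by
  set d : ℕ → ℝ := fun i => f (i + 1) - f i - ν with hdd
  set ct : ℕ → ℝ := fun i => cos (π * d i) / sin (π * d i) with hct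
  set w : ℕ → ℂ := fun i => 1 / 2 + ((ct i / 2 : ℝ) : ℂ) * Complex.I with hw
  have hsin : ∀ i < L, 2 * ρ ≤ sin (π * d i) := fun i hi => by
    have := hd i hi
    exact two_mul_le_sin_pi_mul hρ.le (by simp only [hdd]; linarith) (by simp only [hdd]; linarith)
  have hstep : ∀ i < L, eC (f i) = (eC (f i) - eC (f (i + 1))) * w i := fun i hi => by
    have h1 : eC (f (i + 1)) = eC (f i) * eC (d i) := by
      rw [show f (i + 1) = (f i + d i) + (ν : ℤ) by simp only [hdd]; ring, eC_add, eC_add, eC_intCast, mul_one]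
    have h2 := one_sub_eC_mul_cot (x := d i) (by linarith [hsin i hi])
    rw [h1]
    linear_combination (- eC (f i)) * h2
  have hctb : ∀ i < L, |ct i| ≤ 1 / (2 * ρ) := fun i hi => abs_cot_le hρ (hsin i hi)
  have hρ2 : ∀ i < L, ρ ≤ 1 / 2 := fun i hi => by have := hd i hi; linarith
  have hwb : ∀ i < L, ‖w i‖ ≤ 1 / 2 + 1 / (4 * ρ) := fun i hi => by
    refine (norm_add_le _ _).trans ?_
    rw [norm_mul, Complex.norm_I, mul_one, Complex.norm_real, Real.norm_eq_abs, abs_div, abs_two]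
    have := hctb i hi
    have e : 1 / (4 * ρ) = 1 / (2 * ρ) / 2 := by field_simp; norm_num
    rw [e]
    norm_num
    norm_num at this
    linarith
  have hmono : ∀ i, i + 1 < L → ct (i + 1) ≤ ct i := fun i hi => by
    have h1 := hsin i (by omega)
    have h2 := hsin (i + 1) hi
    have hdle : d i ≤ d (i + 1) := by have := hm i hi; simp only [hdd]; linarith
    have hd1 := hd i (by omega)
    have hd2 := hd (i + 1) hi
    simp only [hct]
    rw [div_le_div_iff₀ (by linarith) (by linarith)]
    have : 0 ≤ sin (π * d (i + 1) - π * d i) := by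
      apply Real.sin_nonneg_of_nonneg_of_le_pi
      · nlinarith [pi_pos]
      · have : d (i + 1) - d i ≤ 1 := by simp only [hdd]; linarith
        nlinarith [pi_pos]
    rw [Real.sin_sub] at this
    linarith
  have main : ∀ n, n + 1 ≤ L →
      ‖∑ i ∈ range (n + 1), eC (f i) + w n * eC (f (n + 1))‖ ≤ ‖w 0‖ + (ct 0 - ct n) / 2 := by
    intro n
    induction n with
    | zero =>
      intro hn
      have := hstep 0 hn
      simp only [zero_add, range_one, sum_singleton, sub_self, zero_div, add_zero]
      have e : eC (f 0) + w 0 * eC (f 1) = eC (f 0) * w 0 := by linear_combination this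
      rw [e, norm_mul, norm_eC, one_mul]
    | succ n ih =>
      intro hn
      have h1 := ih (by omega)
      have h2 := hstep (n + 1) (by omega)
      have e : ∑ i ∈ range (n + 1 + 1), eC (f i) + w (n + 1) * eC (f (n + 1 + 1)) =
          (∑ i ∈ range (n + 1), eC (f i) + w n * eC (f (n + 1))) +
            (w (n + 1) - w n) * eC (f (n + 1)) := by
        rw [sum_range_succ]
        linear_combination h2
      have e2 : w (n + 1) - w n = (((ct (n + 1) - ct n) / 2 : ℝ) : ℂ) * Complex.I := by
        simp only [hw]; push_cast; ring
      rw [e]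
      refine (norm_add_le _ _).trans ?_
      rw [norm_mul, norm_eC, mul_one, e2, norm_mul, Complex.norm_I, mul_one, Complex.norm_real,
        Real.norm_eq_abs, abs_of_nonpos (by linarith [hmono n (by omega)])]
      linarith
  rcases Nat.eq_zero_or_pos L with rfl | hL
  · simp; positivity
  obtain ⟨n, rfl⟩ : ∃ n, L = n + 1 := ⟨L - 1, by omega⟩
  have h1 := main n le_rfl
  have h2 := hwb 0 hL
  have h3 := hwb n (by omega)
  have h4 := abs_le.1 (hctb 0 hL)
  have h5 := abs_le.1 (hctb n (by omega))
  have h6 : ‖∑ i ∈ range (n + 1), eC (f i)‖ ≤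
      ‖∑ i ∈ range (n + 1), eC (f i) + w n * eC (f (n + 1))‖ + ‖w n‖ := by
    have := norm_sub_le (∑ i ∈ range (n + 1), eC (f i) + w n * eC (f (n + 1)))
      (w n * eC (f (n + 1)))
    rwa [add_sub_cancel_right, norm_mul (w n), norm_eC, mul_one] at this
  have h7 : 1 / (4 * ρ) = 1 / ρ / 4 := by field_simp
  have h8 : 1 / (2 * ρ) = 1 / ρ / 2 := by field_simp
  have h9 : 1 ≤ 1 / ρ := by rw [le_div_iff₀ hρ]; linarith [hρ2 0 hL]
  have h10 : 2 / ρ = 2 * (1 / ρ) := by ring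
  rw [h7] at h2 h3
  rw [h8] at h4 h5
  rw [h10]
  linarith

/-! ### The second derivative test -/

lemma exists_filter_range_eq_Ico {d : ℕ → ℝ} {n : ℕ} (hd : ∀ i j, i ≤ j → j < n → d i ≤ d j)
    (x y : ℝ) : ∃ a b, a ≤ b ∧ b ≤ n ∧ (range n).filter (fun i => x ≤ d i ∧ d i < y) = Ico a b := by
  set s := (range n).filter (fun i => x ≤ d i ∧ d i < y) with hs
  rcases s.eq_empty_or_nonempty with h | h
  · exact ⟨0, 0, le_rfl, Nat.zero_le _, by simp [h]⟩
  · have h1 := mem_filter.1 (s.min'_mem h)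
    have h2 := mem_filter.1 (s.max'_mem h)
    rw [mem_range] at h1 h2
    refine ⟨s.min' h, s.max' h + 1, (s.min'_le _ (s.max'_mem h)).trans (Nat.le_succ _), h2.1, ?_⟩
    ext i
    constructor
    · intro hi
      rw [mem_Ico]
      exact ⟨s.min'_le _ hi, Nat.lt_succ_of_le (s.le_max' _ hi)⟩
    · intro hi
      rw [mem_Ico, Nat.lt_succ_iff] at hi
      rw [hs, mem_filter, mem_range]
      have h3 := hd _ _ hi.1 (by omega)
      have h4 := hd _ _ hi.2 h2.1
      exact ⟨by omega, by linarith [h1.2.1], by linarith [h2.2.2]⟩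

lemma mul_sub_le_of_le_diff {d : ℕ → ℝ} {n : ℕ} {lam : ℝ}
    (hd : ∀ i, i + 1 < n → lam ≤ d (i + 1) - d i) (i j : ℕ) (hij : i ≤ j) (hj : j < n) :
    ((j : ℝ) - i) * lam ≤ d j - d i := by
  induction j, hij using Nat.le_induction with
  | base => simp
  | succ j hij ih =>
    have h1 := ih (by omega)
    have h2 := hd j hj
    push_cast
    linarith

lemma le_mul_sub_of_diff_le {d : ℕ → ℝ} {n : ℕ} {lam : ℝ}
    (hd : ∀ i, i + 1 < n → d (i + 1) - d i ≤ lam) (i j : ℕ) (hij : i ≤ j) (hj : j < n) :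
    d j - d i ≤ ((j : ℝ) - i) * lam := by
  induction j, hij using Nat.le_induction with
  | base => simp
  | succ j hij ih =>
    have h1 := ih (by omega)
    have h2 := hd j hj
    push_cast
    linarith

lemma card_filter_range_le {d : ℕ → ℝ} {n : ℕ} {lam : ℝ} (hlam : 0 < lam)
    (hd : ∀ i, i + 1 < n → lam ≤ d (i + 1) - d i) {x y : ℝ} (hxy : x ≤ y) :
    (((range n).filter (fun i => x ≤ d i ∧ d i < y)).card : ℝ) ≤ (y - x) / lam + 1 := by
  have hmono : ∀ i j, i ≤ j → j < n → d i ≤ d j := fun i j hij hj => by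
    have := mul_sub_le_of_le_diff hd i j hij hj
    have h2 : (i : ℝ) ≤ j := by exact_mod_cast hij
    nlinarith
  obtain ⟨a, b, hab, hbn, h⟩ := exists_filter_range_eq_Ico hmono x y
  rw [h, Nat.card_Ico]
  rcases hab.eq_or_lt with rfl | hlt
  · simp only [le_refl, tsub_eq_zero_of_le, Nat.cast_zero]
    have : 0 ≤ (y - x) / lam := div_nonneg (by linarith) hlam.le
    linarith
  · have ha : a ∈ (range n).filter (fun i => x ≤ d i ∧ d i < y) := by rw [h, mem_Ico]; omega
    have hb : b - 1 ∈ (range n).filter (fun i => x ≤ d i ∧ d i < y) := by rw [h, mem_Ico]; omega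
    rw [mem_filter] at ha hb
    have := mul_sub_le_of_le_diff hd a (b - 1) (by omega) (by omega)
    rw [Nat.cast_sub (by omega)] at *
    have : (b : ℝ) - a - 1 ≤ (y - x) / lam := by
      rw [le_div_iff₀ hlam]
      push_cast at this
      nlinarith [ha.2.1, hb.2.2]
    linarith

/-- The **second derivative test**, for a sequence with controlled second differences. -/
lemma norm_sum_eC_le_of_second_diff {f : ℕ → ℝ} {n : ℕ} {lam C : ℝ} (hlam : 0 < lam) (hC : 1 ≤ C)
    (hf : ∀ i, i + 1 < n → lam ≤ (f (i + 2) - f (i + 1)) - (f (i + 1) - f i) ∧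
      (f (i + 2) - f (i + 1)) - (f (i + 1) - f i) ≤ C * lam) :
    ‖∑ i ∈ range n, eC (f i)‖ ≤ 5 * C * (n * √lam) + 10 / √lam := by
  have hsq : 0 < √lam := Real.sqrt_pos.2 hlam
  have hss : √lam * √lam = lam := Real.mul_self_sqrt hlam.le
  rcases Nat.eq_zero_or_pos n with rfl | hn
  · simp; positivity
  have hn0 : (0 : ℝ) < n := by exact_mod_cast hn
  by_cases hbig : 1 / 4 < √lam
  · refine (norm_sum_eC_le_card _ _).trans ?_
    rw [card_range]
    have h1 : (n : ℝ) ≤ 5 * (n * √lam) := by nlinarith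
    have h2 : 5 * (n * √lam) ≤ 5 * C * (n * √lam) := by nlinarith [mul_pos hn0 hsq]
    have h3 : 0 ≤ 10 / √lam := by positivity
    linarith
  push Not at hbig
  set ρ := √lam with hρ
  set d : ℕ → ℝ := fun i => f (i + 1) - f i with hdd
  have hd1 : ∀ i, i + 1 < n → lam ≤ d (i + 1) - d i := fun i hi => (hf i hi).1
  have hd2 : ∀ i, i + 1 < n → d (i + 1) - d i ≤ C * lam := fun i hi => (hf i hi).2
  have hmono : ∀ i j, i ≤ j → j < n → d i ≤ d j := fun i j hij hj => by
    have := mul_sub_le_of_le_diff hd1 i j hij hj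
    have h2 : (i : ℝ) ≤ j := by exact_mod_cast hij
    nlinarith
  have hfiber : ∀ ν : ℤ, ‖∑ i ∈ (range n).filter (fun i => ⌊d i⌋ = ν), eC (f i)‖ ≤ 5 / ρ := by
    intro ν
    have hsplit : ∑ i ∈ (range n).filter (fun i => ⌊d i⌋ = ν), eC (f i) =
        ∑ i ∈ (range n).filter (fun i => (ν : ℝ) ≤ d i ∧ d i < ν + ρ), eC (f i) +
        ∑ i ∈ (range n).filter (fun i => (ν : ℝ) + ρ ≤ d i ∧ d i < ν + 1 - ρ), eC (f i) +
        ∑ i ∈ (range n).filter (fun i => (ν : ℝ) + 1 - ρ ≤ d i ∧ d i < ν + 1), eC (f i) := by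
      simp only [sum_filter, ← sum_add_distrib]
      refine sum_congr rfl fun i _ => ?_
      simp only [Int.floor_eq_iff]
      split_ifs <;> first | (simp; done) | (exfalso; grind)
    have e1 := card_filter_range_le hlam hd1 (x := ν) (y := ν + ρ) (by linarith)
    have e3 := card_filter_range_le hlam hd1 (x := ν + 1 - ρ) (y := ν + 1) (by linarith)
    have e2 : ‖∑ i ∈ (range n).filter (fun i => (ν : ℝ) + ρ ≤ d i ∧ d i < ν + 1 - ρ), eC (f i)‖
        ≤ 2 / ρ := by
      obtain ⟨a, b, hab, hbn, h⟩ := exists_filter_range_eq_Ico hmono (ν + ρ) (ν + 1 - ρ)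
      rw [h, sum_Ico_eq_sum_range]
      apply norm_sum_eC_le_of_monotone (fun i => f (a + i)) (b - a) hsq ν
      · intro i hi
        have : a + i ∈ Ico a b := by rw [mem_Ico]; omega
        rw [← h, mem_filter] at this
        exact ⟨this.2.1, this.2.2.le⟩
      · intro i hi
        have := hd1 (a + i) (by omega)
        simp only [hdd] at this
        rw [show a + (i + 1) = a + i + 1 by ring, show a + (i + 2) = a + i + 1 + 1 by ring]
        linarith
    have hρlam : ρ / lam = 1 / ρ := by rw [← hss]; field_simp
    rw [show (ν : ℝ) + ρ - ν = ρ by ring, hρlam] at e1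
    rw [show (ν : ℝ) + 1 - (ν + 1 - ρ) = ρ by ring, hρlam] at e3
    rw [hsplit]
    have h1 := norm_sum_eC_le_card ((range n).filter (fun i => (ν : ℝ) ≤ d i ∧ d i < ν + ρ)) f
    have h3 := norm_sum_eC_le_card
      ((range n).filter (fun i => (ν : ℝ) + 1 - ρ ≤ d i ∧ d i < ν + 1)) f
    refine (norm_add₃_le).trans ?_
    have h4 : 4 ≤ 1 / ρ := by rw [le_div_iff₀ hsq]; linarith
    have h5 : 5 / ρ = 5 * (1 / ρ) := by ring
    have h6 : 2 / ρ = 2 * (1 / ρ) := by ring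
    rw [h5]; rw [h6] at e2
    linarith
  have hmaps : ∀ i ∈ range n, ⌊d i⌋ ∈ Icc ⌊d 0⌋ ⌊d (n - 1)⌋ := fun i hi => by
    rw [mem_range] at hi
    rw [mem_Icc]
    exact ⟨Int.floor_le_floor (hmono 0 i (Nat.zero_le _) hi),
      Int.floor_le_floor (hmono i (n - 1) (by omega) (by omega))⟩
  rw [← sum_fiberwise_of_maps_to hmaps]
  refine (norm_sum_le _ _).trans ((sum_le_sum fun ν _ => hfiber ν).trans ?_)
  rw [sum_const, nsmul_eq_mul]
  have hcard : ((Icc ⌊d 0⌋ ⌊d (n - 1)⌋).card : ℝ) ≤ C * lam * n + 2 := by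
    have h0 : ⌊d 0⌋ ≤ ⌊d (n - 1)⌋ := Int.floor_le_floor (hmono 0 (n - 1) (by omega) (by omega))
    have h1 := le_mul_sub_of_diff_le hd2 0 (n - 1) (by omega) (by omega)
    rw [Int.card_Icc]
    have h2 : (((⌊d (n - 1)⌋ + 1 - ⌊d 0⌋).toNat : ℤ) : ℝ) = ⌊d (n - 1)⌋ + 1 - ⌊d 0⌋ := by
      rw [Int.toNat_of_nonneg (by omega)]; push_cast; ring
    rw [← Int.cast_natCast, h2]
    have h3 := Int.floor_le (d (n - 1))
    have h4 := Int.lt_floor_add_one (d 0)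
    have h5 : ((n - 1 : ℕ) : ℝ) ≤ n := by exact_mod_cast Nat.sub_le n 1
    have h6 : ((n - 1 : ℕ) : ℝ) * (C * lam) ≤ n * (C * lam) := by gcongr
    push_cast at h1
    linarith
  calc _ ≤ (C * lam * n + 2) * (5 / ρ) := by gcongr
    _ = 5 * C * (n * (lam / ρ)) + 10 / ρ := by ring
    _ = 5 * C * (n * ρ) + 10 / ρ := by
      congr 3; rw [div_eq_iff hsq.ne', hss]

/-! ### The Weyl–van der Corput inequality -/

lemma sum_range_dist_le {r : ℕ → ℝ} (hr : ∀ h, 0 ≤ r h) {H a : ℕ} (ha : a < H) :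
    ∑ b ∈ range H, r (Nat.dist a b) ≤ 2 * ∑ h ∈ range H, r h := by
  have h1 : ∑ b ∈ (range H).filter (fun b => b ≤ a), r (Nat.dist a b) ≤ ∑ h ∈ range H, r h := by
    rw [← sum_image (f := r) (g := fun b => Nat.dist a b)]
    · refine sum_le_sum_of_subset_of_nonneg ?_ fun _ _ _ => hr _
      intro x hx
      simp only [mem_image, mem_filter, mem_range, Nat.dist] at hx ⊢
      omega
    · intro x hx y hy hxy
      simp only [coe_filter, mem_range, Set.mem_ofPred_eq, Nat.dist] at hx hy hxy
      omega
  have h2 : ∑ b ∈ (range H).filter (fun b => ¬ b ≤ a), r (Nat.dist a b) ≤ ∑ h ∈ range H, r h := by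
    rw [← sum_image (f := r) (g := fun b => Nat.dist a b)]
    · refine sum_le_sum_of_subset_of_nonneg ?_ fun _ _ _ => hr _
      intro x hx
      simp only [mem_image, mem_filter, mem_range, Nat.dist] at hx ⊢
      omega
    · intro x hx y hy hxy
      simp only [coe_filter, mem_range, Set.mem_ofPred_eq, Nat.dist] at hx hy hxy
      omega
  rw [← sum_filter_add_sum_filter_not (range H) (fun b => b ≤ a)]
  linarith

/-- The **Weyl–van der Corput inequality** for exponential sums. -/
lemma norm_sum_eC_sq_le (f : ℕ → ℝ) {L H : ℕ} (hH : 1 ≤ H) (hHL : H ≤ L) :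
    ‖∑ i ∈ range L, eC (f i)‖ ^ 2 ≤
      4 * L / H * ∑ h ∈ range H, ‖∑ i ∈ range (L - h), eC (f (i + h) - f i)‖ := by
  set r : ℕ → ℝ := fun h => ‖∑ i ∈ range (L - h), eC (f (i + h) - f i)‖ with hr
  set S := ∑ i ∈ range L, eC (f i) with hS
  set Z : ℕ → ℕ → ℂ := fun n h => if h ≤ n ∧ n - h < L then eC (f (n - h)) else 0 with hZ
  have hshift : ∀ h ∈ range H, ∑ n ∈ range (L + H), Z n h = S := by
    intro h hh
    rw [mem_range] at hh
    symm
    apply sum_of_injOn (fun i => i + h)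
    · intro x _ y _ hxy; simpa using hxy
    · intro x hx; simp only [coe_range, Set.mem_Iio] at hx ⊢; omega
    · intro n _ hn'
      simp only [hZ]
      rw [if_neg]
      rintro ⟨h1, h2⟩
      exact hn' ⟨n - h, by simpa using h2, by simp only; omega⟩
    · intro i hi
      rw [mem_range] at hi
      simp only [hZ]
      rw [if_pos (by omega), Nat.add_sub_cancel]
  have hcorr : ∀ a b, a ≤ b → b < H →
      ∑ n ∈ range (L + H), Z n a * starRingEnd ℂ (Z n b) =
        ∑ i ∈ range (L - (b - a)), eC (f (i + (b - a)) - f i) := by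
    intro a b hab hb
    symm
    apply sum_of_injOn (fun i => i + b)
    · intro x _ y _ hxy; simpa using hxy
    · intro x hx; simp only [coe_range, Set.mem_Iio] at hx ⊢; omega
    · intro n _ hn'
      simp only [hZ]
      by_cases h1 : a ≤ n ∧ n - a < L
      · by_cases h2 : b ≤ n ∧ n - b < L
        · exfalso
          refine hn' ⟨n - b, ?_, ?_⟩
          · simp only [coe_range, Set.mem_Iio]; omega
          · simp only; omega
        · rw [if_neg h2]; simp
      · rw [if_neg h1]; simp
    · intro i hi
      rw [mem_range] at hi
      simp only [hZ]
      rw [if_pos (by omega), if_pos (by omega), eC_sub, Nat.add_sub_cancel,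
        show i + b - a = i + (b - a) by omega]
  have hcorr' : ∀ a ∈ range H, ∀ b ∈ range H,
      ‖∑ n ∈ range (L + H), Z n a * starRingEnd ℂ (Z n b)‖ = r (Nat.dist a b) := by
    intro a ha b hb
    rw [mem_range] at ha hb
    rcases le_total a b with h | h
    · rw [hcorr a b h hb, Nat.dist_eq_sub_of_le h]
    · rw [Nat.dist_comm, Nat.dist_eq_sub_of_le h]
      simp only [hr]
      rw [← hcorr b a h ha, ← RCLike.norm_conj, map_sum]
      congr 1
      refine sum_congr rfl fun n _ => ?_
      rw [map_mul, Complex.conj_conj, mul_comm]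
  have hHS : (H : ℂ) * S = ∑ n ∈ range (L + H), ∑ h ∈ range H, Z n h := by
    rw [sum_comm, sum_congr rfl hshift]; simp
  have hexp : ((∑ n ∈ range (L + H), ‖∑ h ∈ range H, Z n h‖ ^ 2 : ℝ) : ℂ) =
      ∑ a ∈ range H, ∑ b ∈ range H, ∑ n ∈ range (L + H), Z n a * starRingEnd ℂ (Z n b) := by
    push_cast
    simp_rw [← Complex.mul_conj', map_sum, sum_mul_sum]
    rw [sum_comm]
    refine sum_congr rfl fun a _ => ?_
    rw [sum_comm]
  have hbound : ∑ n ∈ range (L + H), ‖∑ h ∈ range H, Z n h‖ ^ 2 ≤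
      2 * H * ∑ h ∈ range H, r h := by
    have h0 : (∑ n ∈ range (L + H), ‖∑ h ∈ range H, Z n h‖ ^ 2) =
        ‖((∑ n ∈ range (L + H), ‖∑ h ∈ range H, Z n h‖ ^ 2 : ℝ) : ℂ)‖ := by
      rw [Complex.norm_real, Real.norm_of_nonneg (by positivity)]
    rw [h0, hexp]
    refine (norm_sum_le _ _).trans ?_
    have h1 : ∀ a ∈ range H,
        ‖∑ b ∈ range H, ∑ n ∈ range (L + H), Z n a * starRingEnd ℂ (Z n b)‖ ≤
          2 * ∑ h ∈ range H, r h := by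
      intro a ha
      refine (norm_sum_le _ _).trans ?_
      rw [sum_congr rfl (hcorr' a ha)]
      exact sum_range_dist_le (r := r) (fun _ => norm_nonneg _) (mem_range.1 ha)
    refine (sum_le_sum h1).trans ?_
    rw [sum_const, card_range, nsmul_eq_mul]
    exact le_of_eq (by ring)
  have hCS : ((H : ℝ) * ‖S‖) ^ 2 ≤ (L + H) * ∑ n ∈ range (L + H), ‖∑ h ∈ range H, Z n h‖ ^ 2 := by
    have h1 : (H : ℝ) * ‖S‖ = ‖(H : ℂ) * S‖ := by rw [norm_mul, Complex.norm_natCast]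
    have h2 := sq_sum_le_card_mul_sum_sq (s := range (L + H)) (f := fun n => ‖∑ h ∈ range H, Z n h‖)
    rw [card_range] at h2
    push_cast at h2
    rw [h1, hHS]
    refine le_trans ?_ h2
    gcongr
    exact norm_sum_le _ _
  have hH0 : (0 : ℝ) < H := by exact_mod_cast hH
  have hHL' : (H : ℝ) ≤ L := by exact_mod_cast hHL
  have hr1 : ∀ h, 0 ≤ r h := fun h => norm_nonneg _
  have hr0 : 0 ≤ ∑ h ∈ range H, r h := sum_nonneg fun h _ => hr1 h
  have h3 : ((H : ℝ) * ‖S‖) ^ 2 ≤ (2 * L) * (2 * H * ∑ h ∈ range H, r h) := by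
    refine hCS.trans ?_
    gcongr
    linarith
  rw [div_mul_eq_mul_div, le_div_iff₀ hH0]
  have h4 : H * (‖S‖ ^ 2 * H) ≤ H * (4 * L * ∑ h ∈ range H, r h) := by linarith
  exact le_of_mul_le_mul_left h4 hH0

/-! ### The `k`-th derivative test -/

/-- `DiffBd k lam C L f`: the `k`-fold multi-step differences of `f` on `[0, L)`, divided by the
product of the steps, all lie in `[lam, C * lam]`. -/
def DiffBd : ℕ → ℝ → ℝ → ℕ → (ℕ → ℝ) → Prop
  | 0, lam, C, L, f => ∀ i < L, lam ≤ f i ∧ f i ≤ C * lam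
  | k + 1, lam, C, L, f =>
      ∀ h, 1 ≤ h → h < L → DiffBd k (h * lam) C (L - h) (fun i => f (i + h) - f i)

lemma sum_Ico_rpow_neg_le {a : ℝ} (ha0 : 0 ≤ a) (ha : a ≤ 1 / 2) (H : ℕ) :
    ∑ h ∈ Ico 1 (H + 1), (h : ℝ) ^ (-a) ≤ 2 * (H : ℝ) ^ (1 - a) := by
  induction H with
  | zero => simp; positivity
  | succ n ih =>
    rw [sum_Ico_succ_top (by omega)]
    refine (add_le_add_left ih _).trans ?_
    set m : ℝ := ((n + 1 : ℕ) : ℝ) with hm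
    have hm0 : 0 < m := by rw [hm]; positivity
    have hm1 : 1 ≤ m := by rw [hm]; push_cast; linarith [(Nat.cast_nonneg n : (0 : ℝ) ≤ n)]
    have hn : (n : ℝ) = m * (1 + -(1 / m)) := by rw [hm]; push_cast; field_simp; ring
    have hinv : 1 / m ≤ 1 := by rw [div_le_one hm0]; exact hm1
    have h1 : (1 + -(1 / m)) ^ (1 - a) ≤ 1 + (1 - a) * -(1 / m) :=
      rpow_one_add_le_one_add_mul_self (by linarith) (by linarith) (by linarith)
    rw [hn, Real.mul_rpow hm0.le (by linarith)]
    have h2 : m ^ (1 - a) = m * m ^ (-a) := by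
      rw [sub_eq_add_neg, Real.rpow_add hm0, Real.rpow_one]
    have h3 : 0 < m ^ (-a) := by positivity
    rw [h2]
    have h4 : m * m ^ (-a) * (1 + -(1 / m)) ^ (1 - a) ≤
        m * m ^ (-a) * (1 + (1 - a) * -(1 / m)) := by gcongr
    have h5 : m * m ^ (-a) * (1 + (1 - a) * -(1 / m)) = m * m ^ (-a) - (1 - a) * m ^ (-a) := by
      field_simp; ring
    nlinarith

/-- The bound for exponential sums with controlled `k`-th differences, with exponents `a`, `b`. -/
def DiffTest (k : ℕ) (a b : ℝ) : Prop :=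
  ∀ C : ℝ, 1 ≤ C → ∃ K : ℝ, 1 ≤ K ∧ ∀ (L : ℕ) (lam : ℝ) (f : ℕ → ℝ), 0 < lam →
    DiffBd k lam C L f →
      ‖∑ i ∈ range L, eC (f i)‖ ≤ K * (L * lam ^ a + (L : ℝ) ^ b * lam ^ (-a))

lemma diffTest_two : DiffTest 2 (1 / 2) 0 := by
  intro C hC
  refine ⟨5 * C + 11, by linarith, fun L lam f hlam hf => ?_⟩
  have hsq : 0 < √lam := Real.sqrt_pos.2 hlam
  rw [Real.rpow_zero, one_mul, Real.rpow_neg hlam.le, ← Real.sqrt_eq_rpow]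
  rcases Nat.eq_zero_or_pos L with rfl | hL
  · simp; positivity
  obtain ⟨n, rfl⟩ : ∃ n, L = n + 1 := ⟨L - 1, by omega⟩
  have h1 := norm_sum_eC_le_of_second_diff (f := f) (n := n) hlam hC (by
    intro i hi
    have := hf 1 le_rfl (by omega) 1 le_rfl (by omega) i (by omega)
    simp only [Nat.cast_one, one_mul] at this
    exact this)
  rw [sum_range_succ]
  refine (norm_add_le _ _).trans ?_
  rw [norm_eC]
  have h2 : 1 ≤ √lam + (√lam)⁻¹ := by
    have : √lam * (√lam)⁻¹ = 1 := mul_inv_cancel₀ hsq.ne'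
    have h3 : 0 < (√lam)⁻¹ := by positivity
    nlinarith [sq_nonneg (√lam - (√lam)⁻¹)]
  have h4 : 10 / √lam = 10 * (√lam)⁻¹ := by ring
  have h5 : 0 < (√lam)⁻¹ := by positivity
  have h6 : (0 : ℝ) ≤ n := Nat.cast_nonneg n
  rw [h4] at h1
  push_cast
  nlinarith [mul_nonneg h6 hsq.le, mul_pos (show 0 < C by linarith) h5,
    mul_pos (show 0 < C by linarith) hsq]

set_option maxHeartbeats 1000000 in
lemma DiffTest.succ {k : ℕ} {a b : ℝ} (ha0 : 0 < a) (ha : a ≤ 1 / 2) (hb : 0 ≤ b)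
    (h : DiffTest k a b) : DiffTest (k + 1) (a / (2 * (1 + a))) ((1 + b) / 2) := by
  intro C hC
  obtain ⟨K, hK, hmain⟩ := h C hC
  refine ⟨8 + 16 * K, by linarith, fun L lam f hlam hf => ?_⟩
  set a' := a / (2 * (1 + a)) with ha'
  have ha'0 : 0 < a' := by positivity
  have htriv : ‖∑ i ∈ range L, eC (f i)‖ ≤ L := by
    simpa using norm_sum_eC_le_card (range L) f
  set X : ℝ := L * lam ^ a' with hX
  set Y : ℝ := (L : ℝ) ^ ((1 + b) / 2) * lam ^ (-a') with hY
  have hX0 : 0 ≤ X := by positivity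
  have hY0 : 0 ≤ Y := by positivity
  have htriv' : (L : ℝ) ≤ X + Y → ‖∑ i ∈ range L, eC (f i)‖ ≤ (8 + 16 * K) * (X + Y) := by
    intro hh
    refine htriv.trans (hh.trans ?_)
    nlinarith
  rcases Nat.eq_zero_or_pos L with rfl | hL
  · apply htriv'; simp only [Nat.cast_zero]; linarith
  have hL1 : (1 : ℝ) ≤ L := by exact_mod_cast hL
  by_cases hlam1 : 1 ≤ lam
  · apply htriv'
    have : 1 ≤ lam ^ a' := Real.one_le_rpow hlam1 ha'0.le
    have : (L : ℝ) ≤ X := by rw [hX]; nlinarith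
    linarith
  push Not at hlam1
  set H₀ := lam ^ (-(2 * a')) with hH₀
  have hH₀1 : 1 ≤ H₀ := Real.one_le_rpow_of_pos_of_le_one_of_nonpos hlam hlam1.le (by linarith)
  have hH₀0 : 0 < H₀ := by linarith
  by_cases hH₀L : (L : ℝ) < H₀
  · apply htriv'
    have h1 : (L : ℝ) ^ (1 / 2 : ℝ) ≤ lam ^ (-a') := by
      have : lam ^ (-a') = H₀ ^ (1 / 2 : ℝ) := by
        rw [hH₀, ← Real.rpow_mul hlam.le]; congr 1; ring
      rw [this]; gcongr
    have h2 : (L : ℝ) ^ (1 / 2 : ℝ) ≤ (L : ℝ) ^ ((1 + b) / 2) :=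
      Real.rpow_le_rpow_of_exponent_le hL1 (by linarith)
    have h3 : (L : ℝ) = (L : ℝ) ^ (1 / 2 : ℝ) * (L : ℝ) ^ (1 / 2 : ℝ) := by
      rw [← Real.rpow_add (by linarith)]; norm_num
    have : (L : ℝ) ≤ Y := by rw [hY]; nth_rewrite 1 [h3]; gcongr
    linarith
  push Not at hH₀L
  set H := ⌊H₀⌋₊ with hH
  have hH1 : 1 ≤ H := Nat.le_floor (by simpa using hH₀1)
  have hHle : (H : ℝ) ≤ H₀ := Nat.floor_le hH₀0.le
  have hHge : H₀ ≤ 2 * H := by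
    have := Nat.lt_floor_add_one H₀
    have h1 : (1 : ℝ) ≤ H := by exact_mod_cast hH1
    rw [← hH] at this
    linarith
  have hHL : H ≤ L := by exact_mod_cast hHle.trans hH₀L
  have hH0 : (0 : ℝ) < H := by exact_mod_cast hH1
  have hvdc := norm_sum_eC_sq_le f hH1 hHL
  have hE0 : 0 < lam ^ (2 * a') := by positivity
  have e1 : H₀⁻¹ = lam ^ (2 * a') := by rw [hH₀, Real.rpow_neg hlam.le, inv_inv]
  have e2 : (H₀ * lam) ^ a = lam ^ (2 * a') := by
    rw [hH₀, ← Real.rpow_add_one hlam.ne', ← Real.rpow_mul hlam.le]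
    congr 1; rw [ha']; field_simp; ring
  have e3 : (H₀ * lam) ^ (-a) = H₀ := by
    rw [Real.rpow_neg (by positivity), e2, ← e1, inv_inv]
  have hterm : ∀ h ∈ Ico 1 H, ‖∑ i ∈ range (L - h), eC (f (i + h) - f i)‖ ≤
      K * (L * lam ^ (2 * a')) + K * ((L : ℝ) ^ b * lam ^ (-a)) * (h : ℝ) ^ (-a) := by
    intro h hh
    rw [mem_Ico] at hh
    have hh0 : (0 : ℝ) < h := by exact_mod_cast hh.1
    have h1 := hmain (L - h) (h * lam) _ (by positivity) (hf h hh.1 (by omega))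
    have h2 : ((L - h : ℕ) : ℝ) ≤ L := by exact_mod_cast Nat.sub_le L h
    have h3 : (h : ℝ) ≤ H₀ := le_trans (by exact_mod_cast hh.2.le) hHle
    have h4 : ((h : ℝ) * lam) ^ a ≤ lam ^ (2 * a') := by rw [← e2]; gcongr
    have h5 : ((L - h : ℕ) : ℝ) ^ b ≤ (L : ℝ) ^ b := by gcongr
    have h6 : ((h : ℝ) * lam) ^ (-a) = lam ^ (-a) * (h : ℝ) ^ (-a) := by
      rw [Real.mul_rpow hh0.le hlam.le, mul_comm]
    calc _ ≤ _ := h1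
      _ ≤ K * (L * lam ^ (2 * a') + (L : ℝ) ^ b * (lam ^ (-a) * (h : ℝ) ^ (-a))) := by
        rw [h6]; gcongr
      _ = _ := by ring
  have hsum : ∑ h ∈ range H, ‖∑ i ∈ range (L - h), eC (f (i + h) - f i)‖ ≤
      L + (H * (K * (L * lam ^ (2 * a'))) +
        K * ((L : ℝ) ^ b * lam ^ (-a)) * (2 * (H : ℝ) ^ (1 - a))) := by
    rw [range_eq_Ico, sum_eq_sum_Ico_succ_bot (by omega)]
    refine add_le_add ?_ ?_
    · simpa using norm_sum_eC_le_card (range (L - 0)) (fun i => f (i + 0) - f i)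
    · refine (sum_le_sum hterm).trans ?_
      rw [sum_add_distrib, sum_const, nsmul_eq_mul, Nat.card_Ico, ← mul_sum]
      have h1 : ((H - 1 : ℕ) : ℝ) ≤ H := by exact_mod_cast Nat.sub_le H 1
      have h2 : ∑ h ∈ Ico 1 H, (h : ℝ) ^ (-a) ≤ 2 * (H : ℝ) ^ (1 - a) := by
        refine le_trans ?_ (sum_Ico_rpow_neg_le ha0.le ha H)
        refine sum_le_sum_of_subset_of_nonneg (Ico_subset_Ico_right (by omega)) ?_
        intro i _ _; positivity
      gcongr
  have hinvH : 1 / (H : ℝ) ≤ 2 * lam ^ (2 * a') := by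
    rw [← e1, div_le_iff₀ hH0]
    rw [show 2 * H₀⁻¹ * H = (2 * H) / H₀ by ring, one_le_div hH₀0]; exact hHge
  have hHa : (H : ℝ) ^ (1 - a) * lam ^ (-a) ≤ H * (2 * H₀) := by
    rw [sub_eq_add_neg, Real.rpow_add hH0, Real.rpow_one, mul_assoc,
      ← Real.mul_rpow hH0.le hlam.le]
    have h1 : ((H : ℝ) * lam) ^ (-a) ≤ (2⁻¹ * (H₀ * lam)) ^ (-a) := by
      apply Real.rpow_le_rpow_of_nonpos (by positivity) _ (by linarith)
      nlinarith
    have h2 : (2⁻¹ * (H₀ * lam)) ^ (-a) ≤ 2 * H₀ := by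
      rw [Real.mul_rpow (by positivity) (by positivity), e3, Real.inv_rpow (by positivity),
        Real.rpow_neg (by positivity), inv_inv]
      have : (2 : ℝ) ^ a ≤ 2 ^ (1 : ℝ) := Real.rpow_le_rpow_of_exponent_le (by norm_num) (by linarith)
      rw [Real.rpow_one] at this
      gcongr
    gcongr
    exact h1.trans h2
  have hX2 : X ^ 2 = (L : ℝ) ^ 2 * lam ^ (2 * a') := by
    rw [hX, mul_pow, ← Real.rpow_natCast (lam ^ a'), ← Real.rpow_mul hlam.le]
    congr 2; push_cast; ring
  have hY2 : Y ^ 2 = (L : ℝ) * (L : ℝ) ^ b * H₀ := by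
    rw [hY, mul_pow, ← Real.rpow_natCast (lam ^ (-a')), ← Real.rpow_mul hlam.le,
      ← Real.rpow_natCast (((L : ℝ) ^ ((1 + b) / 2))), ← Real.rpow_mul (by linarith),
      show (1 + b) / 2 * ((2 : ℕ) : ℝ) = 1 + b by push_cast; ring, Real.rpow_add (by linarith),
      Real.rpow_one, hH₀]
    congr 2; push_cast; ring
  have hS2 : ‖∑ i ∈ range L, eC (f i)‖ ^ 2 ≤ (8 + 16 * K) * (X ^ 2 + Y ^ 2) := by
    calc _ ≤ _ := hvdc
      _ ≤ 4 * L / H * (L + (H * (K * (L * lam ^ (2 * a'))) +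
          K * ((L : ℝ) ^ b * lam ^ (-a)) * (2 * (H : ℝ) ^ (1 - a)))) := by gcongr
      _ = 4 * L ^ 2 * (1 / H) + 4 * K * (L ^ 2 * lam ^ (2 * a')) +
          8 * K * L * (L : ℝ) ^ b * (1 / H) * ((H : ℝ) ^ (1 - a) * lam ^ (-a)) := by
        field_simp; ring
      _ ≤ 4 * L ^ 2 * (2 * lam ^ (2 * a')) + 4 * K * (L ^ 2 * lam ^ (2 * a')) +
          8 * K * L * (L : ℝ) ^ b * (1 / H) * (H * (2 * H₀)) := by gcongr
      _ = (8 + 4 * K) * X ^ 2 + 16 * K * Y ^ 2 := by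
        rw [hX2, hY2]; field_simp; ring
      _ ≤ _ := by nlinarith [sq_nonneg X, sq_nonneg Y]
  apply le_of_sq_le_sq _ (by positivity)
  calc _ ≤ _ := hS2
    _ ≤ (8 + 16 * K) * (X + Y) ^ 2 := by
      have := mul_nonneg hX0 hY0
      gcongr
      linarith [add_sq X Y]
    _ ≤ (8 + 16 * K) * ((8 + 16 * K) * (X + Y) ^ 2) :=
      le_mul_of_one_le_left (by positivity) (by linarith)
    _ = _ := by ring

/-- The third, fourth and fifth derivative tests. -/
lemma diffTest_three : DiffTest 3 (1 / 6) (1 / 2) := by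
  have := diffTest_two.succ (by norm_num) (by norm_num) (by norm_num)
  norm_num at this ⊢; exact this

lemma diffTest_four : DiffTest 4 (1 / 14) (3 / 4) := by
  have := diffTest_three.succ (by norm_num) (by norm_num) (by norm_num)
  norm_num at this ⊢; exact this

lemma diffTest_five : DiffTest 5 (1 / 30) (7 / 8) := by
  have := diffTest_four.succ (by norm_num) (by norm_num) (by norm_num)
  norm_num at this ⊢; exact this

/-! ### Exponential sums with power functions -/

lemma diffBd_of_hasDerivAt {x₀ C : ℝ} : ∀ (k : ℕ) (G : ℕ → ℝ → ℝ) (L : ℕ) (lam : ℝ),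
    (∀ j x, x₀ ≤ x → HasDerivAt (G j) (G (j + 1) x) x) →
    (∀ x, x₀ ≤ x → x ≤ x₀ + L → lam ≤ G k x ∧ G k x ≤ C * lam) →
    DiffBd k lam C L (fun i => G 0 (x₀ + i)) := by
  intro k
  induction k with
  | zero =>
    intro G L lam _ hb i hi
    have : (i : ℝ) ≤ L := by exact_mod_cast hi.le
    exact hb _ (by linarith [(Nat.cast_nonneg i : (0 : ℝ) ≤ i)]) (by linarith)
  | succ k ih =>
    intro G L lam hG hb h hh1 hhL
    have hh0 : (0 : ℝ) < h := by exact_mod_cast hh1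
    have key := ih (fun j x => G j (x + h) - G j x) (L - h) (h * lam) ?_ ?_
    · convert key using 2 with i
      simp only [Nat.cast_add]
      ring_nf
    · intro j x hx
      have h1 := (hG j (x + h) (by linarith)).comp_add_const x h
      exact h1.sub (hG j x hx)
    · intro x hx hxL
      rw [Nat.cast_sub hhL.le] at hxL
      obtain ⟨y, hy, hyeq⟩ := exists_hasDerivAt_eq_slope (G k) (G (k + 1))
        (show x < x + h by linarith)
        (fun z hz => (hG k z (by linarith [hz.1])).continuousAt.continuousWithinAt)
        (fun z hz => hG k z (by linarith [hz.1]))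
      have h1 := hb y (by linarith [hy.1]) (by linarith [hy.2])
      rw [hyeq, add_sub_cancel_left, le_div_iff₀ hh0, div_le_iff₀ hh0] at h1
      exact ⟨by linarith [h1.1], by linarith [h1.2]⟩

lemma hasDerivAt_descPochhammer_mul_rpow (A c : ℝ) (j : ℕ) {x : ℝ} (hx : 0 < x) :
    HasDerivAt (fun x : ℝ => A * (∏ i ∈ range j, (c - i)) * x ^ (c - j))
      (A * (∏ i ∈ range (j + 1), (c - i)) * x ^ (c - (j + 1 : ℕ))) x := by
  have h := (Real.hasDerivAt_rpow_const (x := x) (p := c - j) (Or.inl hx.ne')).const_mul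
    (A * ∏ i ∈ range j, (c - i))
  refine h.congr_deriv ?_
  rw [prod_range_succ, show c - ((j + 1 : ℕ) : ℝ) = c - j - 1 by push_cast; ring]
  ring

/-- The `k`-th derivative test for `∑ e(A n^c)` over `n` in a subinterval of `[M, 2M]`. -/
lemma exists_norm_sum_eC_mul_rpow_le {k : ℕ} {a b c : ℝ} (hT : DiffTest k a b)
    (hb0 : 0 ≤ b) (hb1 : b ≤ 1) (hck : c ≤ k) (hc : ∀ j : ℕ, c ≠ j) :
    ∃ K : ℝ, 1 ≤ K ∧ ∀ A : ℝ, A ≠ 0 → ∀ M s e : ℕ, 1 ≤ M → M ≤ s → e ≤ 2 * M + 1 →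
      ‖∑ n ∈ Ico s e, eC (A * (n : ℝ) ^ c)‖ ≤
        K * (M * (|A| * (M : ℝ) ^ (c - k)) ^ a +
          (M : ℝ) ^ b * (|A| * (M : ℝ) ^ (c - k)) ^ (-a)) := by
  set D := ∏ i ∈ range k, (c - i) with hD
  have hD0 : D ≠ 0 := prod_ne_zero_iff.2 fun i _ => sub_ne_zero.2 (hc i)
  set C : ℝ := 3 ^ (k - c) with hC
  have hC1 : 1 ≤ C := Real.one_le_rpow (by norm_num) (by linarith)
  obtain ⟨K₀, hK₀, hmain⟩ := hT C hC1
  set κ := |D| * C⁻¹ with hκ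
  have hκ0 : 0 < κ := by positivity
  refine ⟨K₀ * (2 * (κ ^ a + κ ^ (-a)) + 1), ?_, ?_⟩
  · have : 0 < κ ^ a := by positivity
    have : 0 < κ ^ (-a) := by positivity
    nlinarith
  suffices hpos : ∀ A : ℝ, 0 < A * D → ∀ M s e : ℕ, 1 ≤ M → M ≤ s → e ≤ 2 * M + 1 →
      ‖∑ n ∈ Ico s e, eC (A * (n : ℝ) ^ c)‖ ≤
        K₀ * (2 * (κ ^ a + κ ^ (-a)) + 1) * (M * (|A| * (M : ℝ) ^ (c - k)) ^ a +
          (M : ℝ) ^ b * (|A| * (M : ℝ) ^ (c - k)) ^ (-a)) by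
    intro A hA M s e hM hs he
    rcases lt_or_gt_of_ne (mul_ne_zero hA hD0) with h | h
    · have := hpos (-A) (by linarith) M s e hM hs he
      simp only [neg_mul, norm_sum_eC_neg, abs_neg] at this
      exact this
    · exact hpos A h M s e hM hs he
  intro A hAD M s e hM hs he
  have hA0 : 0 < |A| := abs_pos.2 (left_ne_zero_of_mul hAD.ne')
  have hM0 : (0 : ℝ) < M := by exact_mod_cast hM
  have hM1 : (1 : ℝ) ≤ M := by exact_mod_cast hM
  set lam := |A| * (M : ℝ) ^ (c - k) with hlam
  have hlam0 : 0 < lam := by positivity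
  rcases le_total e s with hes | hse
  · rw [Ico_eq_empty_of_le hes]
    simp only [sum_empty, norm_zero]
    positivity
  have hs0 : (0 : ℝ) < s := by exact_mod_cast (lt_of_lt_of_le hM hs)
  have hMs : (M : ℝ) ≤ s := by exact_mod_cast hs
  have hdb := diffBd_of_hasDerivAt (x₀ := s) (C := C) k
    (fun j x => A * (∏ i ∈ range j, (c - i)) * x ^ (c - j)) (e - s) (κ * lam)
    (fun j x hx => hasDerivAt_descPochhammer_mul_rpow A c j (hs0.trans_le hx)) (by
      intro x hx hx'
      have hx0 : 0 < x := hs0.trans_le hx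
      have hx3 : x ≤ 3 * M := by
        have h1 : (s : ℝ) + ((e - s : ℕ) : ℝ) = e := by rw [Nat.cast_sub hse]; ring
        have h2 : (e : ℝ) ≤ 2 * M + 1 := by exact_mod_cast he
        linarith
      rw [← hD, ← abs_of_pos hAD, abs_mul]
      have h1 : x ^ (c - k) ≤ (M : ℝ) ^ (c - k) :=
        Real.rpow_le_rpow_of_nonpos hM0 (by linarith) (by linarith)
      have h2 : C⁻¹ * (M : ℝ) ^ (c - k) ≤ x ^ (c - k) := by
        rw [hC, ← Real.rpow_neg (by norm_num), neg_sub, ← Real.mul_rpow (by norm_num) hM0.le]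
        exact Real.rpow_le_rpow_of_nonpos hx0 hx3 (by linarith)
      have hAD' : 0 < |A| * |D| := by positivity
      constructor
      · calc κ * lam = |A| * |D| * (C⁻¹ * (M : ℝ) ^ (c - k)) := by rw [hκ, hlam]; ring
          _ ≤ _ := by gcongr
      · calc |A| * |D| * x ^ (c - k) ≤ |A| * |D| * (M : ℝ) ^ (c - k) := by gcongr
          _ = C * (κ * lam) := by rw [hκ, hlam]; field_simp)
  have h1 := hmain (e - s) (κ * lam) _ (by positivity) hdb
  rw [sum_Ico_eq_sum_range]
  have e0 : ∀ i : ℕ, A * (∏ i ∈ range 0, (c - (i : ℝ))) * ((s : ℝ) + i) ^ (c - ((0 : ℕ) : ℝ)) =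
      A * ((s + i : ℕ) : ℝ) ^ c := fun i => by simp
  simp only [e0] at h1
  refine h1.trans ?_
  have hL : ((e - s : ℕ) : ℝ) ≤ 2 * M := by
    have : e - s ≤ 2 * M := by omega
    exact_mod_cast this
  have hLb : ((e - s : ℕ) : ℝ) ^ b ≤ 2 * (M : ℝ) ^ b := by
    have h2 : ((e - s : ℕ) : ℝ) ^ b ≤ (2 * M : ℝ) ^ b := by gcongr
    rw [Real.mul_rpow (by norm_num) hM0.le] at h2
    have h3 : (2 : ℝ) ^ b ≤ 2 ^ (1 : ℝ) :=
      Real.rpow_le_rpow_of_exponent_le (by norm_num) hb1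
    rw [Real.rpow_one] at h3
    refine h2.trans ?_
    gcongr
  rw [Real.mul_rpow hκ0.le hlam0.le, Real.mul_rpow hκ0.le hlam0.le, mul_assoc]
  have hp : 0 < κ ^ a := by positivity
  have hq : 0 < κ ^ (-a) := by positivity
  have hX : 0 < M * lam ^ a := by positivity
  have hY : 0 < (M : ℝ) ^ b * lam ^ (-a) := by positivity
  gcongr
  calc _ ≤ 2 * M * (κ ^ a * lam ^ a) + 2 * (M : ℝ) ^ b * (κ ^ (-a) * lam ^ (-a)) := by gcongr
    _ = 2 * κ ^ a * (M * lam ^ a) + 2 * κ ^ (-a) * ((M : ℝ) ^ b * lam ^ (-a)) := by ring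
    _ ≤ _ := by nlinarith [mul_pos hp hY, mul_pos hq hX]

/-! ### Linear sums -/

lemma one_add_log_le_rpow {η x : ℝ} (hη : 0 < η) (hx : 1 ≤ x) :
    1 + log x ≤ (1 + 1 / η) * x ^ η := by
  have h1 := Real.log_le_rpow_div (by linarith : (0 : ℝ) ≤ x) hη
  have h2 : 1 ≤ x ^ η := Real.one_le_rpow hx hη.le
  calc 1 + log x ≤ x ^ η + x ^ η / η := by linarith
    _ = _ := by ring

lemma natLog_add_one_le_rpow {η x : ℝ} {N : ℕ} (hη : 0 < η) (hx : 1 ≤ x) (hN : (N : ℝ) ≤ x) :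
    (Nat.log 2 N + 1 : ℝ) ≤ 2 * (1 + 1 / η) * x ^ η := by
  have h1 : (Nat.log 2 N : ℝ) ≤ 2 * log x := by
    rcases Nat.eq_zero_or_pos N with rfl | hpos
    · simpa using Real.log_nonneg hx
    have h2 : (2 : ℝ) ^ Nat.log 2 N ≤ N := by exact_mod_cast Nat.pow_log_le_self 2 hpos.ne'
    have h3 := Real.log_le_log (by positivity) (h2.trans hN)
    rw [Real.log_pow] at h3
    have := Real.log_two_gt_d9
    nlinarith [Real.log_nonneg hx, (Nat.cast_nonneg (Nat.log 2 N) : (0 : ℝ) ≤ _)]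
  have := one_add_log_le_rpow hη hx
  nlinarith

/-- Summation over `[1, N]` of a sequence whose dyadic pieces are at most `B`. -/
lemma norm_sum_Ioc_le_of_dyadic {g : ℕ → ℂ} {N : ℕ} {B : ℝ} (hB : 0 ≤ B)
    (h : ∀ Y n, 1 ≤ Y → Y ≤ n → n ≤ N → n ≤ 2 * Y → ‖∑ m ∈ Ico Y (n + 1), g m‖ ≤ B) :
    ‖∑ n ∈ Ioc 0 N, g n‖ ≤ (Nat.log 2 N + 1) * B := by
  induction N using Nat.strong_induction_on with
  | _ N ih =>
    rcases lt_or_ge N 2 with hN | hN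
    · interval_cases N
      · simpa using hB
      · have := h 1 1 le_rfl le_rfl le_rfl (by norm_num)
        simpa using this
    · have h1 := ih (N / 2) (by omega) (fun Y n h1 h2 h3 h4 => h Y n h1 h2 (by omega) h4)
      have h2 := h (N / 2 + 1) N (by omega) (by omega) le_rfl (by omega)
      have hs : ∑ n ∈ Ioc 0 N, g n = ∑ n ∈ Ioc 0 (N / 2), g n + ∑ n ∈ Ico (N / 2 + 1) (N + 1), g n := by
        rw [← sum_Ioc_consecutive g (Nat.zero_le (N / 2)) (by omega : N / 2 ≤ N)]
        congr 1
        refine sum_congr (Finset.ext fun x => ?_) fun _ _ => rfl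
        simp only [mem_Ioc, mem_Ico]
        omega
      have hl : Nat.log 2 N = Nat.log 2 (N / 2) + 1 := Nat.log_of_one_lt_of_le (by norm_num) hN
      rw [hs, hl]
      push_cast
      calc _ ≤ _ := norm_add_le _ _
        _ ≤ _ := add_le_add h1 h2
        _ = _ := by ring

/-- Partial summation against the weight `log n`. -/
lemma norm_sum_log_mul_le {g : ℕ → ℂ} {N : ℕ} {B : ℝ}
    (h : ∀ n ≤ N, ‖∑ m ∈ Ioc 0 n, g m‖ ≤ B) :
    ‖∑ n ∈ Ioc 0 N, (log n : ℂ) * g n‖ ≤ 2 * log N * B := by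
  have key : ∀ n : ℕ, ∑ m ∈ Ioc 0 n, (log m : ℂ) * g m = log n * ∑ m ∈ Ioc 0 n, g m -
      ∑ k ∈ Ico 1 n, ((log (k + 1 : ℕ) - log k : ℝ) : ℂ) * ∑ m ∈ Ioc 0 k, g m := by
    intro n
    induction n with
    | zero => simp
    | succ n ih =>
      rcases Nat.eq_zero_or_pos n with rfl | hn
      · simp
      rw [sum_Ioc_succ_top (Nat.zero_le n), sum_Ioc_succ_top (Nat.zero_le n), ih,
        sum_Ico_succ_top hn]
      push_cast
      ring
  have hB : 0 ≤ B := (norm_nonneg _).trans (h 0 (Nat.zero_le _))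
  rcases Nat.eq_zero_or_pos N with rfl | hN
  · simp
  rw [key N]
  have hlogN : 0 ≤ log N := Real.log_natCast_nonneg N
  have h1 : ‖(log N : ℂ) * ∑ m ∈ Ioc 0 N, g m‖ ≤ log N * B := by
    rw [norm_mul, Complex.norm_real, Real.norm_of_nonneg hlogN]
    exact mul_le_mul_of_nonneg_left (h N le_rfl) hlogN
  have h2 : ‖∑ k ∈ Ico 1 N, ((log (k + 1 : ℕ) - log k : ℝ) : ℂ) * ∑ m ∈ Ioc 0 k, g m‖ ≤
      log N * B := by
    calc _ ≤ ∑ k ∈ Ico 1 N, (log (k + 1 : ℕ) - log k) * B := by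
          refine norm_sum_le_of_le _ fun k hk => ?_
          rw [mem_Ico] at hk
          have hk0 : (0 : ℝ) < k := by exact_mod_cast hk.1
          have : 0 ≤ log (k + 1 : ℕ) - log k :=
            sub_nonneg.2 (Real.log_le_log hk0 (by push_cast; linarith))
          rw [norm_mul, Complex.norm_real, Real.norm_of_nonneg this]
          exact mul_le_mul_of_nonneg_left (h k hk.2.le) this
      _ = log N * B := by
          rw [← sum_mul, sum_Ico_sub (fun k : ℕ => log k) hN]
          simp
  calc _ ≤ _ := norm_sub_le _ _
    _ ≤ _ := add_le_add h1 h2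
    _ = _ := by ring

lemma ne_natCast_of_le {c : ℝ} (hc1 : 1 < c) (hc2 : c ≤ 20551 / 10000) (hc3 : c ≠ 2) (j : ℕ) : c ≠ j := by
  intro hj
  rcases Nat.lt_or_ge j 2 with h | h
  · have : (j : ℝ) ≤ 1 := by exact_mod_cast Nat.lt_succ_iff.1 h
    linarith
  · rcases h.eq_or_lt with h | h
    · exact hc3 (by rw [hj, ← h]; norm_num)
    · have : (3 : ℝ) ≤ j := by exact_mod_cast h
      linarith

/-- Sums `∑ e(θ (d n)^c)` over `n ≤ N` with `d N ≤ P`. -/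
lemma exists_norm_sum_eC_rpow_le {c : ℝ} (hc1 : 1 < c) (hc2 : c ≤ 20551 / 10000) (hc3 : c ≠ 2) :
    ∃ K : ℝ, 1 ≤ K ∧ ∀ P : ℝ, 1 ≤ P → ∀ θ : ℝ, P ^ (1 - c - 1 / 1000) ≤ |θ| →
      |θ| ≤ P ^ (148 / 10000 : ℝ) → ∀ d N : ℕ, 1 ≤ d → (d * N : ℝ) ≤ P →
      ‖∑ n ∈ Ioc 0 N, eC (θ * ((d * n : ℕ) : ℝ) ^ c)‖ ≤ K * P ^ (86 / 100 : ℝ) := by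
  obtain ⟨K, hK, hmain⟩ := exists_norm_sum_eC_mul_rpow_le (c := c) diffTest_three
    (by norm_num) (by norm_num) (by push_cast; linarith) (ne_natCast_of_le hc1 hc2 hc3)
  refine ⟨2 * (1 + 1 / (1 / 100)) * (2 * K), by linarith, ?_⟩
  intro P hP θ hθ1 hθ2 d N hd hdN
  have hP0 : 0 < P := by linarith
  have hd1 : (1 : ℝ) ≤ d := by exact_mod_cast hd
  have hd0 : (0 : ℝ) < d := by linarith
  have hNP : (N : ℝ) ≤ P := by nlinarith [(Nat.cast_nonneg N : (0 : ℝ) ≤ N)]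
  have hθ0 : 0 < |θ| := lt_of_lt_of_le (by positivity) hθ1
  have hA0 : θ * (d : ℝ) ^ c ≠ 0 := mul_ne_zero (abs_pos.1 hθ0) (by positivity)
  have hpiece : ∀ Y n, 1 ≤ Y → Y ≤ n → n ≤ N → n ≤ 2 * Y →
      ‖∑ m ∈ Ico Y (n + 1), eC (θ * ((d * m : ℕ) : ℝ) ^ c)‖ ≤ 2 * K * P ^ (85 / 100 : ℝ) := by
    intro Y n hY hYn hnN hn2
    have hY0 : (0 : ℝ) < Y := by exact_mod_cast hY
    have h1 := hmain _ hA0 Y Y (n + 1) hY le_rfl (by omega)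
    have e1 : ∀ m : ℕ, θ * (d : ℝ) ^ c * (m : ℝ) ^ c = θ * ((d * m : ℕ) : ℝ) ^ c := by
      intro m
      rw [Nat.cast_mul, Real.mul_rpow (by positivity) (by positivity)]
      ring
    simp only [e1] at h1
    refine h1.trans ?_
    have hdY : (d * Y : ℝ) ≤ P := by
      have : (Y : ℝ) ≤ N := by exact_mod_cast hYn.trans hnN
      nlinarith
    have hY1 : (1 : ℝ) ≤ Y := by exact_mod_cast hY
    have hdY0 : (0 : ℝ) < d * Y := by positivity
    have hdY1 : (1 : ℝ) ≤ d * Y := by nlinarith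
    have eA : |θ * (d : ℝ) ^ c| * (Y : ℝ) ^ (c - (3 : ℕ)) = |θ| * (d * Y : ℝ) ^ c * (Y : ℝ) ^ (-3 : ℝ) := by
      rw [abs_mul, abs_of_pos (by positivity : 0 < (d : ℝ) ^ c), Real.rpow_sub hY0,
        Real.mul_rpow hd0.le hY0.le, Real.rpow_neg hY0.le]
      push_cast
      field_simp
    have t1 : Y * (|θ| * (d * Y : ℝ) ^ c * (Y : ℝ) ^ (-3 : ℝ)) ^ (1 / 6 : ℝ) ≤ P ^ (85 / 100 : ℝ) := by
      have : Y * (|θ| * (d * Y : ℝ) ^ c * (Y : ℝ) ^ (-3 : ℝ)) ^ (1 / 6 : ℝ) =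
          |θ| ^ (1 / 6 : ℝ) * (d * Y : ℝ) ^ (c / 6) * (Y : ℝ) ^ (1 / 2 : ℝ) := by
        rw [Real.mul_rpow (by positivity) (by positivity), Real.mul_rpow (by positivity) (by positivity),
          ← Real.rpow_mul hY0.le, ← Real.rpow_mul hdY0.le]
        have : (Y : ℝ) ^ (1 / 2 : ℝ) = Y * (Y : ℝ) ^ (-3 * (1 / 6) : ℝ) := by
          rw [← Real.rpow_one_add' hY0.le (by norm_num)]; norm_num
        rw [this, show c * (1 / 6) = c / 6 by ring]; ring
      rw [this]
      have hYP : (Y : ℝ) ≤ P := by nlinarith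
      calc _ ≤ (P ^ (148 / 10000 : ℝ)) ^ (1 / 6 : ℝ) * P ^ (c / 6) * P ^ (1 / 2 : ℝ) := by gcongr
        _ = P ^ (148 / 10000 * (1 / 6) + c / 6 + 1 / 2) := by
          rw [← Real.rpow_mul hP0.le, ← Real.rpow_add hP0, ← Real.rpow_add hP0]
        _ ≤ _ := Real.rpow_le_rpow_of_exponent_le hP (by linarith)
    have t2 : (Y : ℝ) ^ (1 / 2 : ℝ) * (|θ| * (d * Y : ℝ) ^ c * (Y : ℝ) ^ (-3 : ℝ)) ^ (-(1 / 6) : ℝ) ≤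
        P ^ (85 / 100 : ℝ) := by
      have : (Y : ℝ) ^ (1 / 2 : ℝ) * (|θ| * (d * Y : ℝ) ^ c * (Y : ℝ) ^ (-3 : ℝ)) ^ (-(1 / 6) : ℝ) =
          |θ| ^ (-(1 / 6) : ℝ) * (d * Y : ℝ) ^ (-(c / 6)) * Y := by
        rw [Real.mul_rpow (by positivity) (by positivity), Real.mul_rpow (by positivity) (by positivity),
          ← Real.rpow_mul hY0.le, ← Real.rpow_mul hdY0.le]
        have : (Y : ℝ) = (Y : ℝ) ^ (1 / 2 : ℝ) * (Y : ℝ) ^ (-3 * (-(1 / 6)) : ℝ) := by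
          rw [← Real.rpow_add hY0]; norm_num
        rw [show c * (-(1 / 6)) = -(c / 6) by ring]
        calc _ = |θ| ^ (-(1 / 6) : ℝ) * (d * Y : ℝ) ^ (-(c / 6)) *
              ((Y : ℝ) ^ (1 / 2 : ℝ) * (Y : ℝ) ^ (-3 * (-(1 / 6)) : ℝ)) := by ring
          _ = _ := by rw [← this]
      rw [this]
      calc _ ≤ (P ^ (1 - c - 1 / 1000)) ^ (-(1 / 6) : ℝ) * (d * Y : ℝ) ^ (-(c / 6)) * (d * Y) := by
            gcongr ?_ * _ * ?_
            · exact Real.rpow_le_rpow_of_nonpos (by positivity) hθ1 (by norm_num)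
            · nlinarith
        _ = (P ^ (1 - c - 1 / 1000)) ^ (-(1 / 6) : ℝ) * (d * Y : ℝ) ^ (-(c / 6) + 1) := by
            rw [Real.rpow_add_one hdY0.ne']; ring
        _ ≤ (P ^ (1 - c - 1 / 1000)) ^ (-(1 / 6) : ℝ) * P ^ (-(c / 6) + 1) := by
            gcongr
            linarith
        _ = P ^ ((1 - c - 1 / 1000) * (-(1 / 6)) + (-(c / 6) + 1)) := by
            rw [← Real.rpow_mul hP0.le, ← Real.rpow_add hP0]
        _ ≤ _ := Real.rpow_le_rpow_of_exponent_le hP (by linarith)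
    rw [eA]
    calc _ ≤ K * (P ^ (85 / 100 : ℝ) + P ^ (85 / 100 : ℝ)) := by gcongr
      _ = _ := by ring
  have h2 := norm_sum_Ioc_le_of_dyadic (by positivity) hpiece
  have h3 := natLog_add_one_le_rpow (η := 1 / 100) (by norm_num) hP hNP
  calc _ ≤ _ := h2
    _ ≤ 2 * (1 + 1 / (1 / 100)) * P ^ (1 / 100 : ℝ) * (2 * K * P ^ (85 / 100 : ℝ)) := by gcongr
    _ = 2 * (1 + 1 / (1 / 100)) * (2 * K) * (P ^ (1 / 100 : ℝ) * P ^ (85 / 100 : ℝ)) := by ring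
    _ = _ := by rw [← Real.rpow_add hP0]; norm_num

/-! ### Bilinear sums -/

/-- Weyl differencing of a bilinear form, with the second variable cut in blocks of length `L`. -/
lemma norm_bilinear_sq_le {s t : Finset ℕ} (a b : ℕ → ℂ) (g : ℕ → ℕ → ℂ) {L : ℕ} {D E : ℝ} {J : ℕ}
    (hL : 1 ≤ L) (hE : 0 ≤ E) (hJ : (t.image (· / L)).card ≤ J)
    (hdiag : ∀ n ∈ t, ‖∑ m ∈ s, g m n * starRingEnd ℂ (g m n)‖ ≤ D)
    (hoff : ∀ n₁ ∈ t, ∀ n₂ ∈ t, n₁ ≠ n₂ → n₁ / L = n₂ / L →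
      ‖∑ m ∈ s, g m n₁ * starRingEnd ℂ (g m n₂)‖ ≤ E) :
    ‖∑ m ∈ s, ∑ n ∈ t, a m * b n * g m n‖ ^ 2 ≤
      J * (D + L * E) * (∑ m ∈ s, ‖a m‖ ^ 2) * ∑ n ∈ t, ‖b n‖ ^ 2 := by
  set T := t.image (· / L) with hT
  set B : ℕ → Finset ℕ := fun j => t.filter (fun n => n / L = j) with hB
  have hsplit : ∑ m ∈ s, ∑ n ∈ t, a m * b n * g m n =
      ∑ j ∈ T, ∑ m ∈ s, a m * ∑ n ∈ B j, b n * g m n := by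
    rw [sum_comm (s := T)]
    refine sum_congr rfl fun m _ => ?_
    rw [← mul_sum, sum_fiberwise_of_maps_to (fun n hn => mem_image_of_mem _ hn), mul_sum]
    exact sum_congr rfl fun n _ => by ring
  have hcard : ∀ j, ((B j).card : ℝ) ≤ L := by
    intro j
    have : B j ⊆ Ico (j * L) (j * L + L) := by
      intro n hn
      have h := (mem_filter.1 hn).2
      have h1 := Nat.div_add_mod' n L
      have h2 := Nat.mod_lt n (by omega : 0 < L)
      rw [h] at h1
      rw [mem_Ico]
      omega
    have := card_le_card this
    rw [Nat.card_Ico, Nat.add_sub_cancel_left] at this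
    exact_mod_cast this
  have hblock : ∀ j, ‖∑ m ∈ s, a m * ∑ n ∈ B j, b n * g m n‖ ^ 2 ≤
      (∑ m ∈ s, ‖a m‖ ^ 2) * ((D + L * E) * ∑ n ∈ B j, ‖b n‖ ^ 2) := by
    intro j
    have h1 : ‖∑ m ∈ s, a m * ∑ n ∈ B j, b n * g m n‖ ^ 2 ≤
        (∑ m ∈ s, ‖a m‖ ^ 2) * ∑ m ∈ s, ‖∑ n ∈ B j, b n * g m n‖ ^ 2 := by
      refine le_trans ?_ (sum_mul_sq_le_sq_mul_sq s (fun m => ‖a m‖) _)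
      gcongr
      exact norm_sum_le_of_le _ fun m _ => (norm_mul _ _).le
    refine h1.trans ?_
    gcongr
    have h2 : ((∑ m ∈ s, ‖∑ n ∈ B j, b n * g m n‖ ^ 2 : ℝ) : ℂ) =
        ∑ n₁ ∈ B j, ∑ n₂ ∈ B j, b n₁ * starRingEnd ℂ (b n₂) *
          ∑ m ∈ s, g m n₁ * starRingEnd ℂ (g m n₂) := by
      push_cast
      simp only [← Complex.mul_conj', map_sum, map_mul, sum_mul_sum]
      simp only [mul_sum]
      rw [sum_comm]
      refine sum_congr rfl fun n₁ _ => ?_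
      rw [sum_comm]
      exact sum_congr rfl fun n₂ _ => sum_congr rfl fun m _ => by ring
    have h3 : ∑ m ∈ s, ‖∑ n ∈ B j, b n * g m n‖ ^ 2 ≤
        ∑ n₁ ∈ B j, ∑ n₂ ∈ B j, ‖b n₁‖ * ‖b n₂‖ * (if n₁ = n₂ then D else E) := by
      have h4 := congrArg norm h2
      rw [Complex.norm_real, Real.norm_of_nonneg (by positivity)] at h4
      rw [h4]
      refine norm_sum_le_of_le _ fun n₁ h₁ => norm_sum_le_of_le _ fun n₂ h₂ => ?_
      rw [norm_mul, norm_mul, RCLike.norm_conj]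
      have h₁ := mem_filter.1 h₁
      have h₂ := mem_filter.1 h₂
      gcongr
      split_ifs with h
      · rw [← h]; exact hdiag n₁ h₁.1
      · exact hoff n₁ h₁.1 n₂ h₂.1 h (h₁.2.trans h₂.2.symm)
    have hD : ∀ n ∈ B j, 0 ≤ D := fun n hn => (norm_nonneg _).trans (hdiag n (mem_filter.1 hn).1)
    calc _ ≤ _ := h3
      _ ≤ ∑ n₁ ∈ B j, ∑ n₂ ∈ B j, ((if n₁ = n₂ then D * ‖b n₁‖ ^ 2 else 0) +
            E * (‖b n₁‖ * ‖b n₂‖)) := by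
          refine sum_le_sum fun n₁ h₁ => sum_le_sum fun n₂ _ => ?_
          split_ifs with h
          · rw [← h]
            have : 0 ≤ E * (‖b n₁‖ * ‖b n₁‖) := by positivity
            linarith
          · linarith
      _ = D * ∑ n ∈ B j, ‖b n‖ ^ 2 + E * (∑ n ∈ B j, ‖b n‖) ^ 2 := by
          simp only [sum_add_distrib, ← mul_sum, sum_ite_eq]
          rw [sq, sum_mul_sum]
          congr 1
          · rw [mul_sum]
            exact sum_congr rfl fun n hn => by rw [if_pos hn]
          · simp only [mul_sum]
      _ ≤ D * ∑ n ∈ B j, ‖b n‖ ^ 2 + E * (L * ∑ n ∈ B j, ‖b n‖ ^ 2) := by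
          gcongr
          refine sq_sum_le_card_mul_sum_sq.trans ?_
          gcongr
          exact_mod_cast hcard j
      _ = _ := by ring
  calc ‖∑ m ∈ s, ∑ n ∈ t, a m * b n * g m n‖ ^ 2
      ≤ (∑ j ∈ T, ‖∑ m ∈ s, a m * ∑ n ∈ B j, b n * g m n‖) ^ 2 := by
        rw [hsplit]
        gcongr
        exact norm_sum_le _ _
    _ ≤ T.card * ∑ j ∈ T, ‖∑ m ∈ s, a m * ∑ n ∈ B j, b n * g m n‖ ^ 2 := sq_sum_le_card_mul_sum_sq
    _ ≤ J * ∑ j ∈ T, (∑ m ∈ s, ‖a m‖ ^ 2) * ((D + L * E) * ∑ n ∈ B j, ‖b n‖ ^ 2) := by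
        gcongr with j hj
        exact hblock j
    _ = _ := by
        rw [← mul_sum, ← mul_sum, sum_fiberwise_of_maps_to (fun n hn => mem_image_of_mem _ hn)]
        ring

/-- For the sizes `M = P^μ`, `N = P^ν`, `|θ| = P^t` of the bilinear sums that matter, one of the
third, fourth and fifth derivative tests gives a saving. -/
lemma exists_test_exponents {c μ ν t : ℝ} (hc2 : c ≤ 20551 / 10000)
    (hνμ : ν ≤ μ) (hν : 0 ≤ ν) (hx1 : μ + ν ≤ 1)
    (ht0 : 1 - c - 1 / 1000 ≤ t) (ht1 : t ≤ 148 / 10000) :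
    ∃ k a b : ℝ, ((k, a, b) = (3, 1 / 6, 1 / 2) ∨ (k, a, b) = (4, 1 / 14, 3 / 4) ∨
        (k, a, b) = (5, 1 / 30, 7 / 8)) ∧
      2 * ν + μ + (μ + a * (t + 294 / 10000 + (c - 1) * ν + (c - k) * μ)) ≤ 19706 / 10000 ∧
      2 * ν + μ + (b * μ - a * (t + (c - 1) * ν + (c - k) * μ)) ≤ 19706 / 10000 := by
  have hf0 : 1 - 1 / 1000 - 20551 / 10000 * (1 - (μ + ν)) ≤ t + c * (μ + ν) := by nlinarith
  have hf1 : t + c * (μ + ν) ≤ 148 / 10000 + 20551 / 10000 * (μ + ν) := by nlinarith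
  set f := t + c * (μ + ν) with hf
  have e1 : ∀ k, t + (c - 1) * ν + (c - k) * μ = f - ν - k * μ := fun k => by rw [hf]; ring
  have e2 : ∀ k, t + 294 / 10000 + (c - 1) * ν + (c - k) * μ = f + 294 / 10000 - ν - k * μ :=
    fun k => by rw [hf]; ring
  simp only [e1, e2]
  by_contra! hcon
  have h3 := hcon 3 (1 / 6) (1 / 2) (by simp)
  have h4 := hcon 4 (1 / 14) (3 / 4) (by simp)
  have h5 := hcon 5 (1 / 30) (7 / 8) (by simp)
  clear hcon
  clear_value f
  by_cases g3 : 2 * ν + μ + (μ + 1 / 6 * (f + 294 / 10000 - ν - 3 * μ)) ≤ 19706 / 10000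
  · have h3 := h3 g3
    linarith
  · by_cases g4 : 2 * ν + μ + (μ + 1 / 14 * (f + 294 / 10000 - ν - 4 * μ)) ≤ 19706 / 10000
    · have h4 := h4 g4
      linarith
    · by_cases g5 : 2 * ν + μ + (μ + 1 / 30 * (f + 294 / 10000 - ν - 5 * μ)) ≤ 19706 / 10000
      · have h5 := h5 g5
        linarith
      · linarith

lemma abs_rpow_sub_rpow_bounds {c : ℝ} (hc1 : 1 < c) (hc2 : c ≤ 20551 / 10000) {N L n₁ n₂ : ℕ}
    (hN : 1 ≤ N) (h1 : n₁ ∈ Ico N (2 * N)) (h2 : n₂ ∈ Ico N (2 * N)) (hne : n₁ ≠ n₂)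
    (hL : n₁ / L = n₂ / L) (hL0 : 1 ≤ L) :
    (N : ℝ) ^ (c - 1) ≤ |(n₁ : ℝ) ^ c - (n₂ : ℝ) ^ c| ∧
      |(n₁ : ℝ) ^ c - (n₂ : ℝ) ^ c| ≤ 12 * (L * (N : ℝ) ^ (c - 1)) := by
  wlog hlt : n₂ < n₁ generalizing n₁ n₂
  · rw [abs_sub_comm]
    exact this h2 h1 hne.symm hL.symm (by omega)
  rw [mem_Ico] at h1 h2
  have hN0 : (0 : ℝ) < N := by exact_mod_cast hN
  have hn0 : (N : ℝ) ≤ n₂ := by exact_mod_cast h2.1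
  have hn1 : (n₁ : ℝ) ≤ 2 * N := by exact_mod_cast h1.2.le
  have hd1 : (n₂ : ℝ) + 1 ≤ n₁ := by exact_mod_cast hlt
  have hdL : (n₁ : ℝ) - n₂ ≤ L := by
    have h3 := Nat.div_add_mod n₁ L
    have h4 := Nat.div_add_mod n₂ L
    have h5 := Nat.mod_lt n₁ (by omega : 0 < L)
    rw [← hL] at h4
    have : n₁ ≤ n₂ + L := by omega
    have : (n₁ : ℝ) ≤ n₂ + L := by exact_mod_cast this
    linarith
  obtain ⟨y, hy, hyeq⟩ := exists_hasDerivAt_eq_slope (fun x : ℝ => x ^ c) (fun x => c * x ^ (c - 1))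
    (show (n₂ : ℝ) < n₁ by linarith)
    (fun z hz => ((Real.hasDerivAt_rpow_const (Or.inr hc1.le)).continuousAt).continuousWithinAt)
    (fun z hz => Real.hasDerivAt_rpow_const (Or.inr hc1.le))
  have hy0 : (N : ℝ) ≤ y := hn0.trans hy.1.le
  have hlow : (N : ℝ) ^ (c - 1) ≤ y ^ (c - 1) := Real.rpow_le_rpow hN0.le hy0 (by linarith)
  have hup : y ^ (c - 1) ≤ 4 * (N : ℝ) ^ (c - 1) := by
    calc y ^ (c - 1) ≤ (2 * N : ℝ) ^ (c - 1) :=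
          Real.rpow_le_rpow (by linarith) (hy.2.le.trans hn1) (by linarith)
      _ = (2 : ℝ) ^ (c - 1) * (N : ℝ) ^ (c - 1) := Real.mul_rpow (by norm_num) hN0.le
      _ ≤ (2 : ℝ) ^ (2 : ℝ) * (N : ℝ) ^ (c - 1) := by
          gcongr
          · norm_num
          · linarith
      _ = _ := by norm_num
  have hpos : 0 < (N : ℝ) ^ (c - 1) := by positivity
  rw [eq_div_iff (by linarith)] at hyeq
  have hcy : c * y ^ (c - 1) ≤ 12 * (N : ℝ) ^ (c - 1) := by nlinarith
  have hcy' : (N : ℝ) ^ (c - 1) ≤ c * y ^ (c - 1) := by nlinarith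
  rw [← hyeq, abs_of_nonneg (mul_nonneg (by linarith) (by linarith))]
  constructor
  · nlinarith
  · calc _ ≤ 12 * (N : ℝ) ^ (c - 1) * L := by
          gcongr
          linarith
      _ = _ := by ring

/-- The `m`-sum arising after differencing in `n`. -/
lemma exists_norm_sum_differenced_le {k : ℕ} {a b c : ℝ} (hT : DiffTest k a b) (ha0 : 0 ≤ a)
    (ha1 : a ≤ 1) (hb0 : 0 ≤ b) (hb1 : b ≤ 1) (hc1 : 1 < c) (hc2 : c ≤ 20551 / 10000) (hck : c ≤ k)
    (hc : ∀ j : ℕ, c ≠ j) :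
    ∃ K : ℝ, 1 ≤ K ∧ ∀ θ : ℝ, θ ≠ 0 → ∀ M N L e n₁ n₂ : ℕ, 1 ≤ M → 1 ≤ N → 1 ≤ L → e ≤ 2 * M →
      n₁ ∈ Ico N (2 * N) → n₂ ∈ Ico N (2 * N) → n₁ ≠ n₂ → n₁ / L = n₂ / L →
      ‖∑ m ∈ Ico M e, eC (θ * ((n₁ : ℝ) ^ c - (n₂ : ℝ) ^ c) * (m : ℝ) ^ c)‖ ≤
        K * (M * (|θ| * L * (N : ℝ) ^ (c - 1) * (M : ℝ) ^ (c - k)) ^ a +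
          (M : ℝ) ^ b * (|θ| * (N : ℝ) ^ (c - 1) * (M : ℝ) ^ (c - k)) ^ (-a)) := by
  obtain ⟨K, hK, hmain⟩ := exists_norm_sum_eC_mul_rpow_le hT hb0 hb1 hck hc
  refine ⟨K * 12, by linarith, ?_⟩
  intro θ hθ M N L e n₁ n₂ hM hN hL he h1 h2 hne hdiv
  obtain ⟨hlo, hhi⟩ := abs_rpow_sub_rpow_bounds hc1 hc2 hN h1 h2 hne hdiv hL
  have hN0 : (0 : ℝ) < N := by exact_mod_cast hN
  have hM0 : (0 : ℝ) < M := by exact_mod_cast hM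
  have hL0 : (0 : ℝ) < L := by exact_mod_cast hL
  have hθ0 : 0 < |θ| := abs_pos.2 hθ
  have hNc : 0 < (N : ℝ) ^ (c - 1) := by positivity
  have hd0 : 0 < |(n₁ : ℝ) ^ c - (n₂ : ℝ) ^ c| := hNc.trans_le hlo
  refine (hmain _ (mul_ne_zero hθ (abs_pos.1 hd0)) M M e hM le_rfl (by omega)).trans ?_
  rw [abs_mul, mul_assoc K]
  gcongr
  rw [mul_add]
  have hX : 0 < |θ| * L * (N : ℝ) ^ (c - 1) * (M : ℝ) ^ (c - k) := by positivity
  refine add_le_add ?_ ?_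
  · calc M * (|θ| * |(n₁ : ℝ) ^ c - (n₂ : ℝ) ^ c| * (M : ℝ) ^ (c - k)) ^ a
        ≤ M * (|θ| * (12 * (L * (N : ℝ) ^ (c - 1))) * (M : ℝ) ^ (c - k)) ^ a := by gcongr
      _ = (12 : ℝ) ^ a * (M * (|θ| * L * (N : ℝ) ^ (c - 1) * (M : ℝ) ^ (c - k)) ^ a) := by
          rw [show |θ| * (12 * (L * (N : ℝ) ^ (c - 1))) * (M : ℝ) ^ (c - k) =
            12 * (|θ| * L * (N : ℝ) ^ (c - 1) * (M : ℝ) ^ (c - k)) by ring,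
            Real.mul_rpow (by norm_num) hX.le]
          ring
      _ ≤ (12 : ℝ) ^ (1 : ℝ) * (M * (|θ| * L * (N : ℝ) ^ (c - 1) * (M : ℝ) ^ (c - k)) ^ a) := by
          gcongr
          norm_num
      _ = _ := by rw [Real.rpow_one]
  · have h3 : (|θ| * |(n₁ : ℝ) ^ c - (n₂ : ℝ) ^ c| * (M : ℝ) ^ (c - k)) ^ (-a) ≤
        (|θ| * (N : ℝ) ^ (c - 1) * (M : ℝ) ^ (c - k)) ^ (-a) :=
      Real.rpow_le_rpow_of_nonpos (by positivity) (by gcongr) (by linarith)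
    have h4 : 0 ≤ (M : ℝ) ^ b * (|θ| * (N : ℝ) ^ (c - 1) * (M : ℝ) ^ (c - k)) ^ (-a) := by
      positivity
    calc _ ≤ (M : ℝ) ^ b * (|θ| * (N : ℝ) ^ (c - 1) * (M : ℝ) ^ (c - k)) ^ (-a) := by gcongr
      _ ≤ _ := by linarith

lemma exists_norm_sum_differenced_le_rpow {c : ℝ} (hc1 : 1 < c) (hc2 : c ≤ 20551 / 10000)
    (hc : ∀ j : ℕ, c ≠ j) :
    ∃ K : ℝ, 1 ≤ K ∧ ∀ P : ℝ, 1 < P → ∀ θ : ℝ, P ^ (1 - c - 1 / 1000) ≤ |θ| →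
      |θ| ≤ P ^ (148 / 10000 : ℝ) → ∀ M N L : ℕ, 1 ≤ N → N ≤ M → (M * N : ℝ) ≤ P → 1 ≤ L →
      (L : ℝ) ≤ 2 * P ^ (294 / 10000 : ℝ) → ∀ e n₁ n₂ : ℕ, e ≤ 2 * M →
      n₁ ∈ Ico N (2 * N) → n₂ ∈ Ico N (2 * N) → n₁ ≠ n₂ → n₁ / L = n₂ / L →
      ‖∑ m ∈ Ico M e, eC (θ * ((n₁ : ℝ) ^ c - (n₂ : ℝ) ^ c) * (m : ℝ) ^ c)‖ * ((N : ℝ) ^ 2 * M) ≤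
        K * P ^ (19706 / 10000 : ℝ) := by
  obtain ⟨K₃, hK₃, h₃⟩ := exists_norm_sum_differenced_le diffTest_three (by norm_num) (by norm_num)
    (by norm_num) (by norm_num) hc1 hc2 (by push_cast; linarith) hc
  obtain ⟨K₄, hK₄, h₄⟩ := exists_norm_sum_differenced_le diffTest_four (by norm_num) (by norm_num)
    (by norm_num) (by norm_num) hc1 hc2 (by push_cast; linarith) hc
  obtain ⟨K₅, hK₅, h₅⟩ := exists_norm_sum_differenced_le diffTest_five (by norm_num) (by norm_num)
    (by norm_num) (by norm_num) hc1 hc2 (by push_cast; linarith) hc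
  refine ⟨3 * (K₃ + K₄ + K₅), by linarith, ?_⟩
  intro P hP θ hθ1 hθ2 M N L hN hNM hMN hL hLP e n₁ n₂ he h1 h2 hne hdiv
  have hP0 : 0 < P := by linarith
  have hθ0 : 0 < |θ| := lt_of_lt_of_le (by positivity) hθ1
  have hN0 : (0 : ℝ) < N := by exact_mod_cast hN
  have hM0 : (0 : ℝ) < M := by exact_mod_cast hN.trans hNM
  obtain ⟨μ, hμ⟩ : ∃ μ, P ^ μ = (M : ℝ) := ⟨_, Real.rpow_logb hP0 hP.ne' hM0⟩
  obtain ⟨ν, hν⟩ : ∃ ν, P ^ ν = (N : ℝ) := ⟨_, Real.rpow_logb hP0 hP.ne' hN0⟩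
  obtain ⟨t, ht⟩ : ∃ t, P ^ t = |θ| := ⟨_, Real.rpow_logb hP0 hP.ne' hθ0⟩
  have hle : ∀ {x y : ℝ}, P ^ x ≤ P ^ y → x ≤ y := fun h => (Real.rpow_le_rpow_left_iff hP).1 h
  obtain ⟨k, a, b, hkab, hE1, hE2⟩ := exists_test_exponents (c := c) (μ := μ) (ν := ν) (t := t) hc2
    (hle (by rw [hμ, hν]; exact_mod_cast hNM))
    (hle (by rw [hν, Real.rpow_zero]; exact_mod_cast hN))
    (hle (by rw [Real.rpow_add hP0, hμ, hν, Real.rpow_one]; exact hMN))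
    (hle (by rw [ht]; exact hθ1)) (hle (by rw [ht]; exact hθ2))
  have hk : ∃ K, 0 ≤ K ∧ K ≤ K₃ + K₄ + K₅ ∧ 0 ≤ a ∧ a ≤ 1 ∧
      ‖∑ m ∈ Ico M e, eC (θ * ((n₁ : ℝ) ^ c - (n₂ : ℝ) ^ c) * (m : ℝ) ^ c)‖ ≤
        K * (M * (|θ| * L * (N : ℝ) ^ (c - 1) * (M : ℝ) ^ (c - k)) ^ a +
          (M : ℝ) ^ b * (|θ| * (N : ℝ) ^ (c - 1) * (M : ℝ) ^ (c - k)) ^ (-a)) := by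
    have hM := hN.trans hNM
    rcases hkab with h | h | h <;> simp only [Prod.mk.injEq] at h <;> obtain ⟨rfl, rfl, rfl⟩ := h
    · exact ⟨K₃, by linarith, by linarith, by norm_num, by norm_num,
        h₃ θ (abs_pos.1 hθ0) M N L e n₁ n₂ hM hN hL he h1 h2 hne hdiv⟩
    · exact ⟨K₄, by linarith, by linarith, by norm_num, by norm_num,
        h₄ θ (abs_pos.1 hθ0) M N L e n₁ n₂ hM hN hL he h1 h2 hne hdiv⟩
    · exact ⟨K₅, by linarith, by linarith, by norm_num, by norm_num,
        h₅ θ (abs_pos.1 hθ0) M N L e n₁ n₂ hM hN hL he h1 h2 hne hdiv⟩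
  obtain ⟨K, hK0, hK, ha0, ha1, hbound⟩ := hk
  have hX1 : (|θ| * L * (N : ℝ) ^ (c - 1) * (M : ℝ) ^ (c - k)) ^ a ≤
      2 * P ^ (a * (t + 294 / 10000 + (c - 1) * ν + (c - k) * μ)) := by
    calc _ ≤ (|θ| * (2 * P ^ (294 / 10000 : ℝ)) * (N : ℝ) ^ (c - 1) * (M : ℝ) ^ (c - k)) ^ a := by
          gcongr
      _ = (2 * P ^ (t + 294 / 10000 + (c - 1) * ν + (c - k) * μ)) ^ a := by
          rw [← ht, ← hμ, ← hν, ← Real.rpow_mul hP0.le, ← Real.rpow_mul hP0.le,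
            Real.rpow_add hP0, Real.rpow_add hP0, Real.rpow_add hP0,
            mul_comm (c - 1), mul_comm (c - k)]
          congr 1
          ring
      _ = (2 : ℝ) ^ a * P ^ (a * (t + 294 / 10000 + (c - 1) * ν + (c - k) * μ)) := by
          rw [Real.mul_rpow (by norm_num) (by positivity), ← Real.rpow_mul hP0.le, mul_comm a]
      _ ≤ (2 : ℝ) ^ (1 : ℝ) * P ^ (a * (t + 294 / 10000 + (c - 1) * ν + (c - k) * μ)) := by
          gcongr
          norm_num
      _ = _ := by rw [Real.rpow_one]
  have hX2 : (|θ| * (N : ℝ) ^ (c - 1) * (M : ℝ) ^ (c - k)) ^ (-a) =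
      P ^ (-(a * (t + (c - 1) * ν + (c - k) * μ))) := by
    rw [← ht, ← hμ, ← hν, ← Real.rpow_mul hP0.le, ← Real.rpow_mul hP0.le, ← Real.rpow_add hP0,
      ← Real.rpow_add hP0, ← Real.rpow_mul hP0.le]
    congr 1
    ring
  have hNM2 : (N : ℝ) ^ 2 * M = P ^ (2 * ν + μ) := by
    rw [Real.rpow_add hP0, hμ, two_mul, Real.rpow_add hP0, hν, sq]
  calc _ ≤ (K * (M * (2 * P ^ (a * (t + 294 / 10000 + (c - 1) * ν + (c - k) * μ))) +
          (M : ℝ) ^ b * P ^ (-(a * (t + (c - 1) * ν + (c - k) * μ))))) * ((N : ℝ) ^ 2 * M) := by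
        gcongr
        refine hbound.trans ?_
        rw [hX2]
        gcongr
    _ = K * (2 * P ^ (2 * ν + μ + (μ + a * (t + 294 / 10000 + (c - 1) * ν + (c - k) * μ))) +
          P ^ (2 * ν + μ + (b * μ - a * (t + (c - 1) * ν + (c - k) * μ)))) := by
        rw [hNM2, ← hμ, ← Real.rpow_mul hP0.le, sub_eq_add_neg (b * μ), Real.rpow_add hP0 (2 * ν + μ),
          Real.rpow_add hP0 (2 * ν + μ), Real.rpow_add hP0 μ, mul_comm μ b, Real.rpow_add hP0 (b * μ)]
        ring
    _ ≤ (K₃ + K₄ + K₅) * (2 * P ^ (19706 / 10000 : ℝ) + P ^ (19706 / 10000 : ℝ)) := by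
        gcongr <;> exact hP.le
    _ = _ := by ring

/-- Bilinear sums over a dyadic box, the longer variable first. -/
lemma exists_norm_bilinear_le {c : ℝ} (hc1 : 1 < c) (hc2 : c ≤ 20551 / 10000)
    (hc : ∀ j : ℕ, c ≠ j) :
    ∃ K : ℝ, 1 ≤ K ∧ ∀ P : ℝ, 1 < P → ∀ θ : ℝ, P ^ (1 - c - 1 / 1000) ≤ |θ| →
      |θ| ≤ P ^ (148 / 10000 : ℝ) → ∀ M N X : ℕ, P ^ (294 / 10000 : ℝ) ≤ N → N ≤ M →
      (M * N : ℝ) ≤ P → ∀ a b : ℕ → ℂ,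
      ‖∑ m ∈ Ico M (2 * M), ∑ n ∈ Ico N (2 * N),
        a m * b n * (if m * n ≤ X then eC (θ * ((m * n : ℕ) : ℝ) ^ c) else 0)‖ ^ 2 * (M * N) ≤
        K * P ^ (19706 / 10000 : ℝ) * (∑ m ∈ Ico M (2 * M), ‖a m‖ ^ 2) *
          ∑ n ∈ Ico N (2 * N), ‖b n‖ ^ 2 := by
  obtain ⟨K, hK, hmain⟩ := exists_norm_sum_differenced_le_rpow hc1 hc2 hc
  refine ⟨3 * (1 + K), by linarith, ?_⟩
  intro P hP θ hθ1 hθ2 M N X hPN hNM hMN a b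
  have hP0 : 0 < P := by linarith
  set Q := P ^ (294 / 10000 : ℝ) with hQ
  have hQ1 : 1 ≤ Q := Real.one_le_rpow hP.le (by norm_num)
  set L := ⌈Q⌉₊ with hLdef
  have hQL : Q ≤ L := Nat.le_ceil Q
  have hL1 : 1 ≤ L := by exact_mod_cast hQ1.trans hQL
  have hL2 : (L : ℝ) ≤ 2 * Q := by
    have := Nat.ceil_lt_add_one (zero_le_one.trans hQ1)
    linarith
  have hLN : L ≤ N := Nat.ceil_le.2 hPN
  have hN1 : 1 ≤ N := hL1.trans hLN
  have hM1 : 1 ≤ M := hN1.trans hNM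
  have hN0 : (0 : ℝ) < N := by exact_mod_cast hN1
  have hM0 : (0 : ℝ) < M := by exact_mod_cast hM1
  have hL0 : (0 : ℝ) < L := by exact_mod_cast hL1
  set W := P ^ (19706 / 10000 : ℝ) with hW
  have hW0 : 0 < W := by positivity
  set E := K * W / ((N : ℝ) ^ 2 * M) with hE
  have hE0 : 0 ≤ E := by positivity
  have hJ : (((Ico N (2 * N)).image (· / L)).card : ℕ) ≤ N / L + 2 := by
    have : (Ico N (2 * N)).image (· / L) ⊆ Ico (N / L) (N / L + (N / L + 2)) := by
      intro j hj
      obtain ⟨n, hn, rfl⟩ := mem_image.1 hj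
      rw [mem_Ico] at hn ⊢
      refine ⟨Nat.div_le_div_right hn.1, ?_⟩
      rw [Nat.div_lt_iff_lt_mul (by omega)]
      have h1 := Nat.div_add_mod' N L
      have h2 := Nat.mod_lt N (by omega : 0 < L)
      nlinarith
    have := card_le_card this
    rwa [Nat.card_Ico, Nat.add_sub_cancel_left] at this
  have hJ' : ((N / L + 2 : ℕ) : ℝ) ≤ 3 * (N / L) := by
    have h1 : ((N / L : ℕ) : ℝ) ≤ (N : ℝ) / L := Nat.cast_div_le
    have h2 : (1 : ℝ) ≤ (N : ℝ) / L := by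
      rw [le_div_iff₀ hL0, one_mul]
      exact_mod_cast hLN
    push_cast
    linarith
  have key := norm_bilinear_sq_le (s := Ico M (2 * M)) (t := Ico N (2 * N)) a b
    (fun m n => if m * n ≤ X then eC (θ * ((m * n : ℕ) : ℝ) ^ c) else 0) (D := M) (E := E)
    hL1 hE0 hJ ?_ ?_
  · have hM2 : (M : ℝ) * N * (3 * (N / L) * (M + L * E)) ≤ 3 * (1 + K) * W := by
      have e1 : (M : ℝ) * N * (3 * (N / L) * (M + L * E)) =
          3 * ((M * N) ^ 2 / L + K * W) := by
        rw [hE]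
        field_simp
      have e2 : (M * N : ℝ) ^ 2 / L ≤ W := by
        rw [div_le_iff₀ hL0]
        calc (M * N : ℝ) ^ 2 ≤ P ^ 2 := by gcongr
          _ = W * Q := by
            rw [hW, hQ, ← Real.rpow_add hP0, ← Real.rpow_natCast]
            norm_num
          _ ≤ W * L := by gcongr
      rw [e1]
      linarith
    have hA : 0 ≤ ∑ m ∈ Ico M (2 * M), ‖a m‖ ^ 2 := by positivity
    have hB : 0 ≤ ∑ n ∈ Ico N (2 * N), ‖b n‖ ^ 2 := by positivity
    calc _ ≤ ((N / L + 2 : ℕ) : ℝ) * (M + L * E) * (∑ m ∈ Ico M (2 * M), ‖a m‖ ^ 2) *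
          (∑ n ∈ Ico N (2 * N), ‖b n‖ ^ 2) * (M * N) := by gcongr
      _ ≤ 3 * (N / L) * (M + L * E) * (∑ m ∈ Ico M (2 * M), ‖a m‖ ^ 2) *
          (∑ n ∈ Ico N (2 * N), ‖b n‖ ^ 2) * (M * N) := by gcongr
      _ = M * N * (3 * (N / L) * (M + L * E)) * ((∑ m ∈ Ico M (2 * M), ‖a m‖ ^ 2) *
          (∑ n ∈ Ico N (2 * N), ‖b n‖ ^ 2)) := by ring
      _ ≤ 3 * (1 + K) * W * ((∑ m ∈ Ico M (2 * M), ‖a m‖ ^ 2) *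
          (∑ n ∈ Ico N (2 * N), ‖b n‖ ^ 2)) := by gcongr
      _ = _ := by ring
  · intro n _
    have : ((Ico M (2 * M)).card : ℝ) = M := by
      rw [Nat.card_Ico]
      congr 1
      omega
    rw [← this, ← nsmul_one, ← sum_const]
    refine norm_sum_le_of_le _ fun m _ => ?_
    rw [norm_mul, RCLike.norm_conj]
    split_ifs <;> simp [norm_eC]
  · intro n₁ h1 n₂ h2 hne hdiv
    have hn1 : 1 ≤ n₁ := hN1.trans (mem_Ico.1 h1).1
    have hn2 : 1 ≤ n₂ := hN1.trans (mem_Ico.1 h2).1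
    have hb := hmain P hP θ hθ1 hθ2 M N L hN1 hNM hMN hL1 hL2
      (min (2 * M) (min (X / n₁ + 1) (X / n₂ + 1))) n₁ n₂ (min_le_left _ _) h1 h2 hne hdiv
    rw [hE, le_div_iff₀ (by positivity)]
    refine le_trans (le_of_eq ?_) hb
    congr 2
    have hset : Ico M (min (2 * M) (min (X / n₁ + 1) (X / n₂ + 1))) =
        (Ico M (2 * M)).filter (fun m => m * n₁ ≤ X ∧ m * n₂ ≤ X) := by
      ext m
      simp only [mem_Ico, mem_filter, lt_min_iff, Nat.lt_succ_iff,
        Nat.le_div_iff_mul_le hn1, Nat.le_div_iff_mul_le hn2]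
      tauto
    rw [hset, sum_filter]
    refine sum_congr rfl fun m _ => ?_
    by_cases g1 : m * n₁ ≤ X
    · by_cases g2 : m * n₂ ≤ X
      · rw [if_pos g1, if_pos g2, if_pos ⟨g1, g2⟩, ← eC_sub]
        congr 1
        rw [Nat.cast_mul, Nat.cast_mul, Real.mul_rpow (by positivity) (by positivity),
          Real.mul_rpow (by positivity) (by positivity)]
        ring
      · simp [g2]
    · simp [g1]

/-! ### Divisor sums -/

lemma sum_Ioc_sum_divisorsAntidiagonal {R : Type*} [AddCommMonoid R] (F : ℕ → ℕ → R) (N : ℕ) :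
    ∑ n ∈ Ioc 0 N, ∑ x ∈ n.divisorsAntidiagonal, F x.1 x.2 =
      ∑ d ∈ Ioc 0 N, ∑ m ∈ Ioc 0 (N / d), F d m := by
  rw [sum_sigma', sum_sigma']
  refine sum_bij' (fun x _ => ⟨x.2.1, x.2.2⟩) (fun x _ => ⟨x.1 * x.2, (x.1, x.2)⟩) ?_ ?_ ?_ ?_ ?_
  · rintro ⟨n, d, m⟩ h
    simp only [mem_sigma, mem_Ioc, Nat.mem_divisorsAntidiagonal] at h ⊢
    obtain ⟨⟨hn, hN⟩, rfl, h0⟩ := h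
    have hd : 0 < d := Nat.pos_of_ne_zero (left_ne_zero_of_mul h0)
    have hm : 0 < m := Nat.pos_of_ne_zero (right_ne_zero_of_mul h0)
    refine ⟨⟨hd, (Nat.le_mul_of_pos_right d hm).trans hN⟩, hm, ?_⟩
    rw [Nat.le_div_iff_mul_le hd, mul_comm]
    exact hN
  · rintro ⟨d, m⟩ h
    simp only [mem_sigma, mem_Ioc, Nat.mem_divisorsAntidiagonal] at h ⊢
    obtain ⟨⟨hd, hN⟩, hm, hmN⟩ := h
    rw [Nat.le_div_iff_mul_le hd, mul_comm] at hmN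
    exact ⟨⟨Nat.mul_pos hd hm, hmN⟩, trivial, (Nat.mul_pos hd hm).ne'⟩
  · rintro ⟨n, d, m⟩ h
    simp only [mem_sigma, Nat.mem_divisorsAntidiagonal] at h
    simp [h.2.1]
  · rintro ⟨d, m⟩ _
    rfl
  · rintro ⟨n, d, m⟩ _
    rfl

lemma card_divisors_eq_sum (n : ℕ) :
    (n.divisors.card : ℝ) = ∑ _x ∈ n.divisorsAntidiagonal, (1 : ℝ) := by
  rw [sum_const, nsmul_one, ← Nat.map_div_right_divisors, card_map]

lemma sum_Ioc_inv_le (N : ℕ) : ∑ d ∈ Ioc 0 N, (d : ℝ)⁻¹ ≤ 1 + log N := by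
  have h := harmonic_le_one_add_log N
  rw [harmonic_eq_sum_Icc] at h
  push_cast at h
  exact h

lemma sum_Ioc_card_divisors_le (N : ℕ) :
    ∑ n ∈ Ioc 0 N, (n.divisors.card : ℝ) ≤ N * (1 + log N) := by
  simp only [card_divisors_eq_sum]
  rw [sum_Ioc_sum_divisorsAntidiagonal (fun _ _ => (1 : ℝ))]
  calc _ ≤ ∑ d ∈ Ioc 0 N, (N : ℝ) * (d : ℝ)⁻¹ := by
        refine sum_le_sum fun d _ => ?_
        rw [sum_const, nsmul_one, Nat.card_Ioc, Nat.sub_zero, ← div_eq_mul_inv]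
        exact Nat.cast_div_le
    _ ≤ _ := by
        rw [← mul_sum]
        gcongr
        exact sum_Ioc_inv_le N

lemma sum_Ioc_card_divisors_div_le (N : ℕ) :
    ∑ n ∈ Ioc 0 N, (n.divisors.card : ℝ) * (n : ℝ)⁻¹ ≤ (1 + log N) ^ 2 := by
  have h1 : ∀ n : ℕ, (n.divisors.card : ℝ) * (n : ℝ)⁻¹ =
      ∑ x ∈ n.divisorsAntidiagonal, (x.1 : ℝ)⁻¹ * (x.2 : ℝ)⁻¹ := by
    intro n
    rw [card_divisors_eq_sum, sum_mul]
    refine sum_congr rfl fun x hx => ?_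
    rw [← (Nat.mem_divisorsAntidiagonal.1 hx).1, Nat.cast_mul, mul_inv, one_mul]
  simp only [h1]
  rw [sum_Ioc_sum_divisorsAntidiagonal (fun d m => (d : ℝ)⁻¹ * (m : ℝ)⁻¹)]
  have hH := sum_Ioc_inv_le N
  calc _ ≤ ∑ d ∈ Ioc 0 N, (d : ℝ)⁻¹ * ∑ m ∈ Ioc 0 N, (m : ℝ)⁻¹ := by
        refine sum_le_sum fun d _ => ?_
        rw [← mul_sum]
        gcongr
        exact Nat.div_le_self N d
    _ = (∑ d ∈ Ioc 0 N, (d : ℝ)⁻¹) ^ 2 := by rw [← sum_mul, sq]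
    _ ≤ _ := by gcongr

lemma card_divisors_mul_le (m n : ℕ) :
    (m * n).divisors.card ≤ m.divisors.card * n.divisors.card := by
  rw [Nat.divisors_mul]
  exact card_mul_le

lemma sum_Ioc_card_divisors_sq_le (N : ℕ) :
    ∑ n ∈ Ioc 0 N, (n.divisors.card : ℝ) ^ 2 ≤ N * (1 + log N) ^ 3 := by
  have h1 : ∀ n : ℕ, (n.divisors.card : ℝ) ^ 2 =
      ∑ x ∈ n.divisorsAntidiagonal, ((x.1 * x.2).divisors.card : ℝ) := by
    intro n
    rw [sq]
    nth_rw 1 [card_divisors_eq_sum]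
    rw [sum_mul]
    refine sum_congr rfl fun x hx => ?_
    rw [(Nat.mem_divisorsAntidiagonal.1 hx).1, one_mul]
  simp only [h1]
  rw [sum_Ioc_sum_divisorsAntidiagonal (fun d m => ((d * m).divisors.card : ℝ))]
  have hlog : 0 ≤ log N := Real.log_natCast_nonneg N
  calc _ ≤ ∑ d ∈ Ioc 0 N, (d.divisors.card : ℝ) * (d : ℝ)⁻¹ * (N * (1 + log N)) := by
        refine sum_le_sum fun d hd => ?_
        have hd0 : 0 < d := (mem_Ioc.1 hd).1
        calc _ ≤ ∑ m ∈ Ioc 0 (N / d), (d.divisors.card : ℝ) * m.divisors.card :=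
              sum_le_sum fun m _ => by exact_mod_cast card_divisors_mul_le d m
          _ = d.divisors.card * ∑ m ∈ Ioc 0 (N / d), (m.divisors.card : ℝ) := by rw [mul_sum]
          _ ≤ d.divisors.card * ((N / d : ℕ) * (1 + log (N / d : ℕ))) := by
              gcongr
              exact sum_Ioc_card_divisors_le _
          _ ≤ d.divisors.card * ((N : ℝ) * (d : ℝ)⁻¹ * (1 + log N)) := by
              have h2 : ((N / d : ℕ) : ℝ) ≤ N * (d : ℝ)⁻¹ := by
                rw [← div_eq_mul_inv]; exact Nat.cast_div_le
              have h3 : log ((N / d : ℕ) : ℝ) ≤ log N := by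
                rcases Nat.eq_zero_or_pos (N / d) with h | h
                · rw [h]; simpa using hlog
                · exact Real.log_le_log (by exact_mod_cast h) (by exact_mod_cast Nat.div_le_self N d)
              have h4 : 0 ≤ log ((N / d : ℕ) : ℝ) := Real.log_natCast_nonneg _
              gcongr
          _ = _ := by ring
    _ = (∑ d ∈ Ioc 0 N, (d.divisors.card : ℝ) * (d : ℝ)⁻¹) * (N * (1 + log N)) := by rw [sum_mul]
    _ ≤ (1 + log N) ^ 2 * (N * (1 + log N)) := by
        gcongr
        exact sum_Ioc_card_divisors_div_le N
    _ = _ := by ring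

lemma sum_Ico_two_pow {R : Type*} [AddCommMonoid R] (g : ℕ → R) (I : ℕ) :
    ∑ n ∈ Ico 1 (2 ^ I), g n = ∑ i ∈ range I, ∑ n ∈ Ico (2 ^ i) (2 * 2 ^ i), g n := by
  induction I with
  | zero => simp
  | succ I ih =>
    rw [sum_range_succ, ← ih, pow_succ', sum_Ico_consecutive g Nat.one_le_two_pow (by omega)]

lemma sum_norm_sq_le_of_le_card_divisors {a : ℕ → ℂ} {B P : ℝ} (hP : 1 ≤ P) {M : ℕ} (hM : 1 ≤ M)
    (hMP : (M : ℝ) ≤ P) (ha : ∀ n : ℕ, 1 ≤ n → ‖a n‖ ≤ B * n.divisors.card) :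
    ∑ m ∈ Ico M (2 * M), ‖a m‖ ^ 2 ≤ B ^ 2 * (16 * M * (1 + log P) ^ 3) := by
  have hM0 : (0 : ℝ) < M := by exact_mod_cast hM
  have hlogP : 0 ≤ log P := Real.log_nonneg hP
  have hlog : 1 + log ((2 * M : ℕ) : ℝ) ≤ 2 * (1 + log P) := by
    push_cast
    rw [Real.log_mul (by norm_num) hM0.ne']
    have h1 := Real.log_le_log hM0 hMP
    have h2 := Real.log_two_lt_d9
    linarith
  have hlog0 : 0 ≤ log ((2 * M : ℕ) : ℝ) := Real.log_natCast_nonneg _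
  calc ∑ m ∈ Ico M (2 * M), ‖a m‖ ^ 2
      ≤ ∑ m ∈ Ico M (2 * M), B ^ 2 * (m.divisors.card : ℝ) ^ 2 := by
        refine sum_le_sum fun m hm => ?_
        rw [← mul_pow]
        gcongr
        exact ha m (hM.trans (mem_Ico.1 hm).1)
    _ ≤ ∑ m ∈ Ioc 0 (2 * M), B ^ 2 * (m.divisors.card : ℝ) ^ 2 := by
        refine sum_le_sum_of_subset_of_nonneg ?_ fun _ _ _ => by positivity
        intro m hm
        rw [mem_Ico] at hm
        rw [mem_Ioc]
        omega
    _ = B ^ 2 * ∑ m ∈ Ioc 0 (2 * M), (m.divisors.card : ℝ) ^ 2 := by rw [mul_sum]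
    _ ≤ B ^ 2 * ((2 * M : ℕ) * (1 + log ((2 * M : ℕ) : ℝ)) ^ 3) := by
        gcongr
        exact sum_Ioc_card_divisors_sq_le _
    _ ≤ B ^ 2 * ((2 * M : ℕ) * (2 * (1 + log P)) ^ 3) := by gcongr
    _ = _ := by push_cast; ring

/-- Bilinear sums whose coefficients are divisor bounded and vanish on an initial segment. -/
lemma exists_norm_typeII_le {c : ℝ} (hc1 : 1 < c) (hc2 : c ≤ 20551 / 10000)
    (hc : ∀ j : ℕ, c ≠ j) :
    ∃ K : ℝ, 1 ≤ K ∧ ∀ P : ℝ, 1 < P → ∀ θ : ℝ, P ^ (1 - c - 1 / 1000) ≤ |θ| →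
      |θ| ≤ P ^ (148 / 10000 : ℝ) → ∀ X : ℕ, (X : ℝ) ≤ P → ∀ U : ℝ,
      2 * P ^ (294 / 10000 : ℝ) ≤ U → ∀ a b : ℕ → ℂ, (∀ n : ℕ, n ≤ U → a n = 0) →
      (∀ n : ℕ, n ≤ U → b n = 0) →
      (∀ n : ℕ, 1 ≤ n → ‖a n‖ ≤ (1 + log P) * n.divisors.card) →
      (∀ n : ℕ, 1 ≤ n → ‖b n‖ ≤ (1 + log P) * n.divisors.card) →
      ‖∑ m ∈ Ioc 0 X, ∑ n ∈ Ioc 0 (X / m), a m * b n * eC (θ * ((m * n : ℕ) : ℝ) ^ c)‖ ≤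
        K * P ^ (9854 / 10000 : ℝ) := by
  obtain ⟨K, hK, hmain⟩ := exists_norm_bilinear_le hc1 hc2 hc
  set κ : ℝ := 1 + 1 / (1 / 100000) with hκ
  refine ⟨4 * (16 * K) * κ ^ 7, ?_, ?_⟩
  · rw [hκ]; norm_num; linarith
  intro P hP θ hθ1 hθ2 X hXP U hU a b ha hb ha' hb'
  have hP0 : 0 < P := by linarith
  set ℓ := 1 + log P with hℓ
  have hℓ1 : 1 ≤ ℓ := by linarith [Real.log_nonneg hP.le]
  set g : ℕ → ℕ → ℂ := fun m n => a m * b n * (if m * n ≤ X then eC (θ * ((m * n : ℕ) : ℝ) ^ c) else 0)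
    with hg
  have hW0 : 0 < P ^ (19706 / 10000 : ℝ) := by positivity
  have hhalf : ∀ x : ℕ, 1 ≤ x → ¬ (2 * x : ℝ) ≤ U → P ^ (294 / 10000 : ℝ) ≤ x := by
    intro x _ h
    linarith
  have hbound : ∀ a' b' : ℕ → ℂ, (∀ n : ℕ, 1 ≤ n → ‖a' n‖ ≤ ℓ * n.divisors.card) →
      (∀ n : ℕ, 1 ≤ n → ‖b' n‖ ≤ ℓ * n.divisors.card) → ∀ M N : ℕ,
      P ^ (294 / 10000 : ℝ) ≤ N → 1 ≤ N → N ≤ M → (M * N : ℝ) ≤ P →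
      ‖∑ m ∈ Ico M (2 * M), ∑ n ∈ Ico N (2 * N),
        a' m * b' n * (if m * n ≤ X then eC (θ * ((m * n : ℕ) : ℝ) ^ c) else 0)‖ ≤
        16 * K * (ℓ ^ 5 * P ^ (9853 / 10000 : ℝ)) := by
    intro a' b' ha' hb' M N hPN hN hNM hMN
    have h1 := hmain P hP θ hθ1 hθ2 M N X hPN hNM hMN a' b'
    have hN1 : (1 : ℝ) ≤ N := by exact_mod_cast hN
    have hM1 : (1 : ℝ) ≤ M := by exact_mod_cast hN.trans hNM
    have hMP : (M : ℝ) ≤ P := by nlinarith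
    have hNP : (N : ℝ) ≤ P := by nlinarith
    have h2 := sum_norm_sq_le_of_le_card_divisors hP.le (hN.trans hNM) hMP ha'
    have h3 := sum_norm_sq_le_of_le_card_divisors hP.le hN hNP hb'
    rw [← hℓ] at h2 h3
    refine abs_le_of_sq_le_sq' ?_ (by positivity) |>.2
    rw [← mul_le_mul_iff_left₀ (by positivity : (0 : ℝ) < M * N)]
    calc _ ≤ _ := h1
      _ ≤ K * P ^ (19706 / 10000 : ℝ) * (ℓ ^ 2 * (16 * M * ℓ ^ 3)) *
          (ℓ ^ 2 * (16 * N * ℓ ^ 3)) := by gcongr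
      _ = 256 * K * (ℓ ^ 5 * P ^ (9853 / 10000 : ℝ)) ^ 2 * (M * N) := by
          rw [mul_pow, ← Real.rpow_natCast (P ^ _), ← Real.rpow_mul hP0.le]
          norm_num
          ring
      _ ≤ 256 * (K * K) * (ℓ ^ 5 * P ^ (9853 / 10000 : ℝ)) ^ 2 * (M * N) := by
          gcongr
          nlinarith
      _ = _ := by ring
  have hbox : ∀ M N : ℕ, 1 ≤ M → 1 ≤ N → ‖∑ m ∈ Ico M (2 * M), ∑ n ∈ Ico N (2 * N), g m n‖ ≤
      16 * K * (ℓ ^ 5 * P ^ (9853 / 10000 : ℝ)) := by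
    intro M N hM hN
    have hzero : (∀ m ∈ Ico M (2 * M), ∀ n ∈ Ico N (2 * N), g m n = 0) →
        ‖∑ m ∈ Ico M (2 * M), ∑ n ∈ Ico N (2 * N), g m n‖ ≤
          16 * K * (ℓ ^ 5 * P ^ (9853 / 10000 : ℝ)) := by
      intro h
      rw [sum_eq_zero fun m hm => sum_eq_zero (h m hm), norm_zero]
      positivity
    by_cases hX : X < M * N
    · refine hzero fun m hm n hn => ?_
      have : M * N ≤ m * n := Nat.mul_le_mul (mem_Ico.1 hm).1 (mem_Ico.1 hn).1
      simp only [hg]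
      rw [if_neg (by omega), mul_zero]
    have hMN : (M * N : ℝ) ≤ P := by
      refine le_trans ?_ hXP
      exact_mod_cast not_lt.1 hX
    by_cases hMU : (2 * M : ℝ) ≤ U
    · refine hzero fun m hm n _ => ?_
      have : (m : ℝ) ≤ 2 * M := by exact_mod_cast (mem_Ico.1 hm).2.le
      simp only [hg]
      rw [ha m (this.trans hMU), zero_mul, zero_mul]
    by_cases hNU : (2 * N : ℝ) ≤ U
    · refine hzero fun m _ n hn => ?_
      have : (n : ℝ) ≤ 2 * N := by exact_mod_cast (mem_Ico.1 hn).2.le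
      simp only [hg]
      rw [hb n (this.trans hNU), mul_zero, zero_mul]
    rcases le_total N M with h | h
    · exact hbound a b ha' hb' M N (hhalf N hN hNU) hN h hMN
    · have h1 := hbound b a hb' ha' N M (hhalf M hM hMU) hM h (by rwa [mul_comm])
      rw [sum_comm] at h1
      refine le_trans (le_of_eq ?_) h1
      congr 1
      refine sum_congr rfl fun m _ => sum_congr rfl fun n _ => ?_
      simp only [hg]
      rw [mul_comm n m, mul_comm (b n)]
  set I := Nat.log 2 X + 1 with hI
  have hXI : X < 2 ^ I := Nat.lt_pow_succ_log_self (by norm_num) X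
  have hS : ∑ m ∈ Ioc 0 X, ∑ n ∈ Ioc 0 (X / m), a m * b n * eC (θ * ((m * n : ℕ) : ℝ) ^ c) =
      ∑ i ∈ range I, ∑ j ∈ range I, ∑ m ∈ Ico (2 ^ i) (2 * 2 ^ i), ∑ n ∈ Ico (2 ^ j) (2 * 2 ^ j),
        g m n := by
    have e1 : ∀ i, ∑ j ∈ range I, ∑ m ∈ Ico (2 ^ i) (2 * 2 ^ i), ∑ n ∈ Ico (2 ^ j) (2 * 2 ^ j),
        g m n = ∑ m ∈ Ico (2 ^ i) (2 * 2 ^ i), ∑ n ∈ Ico 1 (2 ^ I), g m n := by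
      intro i
      rw [sum_comm]
      exact sum_congr rfl fun m _ => (sum_Ico_two_pow _ _).symm
    simp only [e1]
    rw [← sum_Ico_two_pow (fun m => ∑ n ∈ Ico 1 (2 ^ I), g m n)]
    have hsub : Ioc 0 X ⊆ Ico 1 (2 ^ I) := by
      intro m hm
      rw [mem_Ioc] at hm
      rw [mem_Ico]
      omega
    rw [← sum_subset hsub]
    · refine sum_congr rfl fun m hm => ?_
      have hm0 := (mem_Ioc.1 hm).1
      have hset : Ioc 0 (X / m) = (Ico 1 (2 ^ I)).filter (fun n => m * n ≤ X) := by
        ext n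
        rw [mem_Ioc, mem_filter, mem_Ico, Nat.le_div_iff_mul_le hm0, mul_comm n m]
        constructor
        · rintro ⟨h1, h2⟩
          have : n ≤ m * n := Nat.le_mul_of_pos_left n hm0
          omega
        · rintro ⟨h1, h2⟩
          omega
      rw [hset, sum_filter]
      refine sum_congr rfl fun n _ => ?_
      simp only [hg]
      split_ifs <;> simp
    · intro m hm hm'
      refine sum_eq_zero fun n hn => ?_
      have hn1 := (mem_Ico.1 hn).1
      have hm1 := (mem_Ico.1 hm).1
      have : m ≤ m * n := Nat.le_mul_of_pos_right m hn1
      rw [mem_Ioc] at hm'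
      simp only [hg]
      rw [if_neg (by omega), mul_zero]
  have hIle : (I : ℝ) ≤ 2 * κ * P ^ (1 / 100000 : ℝ) := by
    rw [hI]
    push_cast
    exact natLog_add_one_le_rpow (by norm_num) hP.le hXP
  have hℓle : ℓ ≤ κ * P ^ (1 / 100000 : ℝ) := one_add_log_le_rpow (by norm_num) hP.le
  have hκ0 : 0 < κ := by rw [hκ]; norm_num
  rw [hS]
  calc _ ≤ ∑ i ∈ range I, ∑ j ∈ range I, 16 * K * (ℓ ^ 5 * P ^ (9853 / 10000 : ℝ)) :=
        norm_sum_le_of_le _ fun i _ => norm_sum_le_of_le _ fun j _ =>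
          hbox _ _ Nat.one_le_two_pow Nat.one_le_two_pow
    _ = (I : ℝ) ^ 2 * (16 * K * (ℓ ^ 5 * P ^ (9853 / 10000 : ℝ))) := by
        simp only [sum_const, card_range, nsmul_eq_mul]
        ring
    _ ≤ (2 * κ * P ^ (1 / 100000 : ℝ)) ^ 2 *
          (16 * K * ((κ * P ^ (1 / 100000 : ℝ)) ^ 5 * P ^ (9853 / 10000 : ℝ))) := by gcongr
    _ = 4 * (16 * K) * κ ^ 7 * ((P ^ (1 / 100000 : ℝ)) ^ 7 * P ^ (9853 / 10000 : ℝ)) := by ring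
    _ ≤ _ := by
        gcongr
        rw [← Real.rpow_natCast, ← Real.rpow_mul hP0.le, ← Real.rpow_add hP0]
        exact Real.rpow_le_rpow_of_exponent_le hP.le (by norm_num)

/-! ### The Vaughan identity -/

/-- The restriction of an arithmetic function to `[1, u]`. -/
noncomputable def truncLE (u : ℕ) (f : ArithmeticFunction ℝ) : ArithmeticFunction ℝ :=
  ⟨fun n => if n ≤ u then f n else 0, by simp⟩

lemma truncLE_apply (u : ℕ) (f : ArithmeticFunction ℝ) (n : ℕ) :
    truncLE u f n = if n ≤ u then f n else 0 := rfl

open ArithmeticFunction in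
lemma vaughan_identity (u : ℕ) :
    (vonMangoldt : ArithmeticFunction ℝ) =
      truncLE u vonMangoldt + truncLE u (moebius : ArithmeticFunction ℝ) * ArithmeticFunction.log -
      truncLE u (moebius : ArithmeticFunction ℝ) * truncLE u vonMangoldt * (zeta : ArithmeticFunction ℝ) +
      (vonMangoldt - truncLE u vonMangoldt) *
        (((moebius : ArithmeticFunction ℝ) - truncLE u (moebius : ArithmeticFunction ℝ)) *
          (zeta : ArithmeticFunction ℝ)) := by
  have h1 : (moebius : ArithmeticFunction ℝ) * (zeta : ArithmeticFunction ℝ) = 1 := coe_moebius_mul_coe_zeta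
  have h2 : (vonMangoldt : ArithmeticFunction ℝ) * (zeta : ArithmeticFunction ℝ) =
      ArithmeticFunction.log := vonMangoldt_mul_zeta
  linear_combination truncLE u (moebius : ArithmeticFunction ℝ) * h2 - (vonMangoldt - truncLE u vonMangoldt) * h1

lemma sum_Ioc_mul_apply (f g : ArithmeticFunction ℝ) (h : ℕ → ℂ) (X : ℕ) :
    ∑ n ∈ Ioc 0 X, ((f * g) n : ℂ) * h n =
      ∑ d ∈ Ioc 0 X, ∑ m ∈ Ioc 0 (X / d), (f d : ℂ) * (g m : ℂ) * h (d * m) := by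
  rw [← sum_Ioc_sum_divisorsAntidiagonal (fun d m => (f d : ℂ) * (g m : ℂ) * h (d * m))]
  refine sum_congr rfl fun n _ => ?_
  rw [ArithmeticFunction.mul_apply]
  push_cast
  rw [sum_mul]
  exact sum_congr rfl fun x hx => by rw [(Nat.mem_divisorsAntidiagonal.1 hx).1]

/-- Linear sums with coefficients supported on `[1, D]`. -/
lemma norm_sum_Ioc_mul_le {f : ℕ → ℝ} {G : ℕ → ℂ} {X D : ℕ} {A B : ℝ} (hA : 0 ≤ A) (hB : 0 ≤ B)
    (hf0 : ∀ d, D < d → f d = 0) (hf : ∀ d, 1 ≤ d → d ≤ X → |f d| ≤ A)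
    (hG : ∀ d, 1 ≤ d → d ≤ X → ‖G d‖ ≤ B) :
    ‖∑ d ∈ Ioc 0 X, (f d : ℂ) * G d‖ ≤ D * (A * B) := by
  calc ‖∑ d ∈ Ioc 0 X, (f d : ℂ) * G d‖ ≤ ∑ d ∈ Ioc 0 X, if d ≤ D then A * B else 0 := by
        refine norm_sum_le_of_le _ fun d hd => ?_
        rw [mem_Ioc] at hd
        split_ifs with h
        · rw [norm_mul, Complex.norm_real, Real.norm_eq_abs]
          exact mul_le_mul (hf d hd.1 hd.2) (hG d hd.1 hd.2) (norm_nonneg _) hA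
        · rw [hf0 d (not_le.1 h)]
          simp
    _ = ((Ioc 0 X).filter (· ≤ D)).card * (A * B) := by
        rw [← sum_filter, sum_const, nsmul_eq_mul]
    _ ≤ _ := by
        gcongr
        have : (Ioc 0 X).filter (· ≤ D) ⊆ Ioc 0 D := fun d hd => by
          simp only [mem_filter, mem_Ioc] at hd ⊢
          omega
        simpa using card_le_card this

open ArithmeticFunction in
lemma abs_moebius_cast_le (d : ℕ) : |((moebius : ArithmeticFunction ℝ) d)| ≤ 1 := by
  rw [intCoe_apply]
  exact_mod_cast abs_moebius_le_one

open ArithmeticFunction in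
lemma abs_truncLE_moebius_le (u d : ℕ) : |truncLE u (moebius : ArithmeticFunction ℝ) d| ≤ 1 := by
  rw [truncLE_apply]
  split_ifs
  · exact abs_moebius_cast_le d
  · simp

open ArithmeticFunction in
lemma abs_truncLE_vonMangoldt_le (u d : ℕ) : |truncLE u vonMangoldt d| ≤ vonMangoldt d := by
  rw [truncLE_apply]
  split_ifs
  · rw [abs_of_nonneg vonMangoldt_nonneg]
  · simp

open ArithmeticFunction in
lemma abs_truncLE_mul_truncLE_le (u d : ℕ) :
    |(truncLE u (moebius : ArithmeticFunction ℝ) * truncLE u vonMangoldt) d| ≤ Real.log d := by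
  rw [mul_apply]
  calc _ ≤ ∑ x ∈ d.divisorsAntidiagonal, |truncLE u (moebius : ArithmeticFunction ℝ) x.1 * truncLE u vonMangoldt x.2| :=
        abs_sum_le_sum_abs _ _
    _ ≤ ∑ x ∈ d.divisorsAntidiagonal, vonMangoldt x.2 := by
        refine sum_le_sum fun x _ => ?_
        rw [abs_mul]
        have h1 := abs_truncLE_moebius_le u x.1
        have h2 := abs_truncLE_vonMangoldt_le u x.2
        nlinarith [abs_nonneg (truncLE u vonMangoldt x.2)]
    _ = Real.log d := by
        rw [Nat.sum_divisorsAntidiagonal' (fun _ j => vonMangoldt j), vonMangoldt_sum]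

lemma truncLE_mul_truncLE_eq_zero {u d : ℕ} (f g : ArithmeticFunction ℝ) (h : u * u < d) :
    (truncLE u f * truncLE u g) d = 0 := by
  rw [ArithmeticFunction.mul_apply]
  refine sum_eq_zero fun x hx => ?_
  rw [truncLE_apply, truncLE_apply]
  have h1 := (Nat.mem_divisorsAntidiagonal.1 hx).1
  split_ifs with h2 h3
  · have := Nat.mul_le_mul h2 h3
    omega
  all_goals simp

open ArithmeticFunction in
lemma moebius_tail_mul_zeta_eq_zero {u n : ℕ} (h : n ≤ u) :
    (((moebius : ArithmeticFunction ℝ) - truncLE u (moebius : ArithmeticFunction ℝ)) *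
      (zeta : ArithmeticFunction ℝ)) n = 0 := by
  rw [coe_mul_zeta_apply]
  refine sum_eq_zero fun d hd => ?_
  have : d ≤ u := (Nat.divisor_le hd).trans h
  rw [sub_eq_add_neg, ArithmeticFunction.add_apply, ArithmeticFunction.neg_apply, truncLE_apply, if_pos this, add_neg_cancel]

open ArithmeticFunction in
lemma abs_moebius_tail_mul_zeta_le (u n : ℕ) :
    |(((moebius : ArithmeticFunction ℝ) - truncLE u (moebius : ArithmeticFunction ℝ)) * (zeta : ArithmeticFunction ℝ)) n| ≤
      n.divisors.card := by
  rw [coe_mul_zeta_apply]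
  calc _ ≤ _ := abs_sum_le_sum_abs _ _
    _ ≤ ∑ _d ∈ n.divisors, (1 : ℝ) := by
        refine sum_le_sum fun d _ => ?_
        rw [sub_eq_add_neg, ArithmeticFunction.add_apply, ArithmeticFunction.neg_apply, truncLE_apply]
        split_ifs
        · simp
        · simpa using abs_moebius_cast_le d
    _ = _ := by simp

open ArithmeticFunction in
lemma sum_vonMangoldt_mul_eq (u X : ℕ) (h : ℕ → ℂ) :
    ∑ n ∈ Ioc 0 X, (vonMangoldt n : ℂ) * h n =
      ∑ n ∈ Ioc 0 X, (truncLE u vonMangoldt n : ℂ) * h n +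
      ∑ d ∈ Ioc 0 X, (truncLE u (moebius : ArithmeticFunction ℝ) d : ℂ) *
        ∑ m ∈ Ioc 0 (X / d), (Real.log m : ℂ) * h (d * m) -
      ∑ d ∈ Ioc 0 X, ((truncLE u (moebius : ArithmeticFunction ℝ) * truncLE u vonMangoldt) d : ℂ) *
        ∑ m ∈ Ioc 0 (X / d), h (d * m) +
      ∑ d ∈ Ioc 0 X, ∑ m ∈ Ioc 0 (X / d), ((vonMangoldt - truncLE u vonMangoldt) d : ℂ) *
        ((((moebius : ArithmeticFunction ℝ) - truncLE u (moebius : ArithmeticFunction ℝ)) *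
          (zeta : ArithmeticFunction ℝ)) m : ℂ) * h (d * m) := by
  have hlog := sum_Ioc_mul_apply (truncLE u (moebius : ArithmeticFunction ℝ)) ArithmeticFunction.log h X
  have hzeta := sum_Ioc_mul_apply
    (truncLE u (moebius : ArithmeticFunction ℝ) * truncLE u vonMangoldt) (zeta : ArithmeticFunction ℝ) h X
  have htail := sum_Ioc_mul_apply (vonMangoldt - truncLE u vonMangoldt)
    (((moebius : ArithmeticFunction ℝ) - truncLE u (moebius : ArithmeticFunction ℝ)) *
      (zeta : ArithmeticFunction ℝ)) h X
  have hlog' : ∑ d ∈ Ioc 0 X, ∑ m ∈ Ioc 0 (X / d), (truncLE u (moebius : ArithmeticFunction ℝ) d : ℂ) *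
        (ArithmeticFunction.log m : ℂ) * h (d * m) =
      ∑ d ∈ Ioc 0 X, (truncLE u (moebius : ArithmeticFunction ℝ) d : ℂ) *
        ∑ m ∈ Ioc 0 (X / d), (Real.log m : ℂ) * h (d * m) := by
    refine sum_congr rfl fun d _ => ?_
    rw [mul_sum]
    exact sum_congr rfl fun m _ => by rw [log_apply, mul_assoc]
  have hzeta' : ∑ d ∈ Ioc 0 X, ∑ m ∈ Ioc 0 (X / d),
        ((truncLE u (moebius : ArithmeticFunction ℝ) * truncLE u vonMangoldt) d : ℂ) *
        ((zeta : ArithmeticFunction ℝ) m : ℂ) * h (d * m) =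
      ∑ d ∈ Ioc 0 X, ((truncLE u (moebius : ArithmeticFunction ℝ) * truncLE u vonMangoldt) d : ℂ) *
        ∑ m ∈ Ioc 0 (X / d), h (d * m) := by
    refine sum_congr rfl fun d _ => ?_
    rw [mul_sum]
    refine sum_congr rfl fun m hm => ?_
    rw [natCoe_apply, zeta_apply, if_neg (by rw [mem_Ioc] at hm; omega)]
    simp
  rw [← hlog', ← hzeta', ← hlog, ← hzeta, ← htail, ← sum_add_distrib, ← sum_sub_distrib, ← sum_add_distrib]
  refine sum_congr rfl fun n _ => ?_
  conv_lhs => rw [vaughan_identity u]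
  rw [ArithmeticFunction.add_apply, sub_eq_add_neg (truncLE u vonMangoldt + _), ArithmeticFunction.add_apply,
    ArithmeticFunction.add_apply, ArithmeticFunction.neg_apply]
  push_cast
  ring

lemma one_le_card_divisors {n : ℕ} (hn : 1 ≤ n) : (1 : ℝ) ≤ n.divisors.card := by
  exact_mod_cast Finset.card_pos.2 ⟨1, Nat.one_mem_divisors.2 (by omega)⟩

open ArithmeticFunction in
/-- Exponential sums over `θ n ^ c` weighted by the von Mangoldt function. -/
lemma exists_norm_sum_vonMangoldt_le {c : ℝ} (hc1 : 1 < c) (hc2 : c ≤ 20551 / 10000) (hc3 : c ≠ 2)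
    (hc : ∀ j : ℕ, c ≠ j) :
    ∃ K : ℝ, 1 ≤ K ∧ ∀ P : ℝ, 1 < P → ∀ θ : ℝ, P ^ (1 - c - 1 / 1000) ≤ |θ| →
      |θ| ≤ P ^ (148 / 10000 : ℝ) → ∀ X : ℕ, (X : ℝ) ≤ P →
      ‖∑ n ∈ Ioc 0 X, (vonMangoldt n : ℂ) * eC (θ * (n : ℝ) ^ c)‖ ≤ K * P ^ (9854 / 10000 : ℝ) := by
  obtain ⟨K₁, hK₁, hlin⟩ := exists_norm_sum_eC_rpow_le hc1 hc2 hc3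
  obtain ⟨K₂, hK₂, hbil⟩ := exists_norm_typeII_le hc1 hc2 hc
  refine ⟨2000 * K₁ + K₂, by linarith, fun P hP θ hθ1 hθ2 X hX => ?_⟩
  have hP0 : 0 < P := by linarith
  have hlogP : 0 ≤ Real.log P := Real.log_nonneg hP.le
  set Y : ℝ := P ^ (294 / 10000 : ℝ) with hY
  have hY1 : 1 ≤ Y := Real.one_le_rpow hP.le (by norm_num)
  set u : ℕ := ⌈2 * Y⌉₊ with hu
  have hu1 : 2 * Y ≤ u := Nat.le_ceil _
  have hu2 : (u : ℝ) ≤ 3 * Y := by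
    have := (Nat.ceil_lt_add_one (by linarith : 0 ≤ 2 * Y)).le
    linarith
  have hlog_le : ∀ d : ℕ, d ≤ X → Real.log d ≤ Real.log P := fun d hd => by
    rcases Nat.eq_zero_or_pos d with rfl | h
    · simpa using hlogP
    · exact Real.log_le_log (by exact_mod_cast h) (le_trans (by exact_mod_cast hd) hX)
  have hΛ_le : ∀ d : ℕ, d ≤ X → vonMangoldt d ≤ Real.log P := fun d hd =>
    vonMangoldt_le_log.trans (hlog_le d hd)
  have hinner : ∀ d : ℕ, 1 ≤ d → ∀ N ≤ X / d, ‖∑ m ∈ Ioc 0 N, eC (θ * ((d * m : ℕ) : ℝ) ^ c)‖ ≤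
      K₁ * P ^ (86 / 100 : ℝ) := fun d hd N hN => by
    refine hlin P hP.le θ hθ1 hθ2 d N hd (le_trans ?_ hX)
    have : d * N ≤ X := (Nat.mul_le_mul_left d hN).trans (Nat.mul_div_le X d)
    exact_mod_cast this
  have hB0 : 0 ≤ K₁ * P ^ (86 / 100 : ℝ) := by positivity
  have T1 : ‖∑ n ∈ Ioc 0 X, (truncLE u vonMangoldt n : ℂ) * eC (θ * (n : ℝ) ^ c)‖ ≤
      u * (Real.log P * 1) := by
    refine norm_sum_Ioc_mul_le hlogP zero_le_one (fun d hd => ?_) (fun d _ hd => ?_)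
      (fun d _ _ => (norm_eC _).le)
    · rw [truncLE_apply, if_neg (not_le.2 hd)]
    · exact (abs_truncLE_vonMangoldt_le u d).trans (hΛ_le d hd)
  have T2 : ‖∑ d ∈ Ioc 0 X, (truncLE u (moebius : ArithmeticFunction ℝ) d : ℂ) *
        ∑ m ∈ Ioc 0 (X / d), (Real.log m : ℂ) * eC (θ * ((d * m : ℕ) : ℝ) ^ c)‖ ≤
      u * (1 * (2 * Real.log P * (K₁ * P ^ (86 / 100 : ℝ)))) := by
    refine norm_sum_Ioc_mul_le zero_le_one (by positivity) (fun d hd => ?_)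
      (fun d _ _ => abs_truncLE_moebius_le u d) (fun d hd1 hd2 => ?_)
    · rw [truncLE_apply, if_neg (not_le.2 hd)]
    · refine (norm_sum_log_mul_le (hinner d hd1)).trans ?_
      exact mul_le_mul_of_nonneg_right
        (mul_le_mul_of_nonneg_left (hlog_le _ (Nat.div_le_self X d)) zero_le_two) hB0
  have T3 : ‖∑ d ∈ Ioc 0 X, ((truncLE u (moebius : ArithmeticFunction ℝ) * truncLE u vonMangoldt) d : ℂ) *
        ∑ m ∈ Ioc 0 (X / d), eC (θ * ((d * m : ℕ) : ℝ) ^ c)‖ ≤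
      (u * u : ℕ) * (Real.log P * (K₁ * P ^ (86 / 100 : ℝ))) := by
    refine norm_sum_Ioc_mul_le hlogP hB0 (fun d hd => truncLE_mul_truncLE_eq_zero _ _ hd)
      (fun d _ hd => (abs_truncLE_mul_truncLE_le u d).trans (hlog_le d hd))
      (fun d hd _ => hinner d hd _ le_rfl)
  have T4 : ‖∑ d ∈ Ioc 0 X, ∑ m ∈ Ioc 0 (X / d), ((vonMangoldt - truncLE u vonMangoldt) d : ℂ) *
        ((((moebius : ArithmeticFunction ℝ) - truncLE u (moebius : ArithmeticFunction ℝ)) *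
          (zeta : ArithmeticFunction ℝ)) m : ℂ) * eC (θ * ((d * m : ℕ) : ℝ) ^ c)‖ ≤
      K₂ * P ^ (9854 / 10000 : ℝ) := by
    have htail : ∀ d : ℕ, (vonMangoldt - truncLE u vonMangoldt) d = if d ≤ u then 0 else vonMangoldt d :=
      fun d => by
        rw [sub_eq_add_neg, ArithmeticFunction.add_apply, ArithmeticFunction.neg_apply, truncLE_apply]
        split_ifs <;> simp
    refine le_trans (le_of_eq ?_) (hbil P hP θ hθ1 hθ2 X hX u hu1
      (fun d => if d ≤ X then ((vonMangoldt - truncLE u vonMangoldt) d : ℂ) else 0)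
      (fun m => ((((moebius : ArithmeticFunction ℝ) - truncLE u (moebius : ArithmeticFunction ℝ)) *
          (zeta : ArithmeticFunction ℝ)) m : ℂ)) (fun n hn => ?_) (fun n hn => ?_) (fun n hn => ?_)
      (fun n hn => ?_))
    · congr 1
      refine sum_congr rfl fun d hd => sum_congr rfl fun m _ => ?_
      rw [mem_Ioc] at hd
      simp only [if_pos hd.2]
    · have hn' : n ≤ u := by exact_mod_cast hn
      simp [htail, hn']
    · rw [moebius_tail_mul_zeta_eq_zero (by exact_mod_cast hn), Complex.ofReal_zero]
    · have h1 := one_le_card_divisors hn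
      split_ifs with h
      · have hnn : ‖((vonMangoldt - truncLE u vonMangoldt) n : ℂ)‖ ≤ Real.log P := by
          rw [Complex.norm_real, Real.norm_eq_abs, htail]
          split_ifs
          · simpa using hlogP
          · rw [abs_of_nonneg vonMangoldt_nonneg]
            exact hΛ_le n h
        nlinarith
      · rw [norm_zero]
        positivity
    · rw [Complex.norm_real, Real.norm_eq_abs]
      have h1 := abs_moebius_tail_mul_zeta_le u n
      have h2 : (0 : ℝ) ≤ n.divisors.card := Nat.cast_nonneg _
      nlinarith
  have hlogP2 : Real.log P ≤ 101 * P ^ (1 / 100 : ℝ) := by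
    have := one_add_log_le_rpow (η := 1 / 100) (by norm_num) hP.le
    norm_num at this ⊢
    linarith
  have hexp : Y * Y * P ^ (1 / 100 : ℝ) * P ^ (86 / 100 : ℝ) ≤ P ^ (9854 / 10000 : ℝ) := by
    rw [hY, ← Real.rpow_add hP0, ← Real.rpow_add hP0, ← Real.rpow_add hP0]
    exact Real.rpow_le_rpow_of_exponent_le hP.le (by norm_num)
  have hQ1 : (1 : ℝ) ≤ P ^ (86 / 100 : ℝ) := Real.one_le_rpow hP.le (by norm_num)
  set Q : ℝ := P ^ (86 / 100 : ℝ) with hQ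
  set R : ℝ := P ^ (1 / 100 : ℝ) with hR
  have hR0 : 0 < R := Real.rpow_pos_of_pos hP0 _
  rw [sum_vonMangoldt_mul_eq u X (fun n => eC (θ * (n : ℝ) ^ c))]
  have hKQ : 1 ≤ K₁ * Q := one_le_mul_of_one_le_of_one_le hK₁ hQ1
  have hlogu : u * Real.log P ≤ 303 * (Y * R) := by
    calc u * Real.log P ≤ (3 * Y) * (101 * R) := by gcongr
      _ = _ := by ring
  have hYR : Y * R * (K₁ * Q) ≤ K₁ * P ^ (9854 / 10000 : ℝ) := by
    calc Y * R * (K₁ * Q) = K₁ * (1 * Y * R * Q) := by ring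
      _ ≤ K₁ * (Y * Y * R * Q) := by gcongr
      _ ≤ _ := by gcongr
  have E1 : u * (Real.log P * 1) ≤ 303 * (K₁ * P ^ (9854 / 10000 : ℝ)) := by
    calc u * (Real.log P * 1) ≤ 303 * (Y * R) * 1 := by linarith
      _ ≤ 303 * (Y * R) * (K₁ * Q) := by gcongr
      _ ≤ _ := by linarith
  have E2 : u * (1 * (2 * Real.log P * (K₁ * Q))) ≤ 606 * (K₁ * P ^ (9854 / 10000 : ℝ)) := by
    calc u * (1 * (2 * Real.log P * (K₁ * Q))) = 2 * (u * Real.log P) * (K₁ * Q) := by ring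
      _ ≤ 2 * (303 * (Y * R)) * (K₁ * Q) := by gcongr
      _ ≤ _ := by linarith
  have E3 : (u * u : ℕ) * (Real.log P * (K₁ * Q)) ≤ 909 * (K₁ * P ^ (9854 / 10000 : ℝ)) := by
    push_cast
    calc (u : ℝ) * u * (Real.log P * (K₁ * Q)) = u * (u * Real.log P) * (K₁ * Q) := by ring
      _ ≤ (3 * Y) * (303 * (Y * R)) * (K₁ * Q) := by gcongr
      _ = 909 * (K₁ * (Y * Y * R * Q)) := by ring
      _ ≤ _ := by gcongr
  refine (norm_add_le _ _).trans ?_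
  refine (add_le_add ((norm_sub_le _ _).trans (add_le_add (norm_add_le _ _) le_rfl)) le_rfl).trans ?_
  have hpos : 0 ≤ K₁ * P ^ (9854 / 10000 : ℝ) := by positivity
  linarith

lemma range_filter_prime_eq (X : ℕ) : (range (X + 1)).filter Nat.Prime = (Ioc 0 X).filter Nat.Prime := by
  ext p
  simp only [mem_filter, mem_range, mem_Ioc]
  exact ⟨fun h => ⟨⟨h.2.pos, by omega⟩, h.2⟩, fun h => ⟨by omega, h.2⟩⟩

open ArithmeticFunction in
lemma norm_sum_vonMangoldt_sub_sum_prime_le {P : ℝ} (hP : 1 ≤ P) {h : ℕ → ℂ} (hh : ∀ n, ‖h n‖ ≤ 1) :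
    ‖∑ n ∈ Ioc 0 ⌊P⌋₊, (vonMangoldt n : ℂ) * h n -
      ∑ p ∈ (Ioc 0 ⌊P⌋₊).filter Nat.Prime, (Real.log p : ℂ) * h p‖ ≤ 2 * √P * Real.log P := by
  have hΛ : ∀ n : ℕ, n.Prime → vonMangoldt n = Real.log n := fun n hn => vonMangoldt_apply_prime hn
  refine le_trans ?_ (Chebyshev.psi_sub_theta_le hP)
  rw [← sum_filter_add_sum_filter_not (Ioc 0 ⌊P⌋₊) Nat.Prime (fun n => (vonMangoldt n : ℂ) * h n),
    sum_congr rfl (fun n hn => by rw [hΛ n (mem_filter.1 hn).2] :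
      ∀ n ∈ (Ioc 0 ⌊P⌋₊).filter Nat.Prime, (vonMangoldt n : ℂ) * h n = (Real.log n : ℂ) * h n),
    add_sub_cancel_left]
  have : Chebyshev.psi P - Chebyshev.theta P =
      ∑ n ∈ (Ioc 0 ⌊P⌋₊).filter (fun n => ¬ n.Prime), vonMangoldt n := by
    rw [Chebyshev.psi, Chebyshev.theta,
      ← sum_filter_add_sum_filter_not (Ioc 0 ⌊P⌋₊) Nat.Prime (fun n => vonMangoldt n),
      sum_congr rfl (fun n hn => hΛ n (mem_filter.1 hn).2)]
    rw [add_sub_assoc]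
    simp
  rw [this]
  refine norm_sum_le_of_le _ fun n _ => ?_
  rw [norm_mul, Complex.norm_real, Real.norm_eq_abs, abs_of_nonneg vonMangoldt_nonneg]
  exact mul_le_of_le_one_right vonMangoldt_nonneg (hh n)

/-- Exponential sums over primes without integer parts. -/
lemma exists_norm_sum_prime_le {c : ℝ} (hc1 : 1 < c) (hc2 : c ≤ 20551 / 10000) (hc3 : c ≠ 2)
    (hc : ∀ j : ℕ, c ≠ j) :
    ∃ K : ℝ, 1 ≤ K ∧ ∀ P : ℝ, 1 < P → ∀ θ : ℝ, P ^ (1 - c - 1 / 1000) ≤ |θ| →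
      |θ| ≤ P ^ (148 / 10000 : ℝ) →
      ‖∑ p ∈ (range (⌊P⌋₊ + 1)).filter Nat.Prime, (Real.log p : ℂ) * eC (θ * (p : ℝ) ^ c)‖ ≤
        K * P ^ (9854 / 10000 : ℝ) := by
  obtain ⟨K, hK, h⟩ := exists_norm_sum_vonMangoldt_le hc1 hc2 hc3 hc
  refine ⟨K + 22, by linarith, fun P hP θ hθ1 hθ2 => ?_⟩
  have hP0 : 0 < P := by linarith
  have h1 := h P hP θ hθ1 hθ2 ⌊P⌋₊ (Nat.floor_le hP0.le)
  have h2 := norm_sum_vonMangoldt_sub_sum_prime_le hP.le (h := fun n => eC (θ * (n : ℝ) ^ c))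
    (fun n => (norm_eC _).le)
  have h3 : 2 * √P * Real.log P ≤ 22 * P ^ (9854 / 10000 : ℝ) := by
    have hl := one_add_log_le_rpow (η := 1 / 10) (by norm_num) hP.le
    norm_num at hl
    calc 2 * √P * Real.log P ≤ 2 * P ^ (1 / 2 : ℝ) * (11 * P ^ (1 / 10 : ℝ)) := by
          rw [Real.sqrt_eq_rpow]
          gcongr
          linarith
      _ = 22 * (P ^ (1 / 2 : ℝ) * P ^ (1 / 10 : ℝ)) := by ring
      _ ≤ _ := by
          rw [← Real.rpow_add hP0]
          gcongr
          · exact hP.le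
          · norm_num
  rw [range_filter_prime_eq]
  have := norm_sub_norm_le (∑ p ∈ (Ioc 0 ⌊P⌋₊).filter Nat.Prime, (Real.log p : ℂ) * eC (θ * (p : ℝ) ^ c))
    (∑ n ∈ Ioc 0 ⌊P⌋₊, (ArithmeticFunction.vonMangoldt n : ℂ) * eC (θ * (n : ℝ) ^ c))
  rw [norm_sub_rev] at this
  linarith

/-! ### The Dirichlet and Fejér kernels -/

/-- The geometric sum `∑_{l < q} e(l t)`. -/
noncomputable def geomKernel (q : ℕ) (t : ℝ) : ℂ := ∑ l ∈ range q, eC (l * t)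

lemma norm_geomKernel_le (q : ℕ) (t : ℝ) : ‖geomKernel q t‖ ≤ q := by
  simpa [geomKernel, norm_eC] using norm_sum_le (range q) (fun l => eC (l * t))

lemma geomKernel_mul_one_sub (q : ℕ) (t : ℝ) : geomKernel q t * (1 - eC t) = 1 - eC (q * t) := by
  induction q with
  | zero => simp [geomKernel, eC_zero]
  | succ q ih =>
    rw [geomKernel, sum_range_succ, ← geomKernel, add_mul, ih]
    push_cast
    rw [add_mul, one_mul, eC_add]
    ring

lemma norm_geomKernel_mul_sin_le (q : ℕ) (t : ℝ) : ‖geomKernel q t‖ * |Real.sin (π * t)| ≤ 1 := by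
  have h := congrArg norm (geomKernel_mul_one_sub q t)
  rw [norm_mul, norm_one_sub_eC] at h
  have h2 : ‖1 - eC (q * t)‖ ≤ 2 := (norm_sub_le _ _).trans (by rw [norm_one, norm_eC]; norm_num)
  linarith

/-- The kernel at `z / q` decays in the distance from `z` to the multiples of `q`. -/
lemma norm_geomKernel_div_mul_le {q : ℕ} (hq : 1 ≤ q) {z : ℝ} (hz : |z| ≤ q) :
    ‖geomKernel q (z / q)‖ * (1 + min |z| (q - |z|)) ≤ 3 / 2 * q := by
  have hq0 : (0 : ℝ) < q := by exact_mod_cast hq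
  set m := min |z| (q - |z|) with hm
  have hm1 : m ≤ |z| := min_le_left _ _
  have hm2 : m ≤ q - |z| := min_le_right _ _
  have hm0 : 0 ≤ m := le_min (abs_nonneg _) (by linarith)
  have hsin : 2 * (m / q) ≤ |Real.sin (π * (z / q))| := by
    have h1 := two_mul_le_sin_pi_mul (ρ := m / q) (d := |z| / q) (by positivity)
      (by gcongr) (by rw [le_sub_iff_add_le, ← add_div, div_le_one hq0]; linarith)
    refine h1.trans ?_
    rcases abs_cases z with ⟨h, _⟩ | ⟨h, _⟩
    · rw [h]
      exact le_abs_self _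
    · rw [h, neg_div, mul_neg, Real.sin_neg]
      exact neg_le_abs _
  have h2 := norm_geomKernel_mul_sin_le q (z / q)
  have h3 : ‖geomKernel q (z / q)‖ * (2 * (m / q)) ≤ 1 :=
    (mul_le_mul_of_nonneg_left hsin (norm_nonneg _)).trans h2
  have h4 : ‖geomKernel q (z / q)‖ * m ≤ q / 2 := by
    have : ‖geomKernel q (z / q)‖ * (2 * (m / q)) * (q / 2) = ‖geomKernel q (z / q)‖ * m := by
      field_simp
    nlinarith
  have h5 := norm_geomKernel_le q (z / q)
  linarith

lemma ofReal_norm_geomKernel_sq (q : ℕ) (t : ℝ) :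
    ((‖geomKernel q t‖ ^ 2 : ℝ) : ℂ) = ∑ l ∈ range q, ∑ l' ∈ range q, eC (((l : ℝ) - l') * t) := by
  rw [Complex.ofReal_pow, ← Complex.mul_conj', geomKernel, map_sum, sum_mul_sum]
  exact sum_congr rfl fun l _ => sum_congr rfl fun l' _ => by rw [sub_mul, eC_sub]

lemma geomKernel_fract (q : ℕ) (x : ℝ) : geomKernel q (Int.fract x) = geomKernel q x := by
  refine sum_congr rfl fun l _ => ?_
  have : (l : ℝ) * x = l * Int.fract x + ((l * ⌊x⌋ : ℤ) : ℝ) := by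
    push_cast
    rw [← mul_add, Int.fract_add_floor]
  rw [this, eC_add, eC_intCast, mul_one]

lemma geomKernel_int_div_eq_zero {q : ℕ} {h : ℤ} (h0 : h ≠ 0) (hh : |h| < q) :
    geomKernel q ((h : ℝ) / q) = 0 := by
  have hq0 : (0 : ℝ) < q := by
    have : (0 : ℤ) < q := (abs_nonneg h).trans_lt hh
    exact_mod_cast this
  have hq : 1 ≤ q := by exact_mod_cast hq0
  have h1 := geomKernel_mul_one_sub q ((h : ℝ) / q)
  rw [mul_div_cancel₀ _ hq0.ne', eC_intCast, sub_self, mul_eq_zero] at h1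
  refine h1.resolve_right fun h2 => ?_
  have h3 := norm_one_sub_eC ((h : ℝ) / q)
  rw [h2, norm_zero] at h3
  have hr1 : (1 : ℝ) ≤ |(h : ℝ)| := by exact_mod_cast Int.one_le_abs h0
  have hr2 : |(h : ℝ)| + 1 ≤ q := by exact_mod_cast hh
  have hsin := two_mul_le_sin_pi_mul (ρ := 1 / q) (d := |(h : ℝ)| / q) (by positivity)
      (by gcongr) (by rw [le_sub_iff_add_le, ← add_div, div_le_one hq0]; linarith)
  have habs : |Real.sin (π * (|(h : ℝ)| / q))| = |Real.sin (π * ((h : ℝ) / q))| := by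
    rcases abs_cases (h : ℝ) with ⟨h', _⟩ | ⟨h', _⟩
    · rw [h']
    · rw [h', neg_div, mul_neg, Real.sin_neg, abs_neg]
  have hpos : (0 : ℝ) < 2 * (1 / q) := by positivity
  have := le_abs_self (Real.sin (π * (|(h : ℝ)| / q)))
  linarith

lemma sum_norm_geomKernel_sub_sq {q : ℕ} (hq : 1 ≤ q) (t : ℝ) :
    ∑ j ∈ range q, ‖geomKernel q (t - j / q)‖ ^ 2 = (q : ℝ) ^ 2 := by
  have hq0 : (q : ℝ) ≠ 0 := by positivity
  have horth : ∀ l ∈ range q, ∀ l' ∈ range q,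
      ∑ j ∈ range q, eC (((l : ℝ) - l') * (t - j / q)) = if l = l' then (q : ℂ) else 0 := by
    intro l hl l' hl'
    rw [mem_range] at hl hl'
    have : ∀ j ∈ range q, eC (((l : ℝ) - l') * (t - j / q)) =
        eC (((l : ℝ) - l') * t) * eC (j * ((((l' : ℤ) - l : ℤ) : ℝ) / q)) := fun j _ => by
      rw [← eC_add]
      congr 1
      push_cast
      ring
    rw [sum_congr rfl this, ← mul_sum, ← geomKernel]
    split_ifs with h
    · subst h
      simp [geomKernel, eC_zero]
    · rw [geomKernel_int_div_eq_zero (by omega) (by rw [abs_lt]; omega), mul_zero]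
  have : ((∑ j ∈ range q, ‖geomKernel q (t - j / q)‖ ^ 2 : ℝ) : ℂ) = ((q : ℝ) ^ 2 : ℝ) := by
    rw [Complex.ofReal_sum, sum_congr rfl fun (j : ℕ) _ => ofReal_norm_geomKernel_sq q (t - j / q), sum_comm,
      sum_congr rfl fun l _ => sum_comm,
      sum_congr rfl fun l hl => sum_congr rfl fun l' hl' => horth l hl l' hl',
      sum_congr rfl fun l hl => (sum_ite_eq (range q) l fun _ => (q : ℂ)).trans (if_pos hl)]
    simp [sq]
  exact_mod_cast this

/-! ### Harmonic sums -/

lemma sum_range_inv_le (q : ℕ) : ∑ m ∈ range q, (1 + (m : ℝ))⁻¹ ≤ 1 + Real.log q := by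
  refine le_trans (le_of_eq ?_) (sum_Ioc_inv_le q)
  induction q with
  | zero => simp
  | succ q ih =>
    rw [sum_range_succ, ih, sum_Ioc_succ_top (Nat.zero_le q)]
    push_cast
    rw [add_comm (1 : ℝ)]

lemma sum_range_reflect_inv_le (q : ℕ) : ∑ m ∈ range q, ((q : ℝ) - m)⁻¹ ≤ 1 + Real.log q := by
  refine le_trans (le_of_eq ?_) (sum_range_inv_le q)
  rw [← sum_range_reflect]
  refine sum_congr rfl fun m hm => ?_
  rw [mem_range] at hm
  congr 1
  rw [Nat.sub_sub, Nat.cast_sub (by omega)]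
  push_cast
  ring

lemma sum_range_inv_abs_sub_le {q k : ℕ} (hk : k ≤ q) :
    ∑ j ∈ range q, (1 + |(j : ℝ) - k|)⁻¹ ≤ 2 * (1 + Real.log q) := by
  have hlog : Real.log k ≤ Real.log q := by
    rcases Nat.eq_zero_or_pos k with rfl | h
    · simpa using Real.log_natCast_nonneg q
    · exact Real.log_le_log (by exact_mod_cast h) (by exact_mod_cast hk)
  rw [← sum_range_add_sum_Ico _ hk, two_mul]
  refine add_le_add ?_ ?_
  · refine le_trans (sum_le_sum fun j hj => ?_) ((sum_range_reflect_inv_le k).trans (by linarith))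
    have : (j : ℝ) + 1 ≤ k := by exact_mod_cast mem_range.1 hj
    rw [abs_of_nonpos (by linarith)]
    exact inv_anti₀ (by linarith) (by linarith)
  · rw [sum_Ico_eq_sum_range]
    calc _ = ∑ m ∈ range (q - k), (1 + (m : ℝ))⁻¹ := by
          refine sum_congr rfl fun m _ => ?_
          push_cast
          rw [add_sub_cancel_left, abs_of_nonneg (Nat.cast_nonneg _)]
      _ ≤ ∑ m ∈ range q, (1 + (m : ℝ))⁻¹ :=
          sum_le_sum_of_subset_of_nonneg (range_subset_range.2 (Nat.sub_le q k)) fun _ _ _ => by positivity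
      _ ≤ _ := sum_range_inv_le q

lemma sum_sum_norm_geomKernel_le {q : ℕ} (hq : 1 ≤ q) {α : ℝ} (h0 : 0 ≤ α) (h1 : α ≤ 1) :
    ∑ l ∈ range q, ∑ l' ∈ range q, ‖geomKernel q (-(α + ((l : ℝ) - l')) / q)‖ ≤
      9 * (q : ℝ) ^ 2 * (1 + Real.log q) := by
  rw [sum_comm]
  have hterm : ∀ l' ∈ range q, ∑ l ∈ range q, ‖geomKernel q (-(α + ((l : ℝ) - l')) / q)‖ ≤
      9 * q * (1 + Real.log q) := by
    intro l' hl'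
    have hl'q : (l' : ℝ) + 1 ≤ q := by exact_mod_cast mem_range.1 hl'
    have hl'0 : (0 : ℝ) ≤ l' := Nat.cast_nonneg _
    calc _ ≤ ∑ l ∈ range q, 3 / 2 * (q : ℝ) *
          (2 * (1 + |(l : ℝ) - l'|)⁻¹ + ((1 + (l : ℝ))⁻¹ + ((q : ℝ) - l)⁻¹)) := by
          refine sum_le_sum fun l hl => ?_
          have hlq : (l : ℝ) + 1 ≤ q := by exact_mod_cast mem_range.1 hl
          have hl0 : (0 : ℝ) ≤ l := Nat.cast_nonneg _
          set z : ℝ := -(α + ((l : ℝ) - l')) with hz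
          have hzq : |z| ≤ q := abs_le.2 ⟨by linarith, by linarith⟩
          have hker := norm_geomKernel_div_mul_le hq hzq
          have hm0 : 0 ≤ min |z| (q - |z|) := le_min (abs_nonneg _) (by linarith)
          refine ((le_div_iff₀ (by linarith)).2 hker).trans ?_
          rw [div_eq_mul_inv]
          gcongr
          have hA : (1 + |z|)⁻¹ ≤ 2 * (1 + |(l : ℝ) - l'|)⁻¹ := by
            have : |(l : ℝ) - l'| ≤ |z| + 1 := by
              rcases abs_cases z with h | h <;> rcases abs_cases ((l : ℝ) - l') with h' | h' <;> linarith
            rw [← inv_inv (2 : ℝ), ← mul_inv]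
            exact inv_anti₀ (by positivity) (by linarith [abs_nonneg z])
          have hB : (1 + (q - |z|))⁻¹ ≤ (1 + (l : ℝ))⁻¹ + ((q : ℝ) - l)⁻¹ := by
            have p1 : 0 < (1 + (l : ℝ))⁻¹ := by positivity
            have p2 : 0 < ((q : ℝ) - l)⁻¹ := inv_pos.2 (by linarith)
            rcases le_or_gt l' l with h | h
            · have h' : (l' : ℝ) ≤ l := by exact_mod_cast h
              have : |z| ≤ 1 + l := abs_le.2 ⟨by linarith, by linarith⟩
              have := inv_anti₀ (by linarith : 0 < (q : ℝ) - l) (by linarith : (q : ℝ) - l ≤ 1 + (q - |z|))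
              linarith
            · have h' : (l : ℝ) + 1 ≤ l' := by exact_mod_cast h
              have : |z| ≤ q - l := abs_le.2 ⟨by linarith, by linarith⟩
              have := inv_anti₀ (by linarith : 0 < 1 + (l : ℝ)) (by linarith : 1 + (l : ℝ) ≤ 1 + (q - |z|))
              linarith
          rcases min_choice |z| (q - |z|) with h | h <;> rw [h]
          · have p1 : 0 < (1 + (l : ℝ))⁻¹ := by positivity
            have p2 : 0 < ((q : ℝ) - l)⁻¹ := inv_pos.2 (by linarith)
            linarith
          · have p1 : 0 ≤ (1 + |(l : ℝ) - l'|)⁻¹ := by positivity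
            linarith
      _ = 3 / 2 * q * (2 * ∑ l ∈ range q, (1 + |(l : ℝ) - l'|)⁻¹ +
          (∑ l ∈ range q, (1 + (l : ℝ))⁻¹ + ∑ l ∈ range q, ((q : ℝ) - l)⁻¹)) := by
          rw [← mul_sum, sum_add_distrib, sum_add_distrib, mul_sum]
      _ ≤ 3 / 2 * q * (2 * (2 * (1 + Real.log q)) + ((1 + Real.log q) + (1 + Real.log q))) := by
          gcongr
          · exact sum_range_inv_abs_sub_le (mem_range.1 hl').le
          · exact sum_range_inv_le q
          · exact sum_range_reflect_inv_le q
      _ = _ := by ring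
  refine (sum_le_sum hterm).trans (le_of_eq ?_)
  rw [sum_const, card_range, nsmul_eq_mul]
  ring

/-- The Fejér interpolation of `t ↦ e(-α t)` on `[0, 1)` at the points `j / q`. -/
noncomputable def fejerInterp (q : ℕ) (α t : ℝ) : ℂ :=
  ∑ j ∈ range q, ((‖geomKernel q (t - j / q)‖ ^ 2 / (q : ℝ) ^ 2 : ℝ) : ℂ) * eC (-(α * (j / q)))

lemma fejerInterp_eq (q : ℕ) (α t : ℝ) :
    fejerInterp q α t = ((q : ℂ) ^ 2)⁻¹ * ∑ l ∈ range q, ∑ l' ∈ range q,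
      geomKernel q (-(α + ((l : ℝ) - l')) / q) * eC (((l : ℝ) - l') * t) := by
  have h : ∀ j ∈ range q, ((‖geomKernel q (t - j / q)‖ ^ 2 / (q : ℝ) ^ 2 : ℝ) : ℂ) * eC (-(α * (j / q))) =
      ((q : ℂ) ^ 2)⁻¹ * ∑ l ∈ range q, ∑ l' ∈ range q,
        eC (j * (-(α + ((l : ℝ) - l')) / q)) * eC (((l : ℝ) - l') * t) := by
    intro j _
    rw [Complex.ofReal_div, ofReal_norm_geomKernel_sq, Complex.ofReal_pow, Complex.ofReal_natCast,
      div_eq_inv_mul, mul_assoc, sum_mul]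
    congr 1
    refine sum_congr rfl fun l _ => ?_
    rw [sum_mul]
    refine sum_congr rfl fun l' _ => ?_
    rw [← eC_add, ← eC_add]
    congr 1
    ring
  rw [fejerInterp, sum_congr rfl h, ← mul_sum, sum_comm]
  congr 1
  refine sum_congr rfl fun l _ => ?_
  rw [sum_comm]
  refine sum_congr rfl fun l' _ => ?_
  rw [geomKernel, sum_mul]

lemma eC_natCast_sub_mul_fract (l l' : ℕ) (x : ℝ) :
    eC (((l : ℝ) - l') * Int.fract x) = eC (((l : ℝ) - l') * x) := by
  have : ((l : ℝ) - l') * x = ((l : ℝ) - l') * Int.fract x + ((((l : ℤ) - l') * ⌊x⌋ : ℤ) : ℝ) := by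
    push_cast
    rw [← mul_add, Int.fract_add_floor]
  rw [this, eC_add, eC_intCast, mul_one]

lemma norm_sum_mul_fejerInterp_le {q : ℕ} (hq : 1 ≤ q) {α M : ℝ} (h0 : 0 ≤ α) (h1 : α ≤ 1)
    (s : Finset ℕ) (w : ℕ → ℂ) (x : ℕ → ℝ)
    (hM : ∀ h : ℤ, |h| < q → ‖∑ n ∈ s, w n * eC ((α + h) * x n)‖ ≤ M) :
    ‖∑ n ∈ s, w n * eC (α * x n) * fejerInterp q α (Int.fract (x n))‖ ≤ 9 * (1 + Real.log q) * M := by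
  have hq0 : (0 : ℝ) < q := by exact_mod_cast hq
  have hM0 : 0 ≤ M := (norm_nonneg _).trans (hM 0 (by rw [abs_zero]; exact_mod_cast hq))
  have heq : ∑ n ∈ s, w n * eC (α * x n) * fejerInterp q α (Int.fract (x n)) =
      ((q : ℂ) ^ 2)⁻¹ * ∑ l ∈ range q, ∑ l' ∈ range q, geomKernel q (-(α + ((l : ℝ) - l')) / q) *
        ∑ n ∈ s, w n * eC ((α + (((l : ℤ) - l' : ℤ) : ℝ)) * x n) := by
    simp_rw [fejerInterp_eq, mul_sum]
    rw [sum_comm]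
    refine sum_congr rfl fun l _ => ?_
    rw [sum_comm]
    refine sum_congr rfl fun l' _ => sum_congr rfl fun n _ => ?_
    rw [eC_natCast_sub_mul_fract, add_mul, eC_add]
    push_cast
    ring
  rw [heq, norm_mul, norm_inv, norm_pow, Complex.norm_natCast]
  calc _ ≤ ((q : ℝ) ^ 2)⁻¹ * ∑ l ∈ range q, ∑ l' ∈ range q,
        ‖geomKernel q (-(α + ((l : ℝ) - l')) / q)‖ * M := by
        gcongr
        refine norm_sum_le_of_le _ fun l hl => norm_sum_le_of_le _ fun l' hl' => ?_
        rw [norm_mul]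
        rw [mem_range] at hl hl'
        gcongr
        exact hM _ (by rw [abs_lt]; omega)
    _ ≤ ((q : ℝ) ^ 2)⁻¹ * (9 * (q : ℝ) ^ 2 * (1 + Real.log q) * M) := by
        simp_rw [← sum_mul]
        gcongr
        exact sum_sum_norm_geomKernel_le hq h0 h1
    _ = _ := by field_simp

/-- The average of normalised Fejér kernels, detecting proximity to the integers. -/
noncomputable def fejerMean (q : ℕ) (t : ℝ) : ℝ :=
  (q : ℝ)⁻¹ * ∑ H ∈ Ioc 0 q, ‖geomKernel H t‖ ^ 2 / (H : ℝ) ^ 2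

lemma fejerMean_fract (q : ℕ) (x : ℝ) : fejerMean q (Int.fract x) = fejerMean q x := by
  simp_rw [fejerMean, geomKernel_fract]

lemma half_le_norm_geomKernel {H : ℕ} {t v : ℝ} (hv : 0 ≤ v) (ht : t = v ∨ t = 1 - v)
    (hH : (H : ℝ) * v ≤ 1 / 6) : (H : ℝ) / 2 ≤ ‖geomKernel H t‖ := by
  refine le_trans ?_ (Complex.re_le_norm _)
  rw [geomKernel, Complex.re_sum]
  calc (H : ℝ) / 2 = ∑ _l ∈ range H, (1 / 2 : ℝ) := by
        rw [sum_const, card_range, nsmul_eq_mul]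
        ring
    _ ≤ _ := by
        refine sum_le_sum fun l hl => ?_
        have hl' : (l : ℝ) ≤ H := by exact_mod_cast (mem_range.1 hl).le
        have hlv : (l : ℝ) * v ≤ 1 / 6 := (mul_le_mul_of_nonneg_right hl' hv).trans hH
        have hlv0 : 0 ≤ (l : ℝ) * v := by positivity
        have hre : (eC (l * t)).re = Real.cos (2 * π * (l * v)) := by
          rcases ht with rfl | rfl
          · rw [eC, Complex.exp_ofReal_mul_I_re]
          · rw [mul_sub, mul_one, eC_sub, ← Int.cast_natCast, eC_intCast, one_mul, Complex.conj_re, eC,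
              Complex.exp_ofReal_mul_I_re]
        rw [hre, ← Real.cos_pi_div_three]
        exact Real.cos_le_cos_of_nonneg_of_le_pi (by positivity) (by linarith [pi_pos])
          (by nlinarith [pi_pos])

lemma card_div_le_fejerMean {q H₀ : ℕ} (hH : H₀ ≤ q) {t v : ℝ} (hv : 0 ≤ v) (ht : t = v ∨ t = 1 - v)
    (hHv : (H₀ : ℝ) * v ≤ 1 / 6) : (H₀ : ℝ) / (4 * q) ≤ fejerMean q t := by
  rw [fejerMean]
  calc (H₀ : ℝ) / (4 * q) = (q : ℝ)⁻¹ * ∑ _H ∈ Ioc 0 H₀, (1 / 4 : ℝ) := by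
        rw [sum_const, Nat.card_Ioc, nsmul_eq_mul, Nat.sub_zero]
        ring
    _ ≤ (q : ℝ)⁻¹ * ∑ H ∈ Ioc 0 H₀, ‖geomKernel H t‖ ^ 2 / (H : ℝ) ^ 2 := by
        refine mul_le_mul_of_nonneg_left (sum_le_sum fun H hH => ?_) (by positivity)
        rw [mem_Ioc] at hH
        have h0 : (0 : ℝ) < H := by exact_mod_cast hH.1
        have h1 := half_le_norm_geomKernel hv ht
          ((mul_le_mul_of_nonneg_right (by exact_mod_cast hH.2 : (H : ℝ) ≤ H₀) hv).trans hHv)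
        rw [le_div_iff₀ (by positivity)]
        nlinarith
    _ ≤ _ := by
        gcongr

lemma le_fejerMean {q : ℕ} (hq : 1 ≤ q) {t v W : ℝ} (hv : 0 ≤ v) (ht : t = v ∨ t = 1 - v)
    (hW1 : W ≤ 1) (hW : W * (q * v) ≤ 9 / 4) : W ≤ 54 * fejerMean q t + 14 / q := by
  have hq0 : (0 : ℝ) < q := by exact_mod_cast hq
  rcases le_or_gt ((q : ℝ) * v) (1 / 6) with h | h
  · have := card_div_le_fejerMean le_rfl hv ht h
    rw [div_mul_cancel_right₀ hq0.ne'] at this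
    have hpos : (0 : ℝ) < 14 / q := by positivity
    linarith
  · have hv0 : 0 < v := by
      by_contra hcon
      nlinarith
    set H₀ : ℕ := ⌊1 / (6 * v)⌋₊ with hH₀
    have hfl : (H₀ : ℝ) ≤ 1 / (6 * v) := Nat.floor_le (by positivity)
    have hlt : 1 / (6 * v) < H₀ + 1 := Nat.lt_floor_add_one _
    rw [le_div_iff₀ (by positivity)] at hfl
    rw [div_lt_iff₀ (by positivity)] at hlt
    have hHq : H₀ ≤ q := by
      have : (H₀ : ℝ) < q := by
        by_contra hcon
        nlinarith
      exact_mod_cast this.le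
    have h1 := card_div_le_fejerMean hHq hv ht (by linarith)
    rw [div_le_iff₀ (by positivity)] at h1
    have h2 : W * q ≤ 27 / 2 * (H₀ + 1) := by
      by_contra! hcon
      have : 27 / 2 * ((H₀ : ℝ) + 1) * v < W * q * v := mul_lt_mul_of_pos_right hcon hv0
      nlinarith
    have h3 : W * q ≤ (54 * fejerMean q t + 14 / q) * q := by
      rw [add_mul, div_mul_cancel₀ _ hq0.ne']
      linarith
    exact le_of_mul_le_mul_right h3 hq0

/-- The mean value of `fejerMean` over a sequence. -/
lemma sum_fejerMean_le {q N : ℕ} (hq : 1 ≤ q) (x : ℕ → ℝ) {M : ℝ}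
    (hM : ∀ h : ℤ, h ≠ 0 → |h| < q → ‖∑ n ∈ Ioc 0 N, eC (h * x n)‖ ≤ M) (hM0 : 0 ≤ M) :
    ∑ n ∈ Ioc 0 N, fejerMean q (x n) ≤ N * (1 + Real.log q) / q + M := by
  have hq0 : (0 : ℝ) < q := by exact_mod_cast hq
  have hH : ∀ H ∈ Ioc 0 q, ∑ n ∈ Ioc 0 N, ‖geomKernel H (x n)‖ ^ 2 / (H : ℝ) ^ 2 ≤
      N * (H : ℝ)⁻¹ + M := by
    intro H hH
    rw [mem_Ioc] at hH
    have hH0 : (0 : ℝ) < H := by exact_mod_cast hH.1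
    have key : ∑ n ∈ Ioc 0 N, ‖geomKernel H (x n)‖ ^ 2 ≤ H * N + (H : ℝ) ^ 2 * M := by
      have heq : ((∑ n ∈ Ioc 0 N, ‖geomKernel H (x n)‖ ^ 2 : ℝ) : ℂ) =
          ∑ l ∈ range H, ∑ l' ∈ range H, ∑ n ∈ Ioc 0 N, eC ((((l : ℤ) - l' : ℤ) : ℝ) * x n) := by
        rw [Complex.ofReal_sum, sum_congr rfl fun n _ => ofReal_norm_geomKernel_sq H (x n), sum_comm]
        refine sum_congr rfl fun l _ => ?_
        rw [sum_comm]
        push_cast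
        rfl
      have hnn : 0 ≤ ∑ n ∈ Ioc 0 N, ‖geomKernel H (x n)‖ ^ 2 := by positivity
      rw [← abs_of_nonneg hnn, ← Real.norm_eq_abs, ← Complex.norm_real, heq]
      calc _ ≤ ∑ l ∈ range H, ∑ l' ∈ range H, ((if l = l' then (N : ℝ) else 0) + M) := by
            refine norm_sum_le_of_le _ fun l hl => norm_sum_le_of_le _ fun l' hl' => ?_
            rw [mem_range] at hl hl'
            split_ifs with h
            · refine (norm_sum_eC_le_card _ _).trans ?_
              simpa using hM0
            · rw [zero_add]
              exact hM _ (by omega) (by rw [abs_lt]; omega)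
        _ = _ := by
            simp_rw [sum_add_distrib]
            rw [sum_congr rfl fun l hl => (sum_ite_eq (range H) l fun _ => (N : ℝ)).trans (if_pos hl)]
            simp [sq, mul_assoc]
    rw [← sum_div, div_le_iff₀ (by positivity)]
    refine key.trans (le_of_eq ?_)
    field_simp
  simp_rw [fejerMean]
  rw [← mul_sum, sum_comm]
  calc _ ≤ (q : ℝ)⁻¹ * ∑ H ∈ Ioc 0 q, (N * (H : ℝ)⁻¹ + M) := by
        gcongr with H hH'
        exact hH H hH'
    _ = (q : ℝ)⁻¹ * (N * ∑ H ∈ Ioc 0 q, (H : ℝ)⁻¹ + q * M) := by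
        rw [sum_add_distrib, ← mul_sum, sum_const, Nat.card_Ioc, nsmul_eq_mul, Nat.sub_zero]
    _ ≤ (q : ℝ)⁻¹ * (N * (1 + Real.log q) + q * M) := by
        gcongr
        exact sum_Ioc_inv_le q
    _ = _ := by field_simp

lemma fejerWeight_le {q : ℕ} (hq : 1 ≤ q) {t : ℝ} {j : ℕ} (h : |t * q - j| ≤ q) :
    ‖geomKernel q (t - j / q)‖ ^ 2 / (q : ℝ) ^ 2 ≤
      9 / 4 * ((1 + min |t * q - j| (q - |t * q - j|)) ^ 2)⁻¹ := by
  have hq0 : (0 : ℝ) < q := by exact_mod_cast hq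
  have hker := norm_geomKernel_div_mul_le hq h
  have hm0 : 0 ≤ min |t * q - j| (q - |t * q - j|) := le_min (abs_nonneg _) (by linarith)
  rw [show t - j / q = (t * q - j) / q by field_simp, ← div_eq_mul_inv, div_le_div_iff₀ (by positivity) (by positivity),
    ← mul_pow]
  calc _ ≤ (3 / 2 * (q : ℝ)) ^ 2 := by gcongr
    _ = _ := by ring

lemma sum_range_inv_sq_le {a : ℝ} (ha : 0 < a) (q : ℕ) :
    ∑ j ∈ range q, ((1 + (a + j)) ^ 2)⁻¹ ≤ a⁻¹ := by
  have h : ∀ q : ℕ, ∑ j ∈ range q, ((1 + (a + j)) ^ 2)⁻¹ ≤ a⁻¹ - (a + q)⁻¹ := by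
    intro q
    induction q with
    | zero => simp
    | succ q ih =>
      rw [sum_range_succ]
      have hq : (0 : ℝ) ≤ q := Nat.cast_nonneg q
      have : ((1 + (a + q)) ^ 2)⁻¹ ≤ (a + q)⁻¹ - (a + (q + 1))⁻¹ := by
        rw [inv_sub_inv (by positivity) (by positivity), inv_eq_one_div,
          div_le_div_iff₀ (by positivity) (by positivity)]
        nlinarith
      push_cast
      linarith
  have := inv_pos.2 (by positivity : 0 < a + q)
  linarith [h q]

lemma sum_far_fejerWeight_mul_le {q : ℕ} (hq : 1 ≤ q) {t : ℝ} (ht0 : 0 ≤ t) (ht1 : t < 1) :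
    (∑ j ∈ (range q).filter (fun j : ℕ => (q : ℝ) / 2 < |t * q - j|),
      ‖geomKernel q (t - j / q)‖ ^ 2 / (q : ℝ) ^ 2) * (q * min t (1 - t)) ≤ 9 / 4 := by
  have hq0 : (0 : ℝ) < q := by exact_mod_cast hq
  set a : ℝ := q * min t (1 - t) with ha
  rcases (show 0 ≤ a from mul_nonneg hq0.le (le_min ht0 (by linarith))).eq_or_lt with h0 | h0
  · rw [← h0, mul_zero]
    norm_num
  have hW : ∀ j ∈ (range q).filter (fun j : ℕ => (q : ℝ) / 2 < |t * q - j|),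
      ‖geomKernel q (t - j / q)‖ ^ 2 / (q : ℝ) ^ 2 ≤ 9 / 4 * ((1 + (q - |t * q - j|)) ^ 2)⁻¹ := by
    intro j hj
    rw [mem_filter, mem_range] at hj
    have hj1 : (j : ℝ) + 1 ≤ q := by exact_mod_cast hj.1
    have hj0 : (0 : ℝ) ≤ j := Nat.cast_nonneg j
    have hle : |t * q - j| ≤ q := abs_le.2 ⟨by nlinarith, by nlinarith⟩
    have h := fejerWeight_le hq hle
    rwa [min_eq_right (by linarith [hj.2])] at h
  have hsum : ∑ j ∈ (range q).filter (fun j : ℕ => (q : ℝ) / 2 < |t * q - j|),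
      ((1 + (q - |t * q - j|)) ^ 2)⁻¹ ≤ a⁻¹ := by
    rcases le_or_gt t (1 / 2) with ht | ht
    · rw [min_eq_left (by linarith)] at ha
      calc _ ≤ ∑ j ∈ range q, ((1 + (a + (q - 1 - j : ℕ))) ^ 2)⁻¹ := by
            refine (sum_le_sum fun j hj => ?_).trans
              (sum_le_sum_of_subset_of_nonneg (filter_subset _ _) fun _ _ _ => by positivity)
            rw [mem_filter, mem_range] at hj
            have hj1 : (j : ℝ) + 1 ≤ q := by exact_mod_cast hj.1
            have hj0 : (0 : ℝ) ≤ j := Nat.cast_nonneg j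
            have hneg : |t * q - j| = j - t * q := by
              rcases abs_cases (t * q - j) with h | h
              · have := hj.2
                rw [h.1] at this
                nlinarith
              · linarith [h.1]
            rw [hneg, Nat.sub_sub, Nat.cast_sub (by omega)]
            push_cast
            refine inv_anti₀ (by nlinarith) (pow_le_pow_left₀ (by nlinarith) (by linarith) 2)
        _ = ∑ j ∈ range q, ((1 + (a + j)) ^ 2)⁻¹ :=
            sum_range_reflect (fun j : ℕ => ((1 + (a + j)) ^ 2)⁻¹) q
        _ ≤ _ := sum_range_inv_sq_le h0 q
    · rw [min_eq_right (by linarith)] at ha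
      refine le_trans ?_ (sum_range_inv_sq_le h0 q)
      refine (sum_le_sum fun j hj => ?_).trans
        (sum_le_sum_of_subset_of_nonneg (filter_subset _ _) fun _ _ _ => by positivity)
      rw [mem_filter, mem_range] at hj
      have hj1 : (j : ℝ) + 1 ≤ q := by exact_mod_cast hj.1
      have hpos : |t * q - j| = t * q - j := by
        rcases abs_cases (t * q - j) with h | h
        · exact h.1
        · have := hj.2
          rw [h.1] at this
          nlinarith
      rw [hpos]
      refine (congrArg (fun y : ℝ => (y ^ 2)⁻¹) ?_).le
      rw [ha]
      ring
  calc _ ≤ (9 / 4 * a⁻¹) * a := by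
        gcongr
        refine (sum_le_sum hW).trans ?_
        rw [← mul_sum]
        gcongr
    _ = _ := by field_simp

lemma norm_eC_sub_fejerInterp_le {q : ℕ} (hq : 1 ≤ q) {α : ℝ} (h0 : 0 ≤ α) (h1 : α ≤ 1) {t : ℝ}
    (ht0 : 0 ≤ t) (ht1 : t < 1) :
    ‖eC (-(α * t)) - fejerInterp q α t‖ ≤ 85 * ((1 + Real.log q) / q) + 108 * fejerMean q t := by
  have hq0 : (0 : ℝ) < q := by exact_mod_cast hq
  set F : ℕ → ℝ := fun j => ‖geomKernel q (t - j / q)‖ ^ 2 / (q : ℝ) ^ 2 with hF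
  have hF0 : ∀ j, 0 ≤ F j := fun j => by positivity
  have hF1 : ∑ j ∈ range q, F j = 1 := by
    rw [hF, ← sum_div, sum_norm_geomKernel_sub_sq hq, div_self (by positivity)]
  have heq : eC (-(α * t)) - fejerInterp q α t =
      ∑ j ∈ range q, (F j : ℂ) * (eC (-(α * t)) - eC (-(α * (j / q)))) := by
    simp_rw [mul_sub]
    rw [sum_sub_distrib, ← sum_mul, ← Complex.ofReal_sum, hF1, Complex.ofReal_one, one_mul, fejerInterp]
  set W : ℝ := ∑ j ∈ (range q).filter (fun j : ℕ => (q : ℝ) / 2 < |t * q - j|), F j with hW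
  have hW1 : W ≤ 1 := by
    rw [← hF1]
    exact sum_le_sum_of_subset_of_nonneg (filter_subset _ _) fun j _ _ => hF0 j
  have hWG : W ≤ 54 * fejerMean q t + 14 / q :=
    le_fejerMean hq (le_min ht0 (by linarith : 0 ≤ 1 - t))
      (by rcases min_choice t (1 - t) with h | h <;> rw [h] <;> simp) hW1
      (sum_far_fejerWeight_mul_le hq ht0 ht1)
  set k : ℕ := ⌊t * q⌋₊ with hk
  have htq0 : 0 ≤ t * q := by positivity
  have hk1 : (k : ℝ) ≤ t * q := Nat.floor_le htq0
  have hk2 : t * q < k + 1 := Nat.lt_floor_add_one _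
  have hkq : k ≤ q := by
    have : (k : ℝ) ≤ q := by nlinarith
    exact_mod_cast this
  have hterm : ∀ j ∈ range q, ‖(F j : ℂ) * (eC (-(α * t)) - eC (-(α * (j / q))))‖ ≤
      9 * π / q * (1 + |(j : ℝ) - k|)⁻¹ + if (q : ℝ) / 2 < |t * q - j| then 2 * F j else 0 := by
    intro j hj
    rw [norm_mul, Complex.norm_real, Real.norm_eq_abs, abs_of_nonneg (hF0 j)]
    split_ifs with hfar
    · have : ‖eC (-(α * t)) - eC (-(α * (j / q)))‖ ≤ 2 :=
        (norm_sub_le _ _).trans (by rw [norm_eC, norm_eC]; norm_num)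
      have h3 : 0 ≤ 9 * π / q * (1 + |(j : ℝ) - k|)⁻¹ := by positivity
      nlinarith [hF0 j]
    · push Not at hfar
      rw [add_zero]
      set x := |t * q - j| with hx
      have hx0 : 0 ≤ x := abs_nonneg _
      have hFx : F j ≤ 9 / 4 * ((1 + x) ^ 2)⁻¹ := by
        have := fejerWeight_le hq (t := t) (j := j) (by linarith)
        rwa [← hx, min_eq_left (by linarith)] at this
      have hdiff : ‖eC (-(α * t)) - eC (-(α * (j / q)))‖ ≤ 2 * π * (x / q) := by
        refine (norm_eC_sub_eC_le _ _).trans ?_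
        have : -(α * t) - -(α * (j / q)) = -(α * ((t * q - j) / q)) := by
          field_simp
          ring
        rw [this, abs_neg, abs_mul, abs_div, abs_of_nonneg h0, abs_of_pos hq0, ← hx]
        gcongr
        exact mul_le_of_le_one_left (by positivity) h1
      have hjk : (1 + x)⁻¹ ≤ 2 * (1 + |(j : ℝ) - k|)⁻¹ := by
        have : |(j : ℝ) - k| ≤ x + 1 := by
          rcases abs_cases (t * q - j) with h | h <;> rcases abs_cases ((j : ℝ) - k) with h' | h' <;> linarith
        rw [← inv_inv (2 : ℝ), ← mul_inv]
        exact inv_anti₀ (by positivity) (by linarith)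
      have hxx : ((1 + x) ^ 2)⁻¹ * x ≤ (1 + x)⁻¹ := by
        rw [inv_mul_le_iff₀ (by positivity), sq, mul_assoc, mul_inv_cancel₀ (by positivity)]
        linarith
      calc _ ≤ (9 / 4 * ((1 + x) ^ 2)⁻¹) * (2 * π * (x / q)) := by gcongr
        _ = 9 / 2 * π / q * (((1 + x) ^ 2)⁻¹ * x) := by ring
        _ ≤ 9 / 2 * π / q * (2 * (1 + |(j : ℝ) - k|)⁻¹) := by
            exact mul_le_mul_of_nonneg_left (hxx.trans hjk) (by positivity)
        _ = _ := by ring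
  rw [heq]
  refine (norm_sum_le_of_le _ hterm).trans ?_
  rw [sum_add_distrib, ← mul_sum, ← sum_filter, ← mul_sum, ← hW]
  have hlog : 0 ≤ Real.log q := Real.log_natCast_nonneg q
  have hnear : 9 * π / q * ∑ j ∈ range q, (1 + |(j : ℝ) - k|)⁻¹ ≤ 57 * ((1 + Real.log q) / q) := by
    calc _ ≤ 9 * π / q * (2 * (1 + Real.log q)) := by
          gcongr
          exact sum_range_inv_abs_sub_le hkq
      _ = (18 * π) * ((1 + Real.log q) / q) := by ring
      _ ≤ _ := by
          gcongr
          linarith [pi_lt_d2]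
  have h14 : (14 : ℝ) / q ≤ 14 * ((1 + Real.log q) / q) := by
    rw [← mul_div_assoc]
    gcongr
    linarith
  linarith

/-- Exponential sums with integer parts are controlled by exponential sums without them. -/
lemma norm_sum_mul_eC_floor_le {q N : ℕ} (hq : 1 ≤ q) {α L M₁ M₂ : ℝ} (h0 : 0 ≤ α) (h1 : α ≤ 1)
    (hL : 0 ≤ L) (hM₂ : 0 ≤ M₂) {s : Finset ℕ} (hs : s ⊆ Ioc 0 N) (w : ℕ → ℂ) (hw : ∀ n ∈ s, ‖w n‖ ≤ L)
    (x : ℕ → ℝ) (hs₁ : ∀ h : ℤ, |h| < q → ‖∑ n ∈ s, w n * eC ((α + h) * x n)‖ ≤ M₁)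
    (hs₂ : ∀ h : ℤ, h ≠ 0 → |h| < q → ‖∑ n ∈ Ioc 0 N, eC (h * x n)‖ ≤ M₂) :
    ‖∑ n ∈ s, w n * eC (⌊x n⌋ * α)‖ ≤
      9 * (1 + Real.log q) * M₁ + L * (193 * (N * (1 + Real.log q) / q) + 108 * M₂) := by
  have hfloor : ∀ n, eC (⌊x n⌋ * α) = eC (α * x n) * eC (-(α * Int.fract (x n))) := fun n => by
    rw [← eC_add]
    congr 1
    rw [← Int.self_sub_fract]
    ring
  have hsplit : ∑ n ∈ s, w n * eC (⌊x n⌋ * α) =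
      ∑ n ∈ s, w n * eC (α * x n) * fejerInterp q α (Int.fract (x n)) +
      ∑ n ∈ s, w n * eC (α * x n) * (eC (-(α * Int.fract (x n))) - fejerInterp q α (Int.fract (x n))) := by
    rw [← sum_add_distrib]
    refine sum_congr rfl fun n _ => ?_
    rw [hfloor]
    ring
  have hmain := norm_sum_mul_fejerInterp_le hq h0 h1 s w x hs₁
  have herr : ‖∑ n ∈ s, w n * eC (α * x n) *
      (eC (-(α * Int.fract (x n))) - fejerInterp q α (Int.fract (x n)))‖ ≤
      L * (193 * (N * (1 + Real.log q) / q) + 108 * M₂) := by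
    calc _ ≤ ∑ n ∈ s, L * (85 * ((1 + Real.log q) / q) + 108 * fejerMean q (x n)) := by
          refine norm_sum_le_of_le _ fun n hn => ?_
          rw [norm_mul, norm_mul, norm_eC, mul_one, ← fejerMean_fract]
          exact mul_le_mul (hw n hn)
            (norm_eC_sub_fejerInterp_le hq h0 h1 (Int.fract_nonneg _) (Int.fract_lt_one _)) (norm_nonneg _) hL
      _ ≤ ∑ n ∈ Ioc 0 N, L * (85 * ((1 + Real.log q) / q) + 108 * fejerMean q (x n)) :=
          sum_le_sum_of_subset_of_nonneg hs fun n _ _ => by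
            have := Real.log_natCast_nonneg q
            rw [fejerMean]
            positivity
      _ = L * (85 * (N * (1 + Real.log q) / q) + 108 * ∑ n ∈ Ioc 0 N, fejerMean q (x n)) := by
          rw [← mul_sum, sum_add_distrib, ← mul_sum, ← mul_sum, sum_const, Nat.card_Ioc, nsmul_eq_mul, Nat.sub_zero]
          ring
      _ ≤ _ := by
          have := sum_fejerMean_le hq x hs₂ hM₂
          refine mul_le_mul_of_nonneg_left ?_ hL
          linarith
  rw [hsplit]
  exact (norm_add_le _ _).trans (add_le_add hmain herr)

/-- The sum with integer parts in terms of the sums over primes and over integers without them. -/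
lemma norm_SS_le {c K₁ K₂ P : ℝ} (hc1 : 1 < c) (hK₁ : 0 ≤ K₁) (hK₂ : 0 ≤ K₂)
    (hP : 2 ≤ P ^ (1 / 10000 : ℝ)) (hP1 : 1 < P) {α : ℝ} (hα0 : P ^ (1 - c - 1 / 1000) ≤ α)
    (hα1 : α ≤ 1 - P ^ (1 - c - 1 / 1000))
    (hprime : ∀ θ : ℝ, P ^ (1 - c - 1 / 1000) ≤ |θ| → |θ| ≤ P ^ (148 / 10000 : ℝ) →
      ‖∑ p ∈ (range (⌊P⌋₊ + 1)).filter Nat.Prime, (Real.log p : ℂ) * eC (θ * (p : ℝ) ^ c)‖ ≤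
        K₁ * P ^ (9854 / 10000 : ℝ))
    (hint : ∀ θ : ℝ, P ^ (1 - c - 1 / 1000) ≤ |θ| → |θ| ≤ P ^ (148 / 10000 : ℝ) →
      ‖∑ n ∈ Ioc 0 ⌊P⌋₊, eC (θ * (n : ℝ) ^ c)‖ ≤ K₂ * P ^ (86 / 100 : ℝ)) :
    ‖SS c P α‖ ≤ 9 * (1 + Real.log P) * (K₁ * P ^ (9854 / 10000 : ℝ)) +
      Real.log P * (193 * ((1 + Real.log P) * P ^ (9853 / 10000 : ℝ)) + 108 * (K₂ * P ^ (86 / 100 : ℝ))) := by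
  have hP0 : 0 < P := by linarith
  have hlogP : 0 ≤ Real.log P := Real.log_nonneg hP1.le
  have hτ0 : 0 < P ^ (1 - c - 1 / 1000) := Real.rpow_pos_of_pos hP0 _
  have hτ1 : P ^ (1 - c - 1 / 1000) ≤ 1 := Real.rpow_le_one_of_one_le_of_nonpos hP1.le (by linarith)
  set Y : ℝ := P ^ (147 / 10000 : ℝ) with hY
  have hY1 : 1 ≤ Y := Real.one_le_rpow hP1.le (by norm_num)
  set q : ℕ := ⌈Y⌉₊ with hq
  have hYq : Y ≤ q := Nat.le_ceil _
  have hq1 : 1 ≤ q := by exact_mod_cast hY1.trans hYq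
  have hqP : (q : ℝ) ≤ P ^ (148 / 10000 : ℝ) := by
    calc (q : ℝ) ≤ Y + 1 := (Nat.ceil_lt_add_one (by linarith)).le
      _ ≤ 2 * Y := by linarith
      _ ≤ P ^ (1 / 10000 : ℝ) * Y := by gcongr
      _ = _ := by
          rw [hY, ← Real.rpow_add hP0]
          norm_num
  have hlogq : Real.log q ≤ Real.log P := by
    refine Real.log_le_log (by exact_mod_cast hq1) (hqP.trans ?_)
    calc P ^ (148 / 10000 : ℝ) ≤ P ^ (1 : ℝ) := Real.rpow_le_rpow_of_exponent_le hP1.le (by norm_num)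
      _ = P := Real.rpow_one P
  have hmain := norm_sum_mul_eC_floor_le hq1 (N := ⌊P⌋₊) (α := α) (L := Real.log P)
    (M₁ := K₁ * P ^ (9854 / 10000 : ℝ)) (M₂ := K₂ * P ^ (86 / 100 : ℝ)) (by linarith) (by linarith) hlogP
    (by positivity) (s := (range (⌊P⌋₊ + 1)).filter Nat.Prime)
    (by rw [range_filter_prime_eq]; exact filter_subset _ _) (fun p => (Real.log p : ℂ))
    (fun p hp => by
      rw [mem_filter, mem_range] at hp
      rw [Complex.norm_real, Real.norm_eq_abs, abs_of_nonneg (Real.log_natCast_nonneg p)]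
      exact Real.log_le_log (by exact_mod_cast hp.2.pos)
        (le_trans (by exact_mod_cast Nat.lt_succ_iff.1 hp.1) (Nat.floor_le hP0.le)))
    (fun n => (n : ℝ) ^ c)
    (fun h hh => by
      have hh' : |(h : ℝ)| + 1 ≤ q := by exact_mod_cast hh
      refine hprime _ ?_ ?_
      · rcases le_or_gt 0 h with h' | h'
        · have : (0 : ℝ) ≤ h := by exact_mod_cast h'
          exact le_trans (by linarith) (le_abs_self _)
        · have : (h : ℝ) + 1 ≤ 0 := by exact_mod_cast h'
          exact le_trans (by linarith) (neg_le_abs _)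
      · refine (abs_add_le _ _).trans ?_
        rw [abs_of_nonneg (hτ0.le.trans hα0)]
        linarith)
    (fun h h0 hh => by
      have hh' : |(h : ℝ)| + 1 ≤ q := by exact_mod_cast hh
      have h1 : (1 : ℝ) ≤ |(h : ℝ)| := by exact_mod_cast Int.one_le_abs h0
      exact hint _ (hτ1.trans h1) (by linarith))
  have hfrac : (⌊P⌋₊ : ℝ) * (1 + Real.log q) / q ≤ (1 + Real.log P) * P ^ (9853 / 10000 : ℝ) := by
    have : P = P ^ (9853 / 10000 : ℝ) * Y := by
      rw [hY, ← Real.rpow_add hP0]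
      norm_num
    rw [div_le_iff₀ (by linarith)]
    calc (⌊P⌋₊ : ℝ) * (1 + Real.log q) ≤ P * (1 + Real.log P) := by
          gcongr
          exact Nat.floor_le hP0.le
      _ = (1 + Real.log P) * P ^ (9853 / 10000 : ℝ) * Y := by
          rw [mul_assoc, ← this, mul_comm]
      _ ≤ _ := by gcongr
  refine hmain.trans ?_
  gcongr

theorem stmt_13 (c : ℝ) (hc1 : 1 < c) (hc2 : c < 4109054 / 1999527) (hc3 : c ≠ 2) :
    ∃ ε₀ > 0, ∀ ε : ℝ, 0 < ε → ε ≤ ε₀ →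
      ∃ C > 0, ∃ P₀ : ℝ, ∀ P : ℝ, P₀ ≤ P →
        ∀ α : ℝ, P ^ (1 - c - ε) < α → α < 1 - P ^ (1 - c - ε) →
          ‖SS c P α‖ ≤ C * P ^ ((2627349 : ℝ) / 2666036 + ε) := by
  have hc2' : c ≤ 20551 / 10000 := hc2.le.trans (by norm_num)
  obtain ⟨K₁, hK₁, hprime⟩ := exists_norm_sum_prime_le hc1 hc2' hc3 (ne_natCast_of_le hc1 hc2' hc3)
  obtain ⟨K₂, hK₂, hint⟩ := exists_norm_sum_eC_rpow_le hc1 hc2' hc3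
  obtain ⟨P₁, hP₁⟩ := Filter.eventually_atTop.1
    ((tendsto_rpow_atTop (by norm_num : (0 : ℝ) < 1 / 10000)).eventually_ge_atTop 2)
  set A : ℝ := 1 + 1 / (1 / 100000) with hA
  have hA0 : 0 < A := by positivity
  refine ⟨1 / 1000, by norm_num, fun ε hε0 hε => ⟨9 * A * K₁ + 193 * A ^ 2 + 108 * A * K₂, by positivity, max P₁ 2,
    fun P hP α hα0 hα1 => ?_⟩⟩
  have hP1 : 1 < P := lt_of_lt_of_le one_lt_two ((le_max_right _ _).trans hP)
  have hP0 : 0 < P := by linarith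
  have hτ : P ^ (1 - c - 1 / 1000) ≤ P ^ (1 - c - ε) :=
    Real.rpow_le_rpow_of_exponent_le hP1.le (by linarith)
  have hbound := norm_SS_le hc1 (zero_le_one.trans hK₁) (zero_le_one.trans hK₂)
    (hP₁ P ((le_max_left _ _).trans hP)) hP1 (hτ.trans hα0.le) (by linarith) (hprime P hP1)
    (fun θ h1 h2 => by
      simpa using hint P hP1.le θ h1 h2 1 ⌊P⌋₊ le_rfl (by simpa using Nat.floor_le hP0.le))
  have hlogP : 0 ≤ Real.log P := Real.log_nonneg hP1.le
  have hlog : 1 + Real.log P ≤ A * P ^ (1 / 100000 : ℝ) := one_add_log_le_rpow (by norm_num) hP1.le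
  set R : ℝ := P ^ (1 / 100000 : ℝ) with hR
  set T : ℝ := P ^ ((2627349 : ℝ) / 2666036 + ε) with hT
  have e1 : R * P ^ (9854 / 10000 : ℝ) ≤ T := by
    rw [hR, hT, ← Real.rpow_add hP0]
    exact Real.rpow_le_rpow_of_exponent_le hP1.le (le_trans (by norm_num) (le_add_of_nonneg_right hε0.le))
  have e2 : R * (R * P ^ (9853 / 10000 : ℝ)) ≤ T := by
    rw [hR, hT, ← Real.rpow_add hP0, ← Real.rpow_add hP0]
    exact Real.rpow_le_rpow_of_exponent_le hP1.le (le_trans (by norm_num) (le_add_of_nonneg_right hε0.le))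
  have e3 : R * P ^ (86 / 100 : ℝ) ≤ T := by
    rw [hR, hT, ← Real.rpow_add hP0]
    exact Real.rpow_le_rpow_of_exponent_le hP1.le (le_trans (by norm_num) (le_add_of_nonneg_right hε0.le))
  calc ‖SS c P α‖ ≤ _ := hbound
    _ ≤ 9 * (A * R) * (K₁ * P ^ (9854 / 10000 : ℝ)) +
      (A * R) * (193 * ((A * R) * P ^ (9853 / 10000 : ℝ)) + 108 * (K₂ * P ^ (86 / 100 : ℝ))) := by
        gcongr
        linarith
    _ = 9 * A * K₁ * (R * P ^ (9854 / 10000 : ℝ)) + 193 * A ^ 2 * (R * (R * P ^ (9853 / 10000 : ℝ))) +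
        108 * A * K₂ * (R * P ^ (86 / 100 : ℝ)) := by ring
    _ ≤ 9 * A * K₁ * T + 193 * A ^ 2 * T + 108 * A * K₂ * T := by gcongr
    _ = _ := by ring
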